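/- arXiv:2603.11217 — 2 statements merged into one kernel-verified Lean document; each statement's English description precedes it below -/
import Mathlib

section
/- Let Ω ⊆ ℝ^n be a domain, p > n, m ∈ {1,…,n−1}, and let V be an m-dimensional linear subspace of ℝ^n with orthogonal complement V^⊥. Let f ∈ W^{1,p}(Ω : ℝ^N) be continuous. For each α with m < α < pm/(p−n+m), set β = (n−m) − p(1 − m/α). Then the set { a ∈ V^⊥ : ℋ^α(f(V_a ∩ Ω)) > 0 } has ℋ^β-measure zero. -/
open Set Filter MeasureTheory Metric Topology
open scoped ENNReal NNReal

noncomputable section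

/-- The maximal stretch `L_f(x,r) = sup {dist (f y) (f x) : y ∈ Ω, dist y x = r}`. -/
def maxStretch {X Y : Type*} [MetricSpace X] [MetricSpace Y]
    (Ω : Set X) (f : X → Y) (x : X) (r : ℝ) : ℝ :=
  sSup ((fun y => dist (f y) (f x)) '' {y ∈ Ω | dist y x = r})

/-- The minimal stretch `ℓ_f(x,r) = inf {dist (f y) (f x) : y ∈ Ω, dist y x = r}`. -/
def minStretch {X Y : Type*} [MetricSpace X] [MetricSpace Y]
    (Ω : Set X) (f : X → Y) (x : X) (r : ℝ) : ℝ :=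
  sInf ((fun y => dist (f y) (f x)) '' {y ∈ Ω | dist y x = r})

/-- `f` is a homeomorphism of `Ω` onto `Ω'`. -/
def IsHomeoOn {X Y : Type*} [TopologicalSpace X] [TopologicalSpace Y]
    (f : X → Y) (Ω : Set X) (Ω' : Set Y) : Prop :=
  Set.BijOn f Ω Ω' ∧ ContinuousOn f Ω ∧
    ∃ g : Y → X, Set.InvOn g f Ω Ω' ∧ ContinuousOn g Ω'

/-- `f : Ω → Ω'` is a `K`-quasiconformal homeomorphism:
it is a homeomorphism of `Ω` onto `Ω'` and
`limsup_{r → 0⁺} L_f(x,r)/ℓ_f(x,r) ≤ K` for every `x ∈ Ω`. -/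
def IsQCHomeoOn {X Y : Type*} [MetricSpace X] [MetricSpace Y]
    (K : ℝ) (f : X → Y) (Ω : Set X) (Ω' : Set Y) : Prop :=
  IsHomeoOn f Ω Ω' ∧
    ∀ x ∈ Ω, Filter.limsup (fun r => maxStretch Ω f x r / minStretch Ω f x r)
      (𝓝[>] (0:ℝ)) ≤ K

/-- A domain: a nonempty open connected set. -/
def IsEuclDomain {X : Type*} [TopologicalSpace X] (Ω : Set X) : Prop :=
  IsOpen Ω ∧ IsConnected Ω

/-- A continuous map `f` belongs to `W^{1,p}(Ω : ℝ^N)`: there is a locally integrable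
weak derivative `Df : Ω → (ℝ^n →L ℝ^N)` with `∫_Ω ‖Df‖^p < ∞`. -/
def MemW1p (n N : ℕ) (p : ℝ) (Ω : Set (EuclideanSpace ℝ (Fin n)))
    (f : EuclideanSpace ℝ (Fin n) → EuclideanSpace ℝ (Fin N)) : Prop :=
  ∃ Df : EuclideanSpace ℝ (Fin n) → (EuclideanSpace ℝ (Fin n) →L[ℝ] EuclideanSpace ℝ (Fin N)),
    LocallyIntegrableOn Df Ω volume ∧
    (∫⁻ x in Ω, ENNReal.ofReal (‖Df x‖ ^ p) ∂volume) < ⊤ ∧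
    ∀ φ : EuclideanSpace ℝ (Fin n) → ℝ, ContDiff ℝ (⊤ : ℕ∞) φ → HasCompactSupport φ →
      tsupport φ ⊆ Ω → ∀ v : EuclideanSpace ℝ (Fin n),
        (∫ x in Ω, (fderiv ℝ φ x v) • f x ∂volume) = - ∫ x in Ω, (φ x) • (Df x v) ∂volume

/-- `f ∈ W^{1,p}_loc(Ω : ℝ^N)`: the restriction of `f` to every open set compactly
contained in `Ω` belongs to `W^{1,p}`. -/
def MemW1pLoc (n N : ℕ) (p : ℝ) (Ω : Set (EuclideanSpace ℝ (Fin n)))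
    (f : EuclideanSpace ℝ (Fin n) → EuclideanSpace ℝ (Fin N)) : Prop :=
  ∀ U : Set (EuclideanSpace ℝ (Fin n)), IsOpen U → IsCompact (closure U) →
    closure U ⊆ Ω → MemW1p n N p U f

/-- Vitali covering bound: if every point of `A` has arbitrarily small balls whose `μ`-measure
exceeds `ε r ^ β`, then `ℋ^β(A)` is controlled by the measure of any open neighbourhood of `A`. -/
theorem hausdorffMeasure_le_of_frequently_lt_measure_closedBall {X : Type*}
    [NormedAddCommGroup X] [NormedSpace ℝ X] [FiniteDimensional ℝ X] [MeasurableSpace X]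
    [BorelSpace X] (μ : Measure X)
    {β : ℝ} (hβ : 0 < β) {ε : ℝ} (hε : 0 < ε) {A U : Set X} (hU : IsOpen U) (hAU : A ⊆ U)
    (hA : ∀ a ∈ A, ∃ᶠ r in 𝓝[>] (0 : ℝ), ENNReal.ofReal (ε * r ^ β) < μ (closedBall a r)) :
    μH[β] A ≤ ENNReal.ofReal (10 ^ β / ε) * μ U := by
  let T : ℕ → Set (X × ℝ) := fun k => {q | q.1 ∈ A ∧ 0 < q.2 ∧ q.2 < 1 / ((k : ℝ) + 1) ∧
    closedBall q.1 q.2 ⊆ U ∧ ENNReal.ofReal (ε * q.2 ^ β) < μ (closedBall q.1 q.2)}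
  have key : ∀ k, ∃ u ⊆ T k, (u.PairwiseDisjoint fun q => closedBall q.1 q.2) ∧
      ∀ q ∈ T k, ∃ b ∈ u, closedBall q.1 q.2 ⊆ closedBall b.1 (5 * b.2) := fun k =>
    Vitali.exists_disjoint_subfamily_covering_enlargement_closedBall (T k) (fun q => q.1)
      (fun q => q.2) (1 / ((k : ℝ) + 1)) (fun q hq => hq.2.2.1.le) 5 (by norm_num)
  choose u huT hdisj hcov using key
  have hcount : ∀ k, (u k).Countable := fun k =>
    (hdisj k).countable_of_nonempty_interior fun q hq =>
      ⟨q.1, ball_subset_interior_closedBall (mem_ball_self (huT k hq).2.1)⟩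
  have : ∀ k, Countable (u k) := fun k => (hcount k).to_subtype
  have hdiam : ∀ k (q : u k), ediam (closedBall q.1.1 (5 * q.1.2)) ≤
      ENNReal.ofReal (10 * q.1.2) := fun k q => by
    have h0 := (huT k q.2).2.1
    rw [← closedEBall_ofReal (by linarith)]
    refine ediam_closedEBall_le.trans (le_of_eq ?_)
    rw [show (2 : ℝ≥0∞) = ENNReal.ofReal 2 by simp, ← ENNReal.ofReal_mul (by norm_num)]
    ring_nf
  have h := Measure.hausdorffMeasure_le_liminf_tsum (ι := fun k => u k) β A (l := atTop)
    (fun k : ℕ => ENNReal.ofReal (10 * (1 / ((k : ℝ) + 1))))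
    (by
      have := (tendsto_one_div_add_atTop_nhds_zero_nat (𝕜 := ℝ)).const_mul 10
      simpa using ENNReal.tendsto_ofReal this)
    (fun k q => closedBall q.1.1 (5 * q.1.2))
    (Eventually.of_forall fun k q => (hdiam k q).trans
      (ENNReal.ofReal_le_ofReal (by linarith [(huT k q.2).2.2.1])))
    (Eventually.of_forall fun k a ha => by
      obtain ⟨δ, hδ, hδU⟩ := Metric.isOpen_iff.1 hU a (hAU ha)
      have h1 : ∀ᶠ r in 𝓝[>] (0 : ℝ), r < min δ (1 / ((k : ℝ) + 1)) :=
        nhdsWithin_le_nhds (Iio_mem_nhds (by positivity))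
      have h2 : ∀ᶠ r in 𝓝[>] (0 : ℝ), 0 < r := self_mem_nhdsWithin
      obtain ⟨r, hr, hr1, hr2⟩ := ((hA a ha).and_eventually (h1.and h2)).exists
      obtain ⟨b, hb, hsub⟩ := hcov k (a, r) ⟨ha, hr2, hr1.trans_le (min_le_right _ _),
        (closedBall_subset_ball (hr1.trans_le (min_le_left _ _))).trans hδU, hr⟩
      exact mem_iUnion.2 ⟨⟨b, hb⟩, hsub (mem_closedBall_self hr2.le)⟩)
  refine h.trans (liminf_le_of_frequently_le' (Eventually.frequently (Eventually.of_forall ?_)))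
  intro k
  calc ∑' q : u k, ediam (closedBall q.1.1 (5 * q.1.2)) ^ β
      ≤ ∑' q : u k, ENNReal.ofReal (10 ^ β / ε) * μ (closedBall q.1.1 q.1.2) := by
        refine ENNReal.tsum_le_tsum fun q => ?_
        obtain ⟨-, h0, -, -, hlt⟩ := huT k q.2
        refine (ENNReal.rpow_le_rpow (hdiam k q) hβ.le).trans ?_
        refine le_trans (le_of_eq ?_) (mul_le_mul_right hlt.le _)
        rw [ENNReal.ofReal_rpow_of_pos (by positivity), ← ENNReal.ofReal_mul (by positivity),
          Real.mul_rpow (by norm_num) h0.le]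
        congr 1
        field_simp
    _ = ENNReal.ofReal (10 ^ β / ε) * μ (⋃ q ∈ u k, closedBall q.1 q.2) := by
        rw [ENNReal.tsum_mul_left, measure_biUnion (hcount k) (hdisj k)
          (fun q _ => measurableSet_closedBall)]
    _ ≤ _ := by
        gcongr
        exact iUnion₂_subset fun q hq => (huT k hq).2.2.2.1

/-- If a finite measure `μ` is absolutely continuous with respect to `ℋ^d`, then for every
`0 < β < d` its upper `β`-density vanishes `ℋ^β`-almost everywhere. -/
theorem hausdorffMeasure_not_isLittleO_closedBall_eq_zero {X : Type*}
    [NormedAddCommGroup X] [NormedSpace ℝ X] [FiniteDimensional ℝ X] [MeasurableSpace X]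
    [BorelSpace X] (μ : Measure X) [IsFiniteMeasure μ]
    {β d : ℝ} (hβ : 0 < β) (hβd : β < d) (hμ : μ ≪ (μH[d] : Measure X)) :
    μH[β] {a : X | ¬ ∀ ε : ℝ, 0 < ε →
      ∀ᶠ r in 𝓝[>] (0 : ℝ), μ (closedBall a r) ≤ ENNReal.ofReal (ε * r ^ β)} = 0 := by
  have main : ∀ ε : ℝ, 0 < ε → μH[β] {a : X | ∃ᶠ r in 𝓝[>] (0 : ℝ),
      ENNReal.ofReal (ε * r ^ β) < μ (closedBall a r)} = 0 := by
    intro ε hε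
    set A := {a : X | ∃ᶠ r in 𝓝[>] (0 : ℝ), ENNReal.ofReal (ε * r ^ β) < μ (closedBall a r)}
    have hfin : μH[β] A < ⊤ :=
      (hausdorffMeasure_le_of_frequently_lt_measure_closedBall μ hβ hε isOpen_univ
        (subset_univ A) fun a ha => ha).trans_lt
        (ENNReal.mul_lt_top ENNReal.ofReal_lt_top (measure_lt_top _ _))
    have hd : μH[d] A = 0 :=
      (Measure.hausdorffMeasure_zero_or_top hβd A).resolve_right hfin.ne
    have hA0 : μ A = 0 := hμ hd
    refine le_antisymm (ENNReal.le_of_forall_pos_le_add fun η hη _ => ?_) zero_le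
    have hc : (0 : ℝ) < 10 ^ β / ε := by positivity
    obtain ⟨U, hAU, hU, hUη⟩ := A.exists_isOpen_lt_of_lt (μ := μ) (ENNReal.ofReal (η / (10 ^ β / ε)))
      (by rw [hA0]; simp only [ENNReal.ofReal_pos]; positivity)
    refine (hausdorffMeasure_le_of_frequently_lt_measure_closedBall μ hβ hε hU hAU
      fun a ha => ha).trans ?_
    refine (mul_le_mul_right hUη.le _).trans ?_
    rw [← ENNReal.ofReal_mul hc.le, mul_div_cancel₀ _ hc.ne']
    simp
  refine measure_mono_null (t := ⋃ k : ℕ, {a : X | ∃ᶠ r in 𝓝[>] (0 : ℝ),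
      ENNReal.ofReal (1 / ((k : ℝ) + 1) * r ^ β) < μ (closedBall a r)}) ?_
    (measure_iUnion_null fun k => main _ (by positivity))
  intro a ha
  simp only [mem_ofPred_eq, not_forall] at ha
  obtain ⟨ε, hε, h⟩ := ha
  obtain ⟨k, hk⟩ := exists_nat_one_div_lt hε
  refine mem_iUnion.2 ⟨k, ?_⟩
  have h' : ∃ᶠ r in 𝓝[>] (0 : ℝ), ENNReal.ofReal (ε * r ^ β) < μ (closedBall a r) :=
    (not_eventually.1 h).mono fun r hr => not_le.1 hr
  refine (h'.and_eventually self_mem_nhdsWithin).mono fun r hr => lt_of_le_of_lt ?_ hr.1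
  have : (0 : ℝ) < r := hr.2
  gcongr

/-- The derivative, with respect to the scale `ρ`, of the average of a continuous function against
the kernel `K` rescaled around `x`. -/
theorem hasDerivAt_integral_rescaled_kernel {n : ℕ} {F : Type*} [NormedAddCommGroup F]
    [NormedSpace ℝ F] {K : EuclideanSpace ℝ (Fin n) → ℝ} (hK : ContDiff ℝ (⊤ : ℕ∞) K)
    (hKc : HasCompactSupport K) {g : EuclideanSpace ℝ (Fin n) → F} (hg : Continuous g)
    (x : EuclideanSpace ℝ (Fin n)) {ρ₀ : ℝ} (hρ₀ : 0 < ρ₀) :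
    HasDerivAt (fun ρ : ℝ => ∫ y, (ρ ^ (-(n : ℤ)) * K (ρ⁻¹ • (y - x))) • g y)
      (∫ y, (-ρ₀ ^ (-(n : ℤ) - 1) * (n * K (ρ₀⁻¹ • (y - x)) +
        fderiv ℝ K (ρ₀⁻¹ • (y - x)) (ρ₀⁻¹ • (y - x)))) • g y) ρ₀ := by
  obtain ⟨M, hM⟩ := hKc.isCompact.isBounded.subset_closedBall (0 : EuclideanSpace ℝ (Fin n))
  have hdK : Continuous (fderiv ℝ K) := hK.continuous_fderiv (by simp)
  have hK0 : ∀ z, M < ‖z‖ → K z = 0 := fun z hz => image_eq_zero_of_notMem_tsupport fun h =>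
    (mem_closedBall_zero_iff.1 (hM h)).not_gt hz
  have hK1 : ∀ z, M < ‖z‖ → fderiv ℝ K z = 0 := fun z hz =>
    image_eq_zero_of_notMem_tsupport fun h =>
    (mem_closedBall_zero_iff.1 (hM (tsupport_fderiv_subset ℝ h))).not_gt hz
  have hout : ∀ ρ ∈ Icc (ρ₀ / 2) (2 * ρ₀), ∀ y ∉ closedBall x (2 * ρ₀ * M),
      M < ‖ρ⁻¹ • (y - x)‖ := by
    intro ρ hρ y hy
    have h0 : 0 < ρ := by linarith [hρ.1]
    rw [mem_closedBall, not_le, dist_eq_norm] at hy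
    rw [norm_smul, norm_inv, Real.norm_of_nonneg h0.le, inv_mul_eq_div, lt_div_iff₀ h0]
    rcases le_or_gt 0 M with h | h
    · nlinarith [hρ.2]
    · nlinarith [norm_nonneg (y - x), hρ.1]
  let G : ℝ → EuclideanSpace ℝ (Fin n) → F := fun ρ y =>
    (ρ ^ (-(n : ℤ)) * K (ρ⁻¹ • (y - x))) • g y
  let G' : ℝ → EuclideanSpace ℝ (Fin n) → F := fun ρ y =>
    (-ρ ^ (-(n : ℤ) - 1) * (n * K (ρ⁻¹ • (y - x)) +
        fderiv ℝ K (ρ⁻¹ • (y - x)) (ρ⁻¹ • (y - x)))) • g y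
  have hGcont : ∀ ρ, Continuous (G ρ) := fun ρ => by
    have := hK.continuous
    fun_prop
  have hG'cont : ContinuousOn (Function.uncurry G') (Icc (ρ₀ / 2) (2 * ρ₀) ×ˢ univ) := by
    have hne : ∀ q ∈ Icc (ρ₀ / 2) (2 * ρ₀) ×ˢ (univ : Set (EuclideanSpace ℝ (Fin n))),
        q.1 ≠ 0 := fun q hq => by
      have := hq.1.1
      linarith
    have hz : ContinuousOn (fun q : ℝ × EuclideanSpace ℝ (Fin n) => q.1⁻¹ • (q.2 - x))
        (Icc (ρ₀ / 2) (2 * ρ₀) ×ˢ univ) :=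
      (continuousOn_fst.inv₀ hne).smul (by fun_prop)
    refine ContinuousOn.smul (ContinuousOn.mul ?_ (ContinuousOn.add ?_ ?_))
      (hg.comp continuous_snd).continuousOn
    · exact (continuousOn_fst.zpow₀ _ fun q hq => Or.inl (hne q hq)).neg
    · exact continuousOn_const.mul (hK.continuous.comp_continuousOn hz)
    · exact (hdK.comp_continuousOn hz).clm_apply hz
  have hρmem : ρ₀ ∈ Icc (ρ₀ / 2) (2 * ρ₀) := ⟨by linarith, by linarith⟩
  have hcomp : IsCompact (Icc (ρ₀ / 2) (2 * ρ₀) ×ˢ closedBall x (2 * ρ₀ * M)) :=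
    isCompact_Icc.prod (isCompact_closedBall _ _)
  obtain ⟨B, hB⟩ := hcomp.exists_bound_of_continuousOn
    (hG'cont.mono (prod_mono_right (subset_univ _)))
  refine (hasDerivAt_integral_of_dominated_loc_of_deriv_le (F := G) (F' := G')
    (bound := (closedBall x (2 * ρ₀ * M)).indicator fun _ => B)
    (Icc_mem_nhds (a := ρ₀ / 2) (b := 2 * ρ₀) (by linarith) (by linarith))
    (Eventually.of_forall fun ρ => (hGcont ρ).aestronglyMeasurable) ?_ ?_ ?_ ?_ ?_).2
  · refine (hGcont ρ₀).integrable_of_hasCompactSupport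
      (HasCompactSupport.intro (isCompact_closedBall x (2 * ρ₀ * M)) fun y hy => ?_)
    simp [G, hK0 _ (hout ρ₀ hρmem y hy)]
  · refine Continuous.aestronglyMeasurable ?_
    rw [← continuousOn_univ]
    exact hG'cont.comp (f := fun y => (ρ₀, y)) (by fun_prop) fun y _ => ⟨hρmem, mem_univ _⟩
  · refine ae_of_all _ fun y ρ hρ => ?_
    by_cases hy : y ∈ closedBall x (2 * ρ₀ * M)
    · rw [indicator_of_mem hy]
      exact hB (ρ, y) ⟨hρ, hy⟩
    · rw [indicator_of_notMem hy]
      simp [G', hK0 _ (hout ρ hρ y hy), hK1 _ (hout ρ hρ y hy)]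
  · exact (integrable_indicator_iff measurableSet_closedBall).2
      (integrableOn_const (isCompact_closedBall _ _).measure_lt_top.ne)
  · refine ae_of_all _ fun y ρ hρ => ?_
    have h0 : ρ ≠ 0 := by linarith [hρ.1]
    have h1 : HasDerivAt (fun ρ : ℝ => ρ⁻¹ • (y - x)) (-(ρ ^ 2)⁻¹ • (y - x)) ρ :=
      (hasDerivAt_inv h0).smul_const _
    have h2 := ((hK.differentiable (by simp)).differentiableAt
      (x := ρ⁻¹ • (y - x))).hasFDerivAt.comp_hasDerivAt ρ h1
    have h3 := ((hasDerivAt_zpow (-(n : ℤ)) ρ (Or.inl h0)).mul h2).smul_const (g y)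
    convert! h3 using 2
    simp only [Function.comp, map_smul, smul_eq_mul, zpow_sub₀ h0, zpow_one]
    push_cast
    field_simp
    ring

/-- The divergence of the vector field `y ↦ ρ⁻ⁿ K(z) z`, where `z = ρ⁻¹ (y - x)`. -/
theorem sum_fderiv_rescaled_kernel_mul_coord {n : ℕ} {K : EuclideanSpace ℝ (Fin n) → ℝ}
    (hK : ContDiff ℝ (⊤ : ℕ∞) K) (x y : EuclideanSpace ℝ (Fin n)) {ρ : ℝ} (hρ : 0 < ρ) :
    ∑ i, fderiv ℝ (fun y => ρ ^ (-(n : ℤ)) * K (ρ⁻¹ • (y - x)) * (ρ⁻¹ • (y - x)) i) y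
        (EuclideanSpace.single i 1) =
      ρ ^ (-(n : ℤ) - 1) * (n * K (ρ⁻¹ • (y - x)) +
        fderiv ℝ K (ρ⁻¹ • (y - x)) (ρ⁻¹ • (y - x))) := by
  have hz : HasFDerivAt (fun y : EuclideanSpace ℝ (Fin n) => ρ⁻¹ • (y - x))
      (ρ⁻¹ • ContinuousLinearMap.id ℝ _) y :=
    ((hasFDerivAt_id y).sub_const x).const_smul ρ⁻¹
  have h2 := ((hK.differentiable (by simp)).differentiableAt
      (x := ρ⁻¹ • (y - x))).hasFDerivAt.comp y hz
  have hc : ∀ i, HasFDerivAt (fun y : EuclideanSpace ℝ (Fin n) => (ρ⁻¹ • (y - x)) i)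
      ((EuclideanSpace.proj i).comp (ρ⁻¹ • ContinuousLinearMap.id ℝ _)) y := fun i =>
    (EuclideanSpace.proj i : EuclideanSpace ℝ (Fin n) →L[ℝ] ℝ).hasFDerivAt.comp y hz
  have hd : ∀ i, fderiv ℝ (fun y => ρ ^ (-(n : ℤ)) * K (ρ⁻¹ • (y - x)) * (ρ⁻¹ • (y - x)) i) y
        (EuclideanSpace.single i 1) = ρ ^ (-(n : ℤ) - 1) * (K (ρ⁻¹ • (y - x)) +
          (ρ⁻¹ • (y - x)) i * fderiv ℝ K (ρ⁻¹ • (y - x)) (EuclideanSpace.single i 1)) := by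
    intro i
    have h3 := ((h2.const_mul (ρ ^ (-(n : ℤ)))).mul (hc i)).fderiv
    refine (congrArg (fun L => L (EuclideanSpace.single i 1)) h3).trans ?_
    simp [zpow_sub₀ hρ.ne']
    ring
  have hsum : (ρ⁻¹ • (y - x)) =
      ∑ i, (ρ⁻¹ • (y - x)) i • (EuclideanSpace.single i (1 : ℝ) : EuclideanSpace ℝ (Fin n)) := by
    ext j
    simp [Finset.sum_apply, Pi.single_apply]
  rw [Finset.sum_congr rfl fun i _ => hd i, ← Finset.mul_sum, Finset.sum_add_distrib]
  congr 1
  conv_rhs => rw [show ∀ L : EuclideanSpace ℝ (Fin n) →L[ℝ] ℝ, L (ρ⁻¹ • (y - x)) =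
    ∑ i, (ρ⁻¹ • (y - x)) i * L (EuclideanSpace.single i (1 : ℝ)) from fun L => by
      conv_lhs => rw [hsum]
      simp only [map_sum, map_smul, smul_eq_mul]]
  simp

/-- The derivative in the scale of the averages of `g` against a rescaled kernel is an average of
the weak derivative of `g`. -/
theorem integral_rescaled_kernel_deriv_eq {n : ℕ} {F : Type*} [NormedAddCommGroup F]
    [NormedSpace ℝ F] {K : EuclideanSpace ℝ (Fin n) → ℝ} (hK : ContDiff ℝ (⊤ : ℕ∞) K)
    {g : EuclideanSpace ℝ (Fin n) → F} (hg : Continuous g)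
    {T : Set (EuclideanSpace ℝ (Fin n))} (hT : IsCompact T)
    {Dg : EuclideanSpace ℝ (Fin n) → EuclideanSpace ℝ (Fin n) →L[ℝ] F}
    (hDg : IntegrableOn Dg T)
    (hw : ∀ φ : EuclideanSpace ℝ (Fin n) → ℝ, ContDiff ℝ (⊤ : ℕ∞) φ → tsupport φ ⊆ T →
      ∀ v, ∫ y in T, (fderiv ℝ φ y v) • g y = - ∫ y in T, φ y • Dg y v)
    (x : EuclideanSpace ℝ (Fin n)) {ρ : ℝ} (hρ : 0 < ρ)
    (hsupp : tsupport (fun y => K (ρ⁻¹ • (y - x))) ⊆ T) :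
    ∫ y, (-ρ ^ (-(n : ℤ) - 1) * (n * K (ρ⁻¹ • (y - x)) +
        fderiv ℝ K (ρ⁻¹ • (y - x)) (ρ⁻¹ • (y - x)))) • g y =
      ∫ y in T, (ρ ^ (-(n : ℤ)) * K (ρ⁻¹ • (y - x))) • Dg y (ρ⁻¹ • (y - x)) := by
  let ψ : Fin n → EuclideanSpace ℝ (Fin n) → ℝ := fun i y =>
    ρ ^ (-(n : ℤ)) * K (ρ⁻¹ • (y - x)) * (ρ⁻¹ • (y - x)) i
  have hψ : ∀ i, ContDiff ℝ (⊤ : ℕ∞) (ψ i) := fun i => by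
    have h1 : ContDiff ℝ (⊤ : ℕ∞) fun y : EuclideanSpace ℝ (Fin n) => ρ⁻¹ • (y - x) := by
      fun_prop
    exact (contDiff_const.mul (hK.comp h1)).mul
      ((EuclideanSpace.proj i : EuclideanSpace ℝ (Fin n) →L[ℝ] ℝ).contDiff.comp h1)
  have hψs : ∀ i, tsupport (ψ i) ⊆ T := fun i =>
    (closure_mono fun y hy => Function.mem_support.2 fun hy0 =>
      Function.mem_support.1 hy (by simp only [ψ, hy0]; ring)).trans hsupp
  have hψd : ∀ i, ∀ y ∉ T, fderiv ℝ (ψ i) y = 0 := fun i y hy =>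
    image_eq_zero_of_notMem_tsupport fun h => hy (hψs i (tsupport_fderiv_subset ℝ h))
  have hint1 : ∀ i, IntegrableOn
      (fun y => (fderiv ℝ (ψ i) y (EuclideanSpace.single i 1)) • g y) T := fun i => by
    refine ContinuousOn.integrableOn_compact hT (Continuous.continuousOn ?_)
    have := (hψ i).continuous_fderiv (by simp)
    fun_prop
  have hint2 : ∀ i, IntegrableOn (fun y => ψ i y • Dg y (EuclideanSpace.single i 1)) T :=
    fun i => IntegrableOn.continuousOn_smul
      (hDg.apply_continuousLinearMap (EuclideanSpace.single i 1))
      (hψ i).continuous.continuousOn hT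
  have hdiv := fun y => sum_fderiv_rescaled_kernel_mul_coord hK x y hρ
  calc ∫ y, (-ρ ^ (-(n : ℤ) - 1) * (n * K (ρ⁻¹ • (y - x)) +
        fderiv ℝ K (ρ⁻¹ • (y - x)) (ρ⁻¹ • (y - x)))) • g y
      = ∫ y, - ∑ i, (fderiv ℝ (ψ i) y (EuclideanSpace.single i 1)) • g y := by
        congr 1 with y
        rw [← Finset.sum_smul, hdiv y, ← neg_smul, neg_mul]
    _ = - ∫ y in T, ∑ i, (fderiv ℝ (ψ i) y (EuclideanSpace.single i 1)) • g y := by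
        rw [integral_neg, setIntegral_eq_integral_of_forall_compl_eq_zero fun y hy => ?_]
        simp [hψd _ y hy]
    _ = ∑ i, ∫ y in T, ψ i y • Dg y (EuclideanSpace.single i 1) := by
        rw [integral_finsetSum _ fun i _ => hint1 i, ← Finset.sum_neg_distrib]
        exact Finset.sum_congr rfl fun i _ => by rw [hw (ψ i) (hψ i) (hψs i), neg_neg]
    _ = _ := by
        rw [← integral_finsetSum _ fun i _ => hint2 i]
        congr 1 with y
        have hsum : (ρ⁻¹ • (y - x)) = ∑ i, (ρ⁻¹ • (y - x)) i •
            (EuclideanSpace.single i (1 : ℝ) : EuclideanSpace ℝ (Fin n)) := by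
          ext j
          simp [Finset.sum_apply, Pi.single_apply]
        conv_rhs => rw [show ∀ L : EuclideanSpace ℝ (Fin n) →L[ℝ] F, L (ρ⁻¹ • (y - x)) =
          ∑ i, (ρ⁻¹ • (y - x)) i • L (EuclideanSpace.single i (1 : ℝ)) from fun L => by
            conv_lhs => rw [hsum]
            simp only [map_sum, map_smul]]
        simp only [ψ, Finset.smul_sum, mul_smul]

/-- Hölder's inequality against the constant function `1` on a set of finite measure. -/
theorem setIntegral_norm_le_of_lintegral_rpow_le {X F : Type*} [MeasurableSpace X]
    [NormedAddCommGroup F] {μ : Measure X} {u : X → F} {B : Set X} (hu : IntegrableOn u B μ)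
    (hB : μ B ≠ ⊤) {p : ℝ} (hp : 1 < p) {M : ℝ} (hM : 0 ≤ M)
    (h : ∫⁻ y in B, ‖u y‖ₑ ^ p ∂μ ≤ ENNReal.ofReal (M ^ p)) :
    ∫ y in B, ‖u y‖ ∂μ ≤ μ.real B ^ (1 - 1 / p) * M := by
  have hp0 : 0 < p := by linarith
  rw [integral_norm_eq_lintegral_enorm hu.aestronglyMeasurable]
  refine ENNReal.toReal_le_of_le_ofReal (by positivity) ?_
  have hH := ENNReal.lintegral_mul_le_Lp_mul_Lq (μ.restrict B) (Real.HolderConjugate.conjExponent hp)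
    hu.aestronglyMeasurable.enorm (g := fun _ => 1) aemeasurable_const
  simp only [Pi.mul_apply, mul_one, ENNReal.one_rpow, lintegral_const, Measure.restrict_apply_univ,
    one_mul] at hH
  refine hH.trans ?_
  have he : 1 / p.conjExponent = 1 - 1 / p := by
    rw [Real.conjExponent]
    field_simp
  rw [mul_comm, ENNReal.ofReal_mul (by positivity), he]
  refine mul_le_mul' (le_of_eq ?_) ?_
  · rw [Measure.real, ENNReal.toReal_rpow, ENNReal.ofReal_toReal]
    exact ENNReal.rpow_ne_top_of_nonneg (by
      have : 1 / p ≤ 1 := by rw [div_le_one hp0]; exact hp.le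
      linarith) hB
  · refine (ENNReal.rpow_le_rpow h (by positivity)).trans (le_of_eq ?_)
    rw [ENNReal.ofReal_rpow_of_nonneg (by positivity) (by positivity), ← Real.rpow_mul hM,
      mul_one_div_cancel hp0.ne', Real.rpow_one]

theorem norm_setIntegral_rescaled_kernel_le {n : ℕ} {F : Type*} [NormedAddCommGroup F]
    [NormedSpace ℝ F] {K : EuclideanSpace ℝ (Fin n) → ℝ} {A R : ℝ} (hA : ∀ z, ‖K z‖ ≤ A)
    (hR : ∀ z, K z ≠ 0 → ‖z‖ ≤ R) (hR0 : 0 ≤ R) {x : EuclideanSpace ℝ (Fin n)} {ρ : ℝ} (hρ : 0 < ρ)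
    {B T : Set (EuclideanSpace ℝ (Fin n))} (hT : MeasurableSet T)
    (hBT : B ⊆ T) (hB : ∀ y, K (ρ⁻¹ • (y - x)) ≠ 0 → y ∈ B) (hBv : volume B ≠ ⊤)
    {Dg : EuclideanSpace ℝ (Fin n) → EuclideanSpace ℝ (Fin n) →L[ℝ] F}
    (hDg : IntegrableOn Dg T) {p : ℝ} (hp : 1 < p) {M : ℝ} (hM : 0 ≤ M)
    (h : ∫⁻ y in B, ‖Dg y‖ₑ ^ p ≤ ENNReal.ofReal (M ^ p)) :
    ‖∫ y in T, (ρ ^ (-(n : ℤ)) * K (ρ⁻¹ • (y - x))) • Dg y (ρ⁻¹ • (y - x))‖ ≤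
      ρ ^ (-(n : ℤ)) * A * R * (volume.real B ^ (1 - 1 / p) * M) := by
  have hA0 : 0 ≤ A := (norm_nonneg _).trans (hA 0)
  rw [setIntegral_eq_of_subset_of_forall_sdiff_eq_zero hT hBT fun y hy => ?_]
  · have hint : IntegrableOn (fun y => ρ ^ (-(n : ℤ)) * A * R * ‖Dg y‖) B :=
      ((hDg.mono_set hBT).norm).const_mul _
    refine (norm_integral_le_of_norm_le hint (ae_of_all _ fun y => ?_)).trans ?_
    · by_cases hy : K (ρ⁻¹ • (y - x)) = 0
      · simp only [hy, mul_zero, zero_smul, norm_zero]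
        positivity
      · rw [norm_smul, norm_mul, Real.norm_of_nonneg (by positivity : 0 ≤ ρ ^ (-(n : ℤ)))]
        calc ρ ^ (-(n : ℤ)) * ‖K (ρ⁻¹ • (y - x))‖ * ‖Dg y (ρ⁻¹ • (y - x))‖
            ≤ ρ ^ (-(n : ℤ)) * A * (‖Dg y‖ * R) := by
              gcongr
              · exact hA _
              · exact (Dg y).le_opNorm_of_le (hR _ hy)
          _ = _ := by ring
    · rw [integral_const_mul]
      gcongr
      exact setIntegral_norm_le_of_lintegral_rpow_le (hDg.mono_set hBT) hBv hp hM h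
  · by_contra hne
    exact hy.2 (hB y fun h0 => hne (by simp [h0]))

/-- Averages against a kernel of integral one, rescaled around `x`, converge to the value
at `x`. -/
theorem tendsto_integral_rescaled_kernel {n : ℕ} {F : Type*} [NormedAddCommGroup F]
    [NormedSpace ℝ F] [CompleteSpace F] {K : EuclideanSpace ℝ (Fin n) → ℝ} (hK : Continuous K)
    (hKc : HasCompactSupport K) (hK1 : ∫ z, K z = 1) {g : EuclideanSpace ℝ (Fin n) → F}
    (hg : Continuous g) (x : EuclideanSpace ℝ (Fin n)) :
    Tendsto (fun ρ : ℝ => ∫ y, (ρ ^ (-(n : ℤ)) * K (ρ⁻¹ • (y - x))) • g y) (𝓝[>] 0)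
      (𝓝 (g x)) := by
  have h1 : Continuous fun ρ : ℝ => ∫ z in tsupport K, K z • g (x + ρ • z) :=
    continuous_parametric_integral_of_continuous (f := fun ρ z => K z • g (x + ρ • z))
      (by fun_prop) hKc.isCompact
  have h2 : ∀ ρ : ℝ, ∫ z in tsupport K, K z • g (x + ρ • z) = ∫ z, K z • g (x + ρ • z) :=
    fun ρ => setIntegral_eq_integral_of_forall_compl_eq_zero fun z hz => by
      simp [image_eq_zero_of_notMem_tsupport hz]
  have h3 := (h1.tendsto 0).mono_left (nhdsWithin_le_nhds (s := Ioi 0))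
  have h5 : ∫ z in tsupport K, K z = 1 := by
    rw [← hK1]
    exact setIntegral_eq_integral_of_forall_compl_eq_zero fun z hz =>
      image_eq_zero_of_notMem_tsupport hz
  simp only [zero_smul, add_zero, integral_smul_const, h5, one_smul] at h3
  simp only [h2] at h3
  refine h3.congr' (eventually_nhdsWithin_of_forall fun ρ (hρ : 0 < ρ) => ?_)
  have h4 := integral_sub_right_eq_self (μ := volume)
    (fun w => K (ρ⁻¹ • w) • g (x + ρ • ρ⁻¹ • w)) x
  rw [Measure.integral_comp_smul volume (fun z => K z • g (x + ρ • z)) ρ⁻¹] at h4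
  simp only [smul_inv_smul₀ hρ.ne', add_sub_cancel, finrank_euclideanSpace, Fintype.card_fin] at h4
  simp only [mul_smul, integral_smul]
  rw [h4, smul_smul, abs_of_pos (by positivity), inv_pow, inv_inv, zpow_neg, zpow_natCast,
    inv_mul_cancel₀ (by positivity), one_smul]

/-- The constant in Morrey's estimate `norm_integral_bump_sub_le`. -/
def morreyConst (n : ℕ) (p L : ℝ) : ℝ :=
  (2 ^ n / volume.real (ball (0 : EuclideanSpace ℝ (Fin n)) 1)) * (L + 1) *
    volume.real (ball (0 : EuclideanSpace ℝ (Fin n)) 1) ^ (1 - 1 / p) / (1 - n / p)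

theorem morreyConst_nonneg {n : ℕ} {p L : ℝ} (hp : n < p) (hL : 0 ≤ L) :
    0 ≤ morreyConst n p L := by
  have : (n : ℝ) / p ≤ 1 := div_le_one_of_le₀ hp.le ((Nat.cast_nonneg n).trans hp.le)
  have : 0 ≤ 1 - n / p := by linarith
  rw [morreyConst]
  positivity

/-- The value of `g` at a point `x` of a convex set `S` differs from its average over a ball
contained in `S` by at most a multiple of the `L^p` norm over `S` of the weak derivative of `g`. -/
theorem norm_integral_bump_sub_le {n : ℕ} (hn : 0 < n) {F : Type*} [NormedAddCommGroup F]
    [NormedSpace ℝ F] [CompleteSpace F] {p : ℝ} (hp : n < p)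
    {g : EuclideanSpace ℝ (Fin n) → F} (hg : Continuous g)
    {T S : Set (EuclideanSpace ℝ (Fin n))} (hT : IsCompact T)
    {Dg : EuclideanSpace ℝ (Fin n) → EuclideanSpace ℝ (Fin n) →L[ℝ] F}
    (hDg : IntegrableOn Dg T)
    (hw : ∀ φ : EuclideanSpace ℝ (Fin n) → ℝ, ContDiff ℝ (⊤ : ℕ∞) φ → tsupport φ ⊆ T →
      ∀ v, ∫ y in T, (fderiv ℝ φ y v) • g y = - ∫ y in T, φ y • Dg y v)
    (hS : Convex ℝ S) (hST : S ⊆ T) {c x : EuclideanSpace ℝ (Fin n)} {r L : ℝ} (hL : 0 ≤ L)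
    (hx : x ∈ S) (hxc : dist x c ≤ L * r)
    (b : ContDiffBump (0 : EuclideanSpace ℝ (Fin n))) (hb1 : b.rIn = r / 2) (hb2 : b.rOut = r)
    (hcS : ball c r ⊆ S) {M : ℝ} (hM : 0 ≤ M)
    (hI : ∫⁻ y in S, ‖Dg y‖ₑ ^ p ≤ ENNReal.ofReal (M ^ p)) :
    ‖(∫ y, b.normed volume (y - c) • g y) - g x‖ ≤ morreyConst n p L * r ^ (1 - n / p) * M := by
  have hr : 0 < r := hb2 ▸ b.rOut_pos
  have hn1 : (1 : ℝ) ≤ n := by exact_mod_cast hn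
  have hp0 : 0 < p := by linarith
  have : Nonempty (Fin n) := ⟨⟨0, hn⟩⟩
  have hs : 0 < 1 - n / p := by
    have : n / p < 1 := (div_lt_one hp0).2 hp
    linarith
  set ω := volume.real (ball (0 : EuclideanSpace ℝ (Fin n)) 1) with hω
  have hω0 : 0 < ω := ENNReal.toReal_pos (measure_ball_pos _ _ one_pos).ne' measure_ball_lt_top.ne
  have hball : ∀ (z : EuclideanSpace ℝ (Fin n)) {t : ℝ}, 0 < t →
      volume.real (ball z t) = t ^ n * ω := fun z t ht => by
    rw [Measure.real, Measure.addHaar_ball_of_pos _ _ ht, ENNReal.toReal_mul,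
      ENNReal.toReal_ofReal (by positivity), finrank_euclideanSpace, Fintype.card_fin]
    rfl
  let K : EuclideanSpace ℝ (Fin n) → ℝ := fun z => b.normed volume (z - (c - x))
  have hK : ContDiff ℝ (⊤ : ℕ∞) K := b.contDiff_normed.comp (contDiff_id.sub contDiff_const)
  have hKsupp : ∀ z, K z ≠ 0 → z - (c - x) ∈ ball (0 : EuclideanSpace ℝ (Fin n)) r :=
    fun z hz => by
      rw [← hb2, ← b.support_normed_eq (μ := volume)]
      exact hz
  have hKc : HasCompactSupport K :=
    HasCompactSupport.intro (isCompact_closedBall (c - x) r) fun z hz => by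
      by_contra h
      refine hz ?_
      have := hKsupp z h
      rw [mem_ball_zero_iff] at this
      rw [mem_closedBall, dist_eq_norm]
      exact this.le
  have hK1 : ∫ z, K z = 1 :=
    (integral_sub_right_eq_self (b.normed volume) (c - x)).trans b.integral_normed
  have hKA : ∀ z, ‖K z‖ ≤ 2 ^ n / (ω * r ^ n) := fun z => by
    rw [Real.norm_of_nonneg (b.nonneg_normed _)]
    refine (b.normed_le_div_measure_closedBall_rIn volume _).trans (le_of_eq ?_)
    rw [Measure.real, Measure.addHaar_closedBall_eq_addHaar_ball, ← Measure.real, hb1,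
      hball _ (by positivity)]
    field_simp
    rw [← mul_pow, div_mul_cancel₀ _ two_ne_zero]
  have hKR : ∀ z, K z ≠ 0 → ‖z‖ ≤ (L + 1) * r := fun z hz => by
    have h1 := mem_ball_zero_iff.1 (hKsupp z hz)
    have h2 : ‖c - x‖ ≤ L * r := by rwa [← dist_eq_norm, dist_comm]
    calc ‖z‖ = ‖(z - (c - x)) + (c - x)‖ := by rw [sub_add_cancel]
      _ ≤ ‖z - (c - x)‖ + ‖c - x‖ := norm_add_le _ _
      _ ≤ _ := by linarith
  have hKB : ∀ ρ : ℝ, 0 < ρ → ∀ y, K (ρ⁻¹ • (y - x)) ≠ 0 → y ∈ ball (x + ρ • (c - x)) (ρ * r) := by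
    intro ρ hρ y hy
    have h1 := mem_ball_zero_iff.1 (hKsupp _ hy)
    rw [mem_ball, dist_eq_norm]
    calc ‖y - (x + ρ • (c - x))‖ = ‖ρ • (ρ⁻¹ • (y - x) - (c - x))‖ := by
          rw [smul_sub ρ (ρ⁻¹ • (y - x)), smul_inv_smul₀ hρ.ne', sub_sub]
      _ = ρ * ‖ρ⁻¹ • (y - x) - (c - x)‖ := by rw [norm_smul, Real.norm_of_nonneg hρ.le]
      _ < ρ * r := by gcongr
  have hBS : ∀ ρ : ℝ, 0 < ρ → ρ ≤ 1 → ball (x + ρ • (c - x)) (ρ * r) ⊆ S := by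
    intro ρ hρ hρ1 y hy
    have h1 : c + ρ⁻¹ • (y - (x + ρ • (c - x))) ∈ S := hcS (by
      rw [mem_ball, dist_eq_norm, add_sub_cancel_left, norm_smul, norm_inv,
        Real.norm_of_nonneg hρ.le, inv_mul_eq_div, div_lt_iff₀ hρ, mul_comm r]
      rwa [mem_ball, dist_eq_norm] at hy)
    have h2 := hS hx h1 (by linarith : 0 ≤ 1 - ρ) hρ.le (by ring)
    convert h2 using 1
    rw [smul_add, smul_inv_smul₀ hρ.ne', sub_smul, one_smul, smul_sub]
    abel
  let Φ : ℝ → F := fun ρ => ∫ y, (ρ ^ (-(n : ℤ)) * K (ρ⁻¹ • (y - x))) • g y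
  let Φ' : ℝ → F := fun ρ =>
    ∫ y in T, (ρ ^ (-(n : ℤ)) * K (ρ⁻¹ • (y - x))) • Dg y (ρ⁻¹ • (y - x))
  have hΦ : ∀ ρ : ℝ, 0 < ρ → ρ ≤ 1 → HasDerivAt Φ (Φ' ρ) ρ := by
    intro ρ hρ hρ1
    have h1 := hasDerivAt_integral_rescaled_kernel hK hKc hg x hρ
    rwa [integral_rescaled_kernel_deriv_eq hK hg hT hDg hw x hρ] at h1
    refine closure_minimal (fun y hy => hST (hBS ρ hρ hρ1 (hKB ρ hρ y hy))) hT.isClosed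
  set C₀ := 2 ^ n / ω * (L + 1) * ω ^ (1 - 1 / p) * r ^ (1 - n / p) * M with hC₀
  have hΦ' : ∀ ρ : ℝ, 0 < ρ → ρ ≤ 1 → ‖Φ' ρ‖ ≤ C₀ * ρ ^ (-(n / p)) := by
    intro ρ hρ hρ1
    refine (norm_setIntegral_rescaled_kernel_le hKA hKR (by positivity) hρ hT.measurableSet
      ((hBS ρ hρ hρ1).trans hST) (hKB ρ hρ) measure_ball_lt_top.ne hDg
      (by linarith) hM ((lintegral_mono_set (hBS ρ hρ hρ1)).trans hI)).trans (le_of_eq ?_)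
    rw [hball _ (by positivity)]
    have e1 : ((ρ * r) ^ n * ω) ^ (1 - 1 / p) =
        ρ ^ n * ρ ^ (-(n / p)) * (r ^ n * r ^ (-(n / p))) * ω ^ (1 - 1 / p) := by
      have h1 : ∀ t : ℝ, 0 < t → t ^ n * t ^ (-(n / p)) = (t ^ n) ^ (1 - 1 / p) := fun t ht => by
        rw [← Real.rpow_natCast, ← Real.rpow_mul ht.le, ← Real.rpow_add ht]
        congr 1
        field_simp
        ring
      rw [h1 _ hρ, h1 _ hr, Real.mul_rpow (by positivity) hω0.le, mul_pow,
        Real.mul_rpow (by positivity) (by positivity)]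
    have e2 : r ^ (1 - n / p) = r * r ^ (-(n / p)) := by
      rw [sub_eq_add_neg, Real.rpow_add hr, Real.rpow_one]
    rw [e1, hC₀, e2, zpow_neg, zpow_natCast]
    field_simp
  have hC₀0 : 0 ≤ C₀ := by positivity
  have hδ : ∀ δ : ℝ, 0 < δ → δ ≤ 1 → ‖Φ 1 - Φ δ‖ ≤ C₀ / (1 - n / p) := by
    intro δ hδ hδ1
    have h1 := image_norm_le_of_norm_deriv_right_le_deriv_boundary' (a := δ) (b := 1)
      (f := fun ρ => Φ ρ - Φ δ) (f' := Φ')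
      (B := fun ρ => C₀ / (1 - n / p) * (ρ ^ (1 - n / p) - δ ^ (1 - n / p)))
      (B' := fun ρ => C₀ * ρ ^ (-(n / p)))
      (fun ρ hρ => ((hΦ ρ (hδ.trans_le hρ.1) hρ.2).sub_const _).continuousAt.continuousWithinAt)
      (fun ρ hρ => ((hΦ ρ (hδ.trans_le hρ.1) hρ.2.le).sub_const _).hasDerivWithinAt)
      (by simp)
      (((continuous_id.rpow_const fun _ => Or.inr hs.le).sub continuous_const).const_mul
        _).continuousOn
      (fun ρ hρ => by
        have h0 : 0 < ρ := hδ.trans_le hρ.1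
        have h2 := ((Real.hasDerivAt_rpow_const (p := 1 - n / p) (Or.inl h0.ne')).sub_const
          (δ ^ (1 - n / p))).const_mul (C₀ / (1 - n / p))
        refine (h2.congr_deriv ?_).hasDerivWithinAt
        rw [show (1 : ℝ) - n / p - 1 = -(n / p) by ring]
        rw [← mul_assoc, div_mul_cancel₀ _ hs.ne'])
      (fun ρ hρ => hΦ' ρ (hδ.trans_le hρ.1) hρ.2.le) (right_mem_Icc.2 hδ1)
    refine h1.trans ?_
    rw [Real.one_rpow]
    have : 0 ≤ δ ^ (1 - n / p) := by positivity
    exact mul_le_of_le_one_right (by positivity) (by linarith)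
  have hlim := tendsto_integral_rescaled_kernel hK.continuous hKc hK1 hg x
  have hfin : ‖Φ 1 - g x‖ ≤ C₀ / (1 - n / p) := by
    refine le_of_tendsto (tendsto_const_nhds.sub hlim).norm ?_
    filter_upwards [self_mem_nhdsWithin, nhdsWithin_le_nhds (Iic_mem_nhds zero_lt_one)]
      with δ h1 h2 using hδ δ h1 h2
  have hΦ1 : Φ 1 = ∫ y, b.normed volume (y - c) • g y := by
    simp only [Φ, K]
    congr 1 with y
    simp
  rw [← hΦ1]
  refine hfin.trans (le_of_eq ?_)
  rw [hC₀, morreyConst, ← hω]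
  ring

/-- Morrey's estimate on a convex set `S` pinched between two concentric balls. -/
theorem ediam_image_le_of_lintegral_weakDeriv {n N : ℕ} (hn : 0 < n) {p : ℝ} (hp : n < p)
    {Ω : Set (EuclideanSpace ℝ (Fin n))} (hΩ : IsOpen Ω)
    {f : EuclideanSpace ℝ (Fin n) → EuclideanSpace ℝ (Fin N)} (hfc : ContinuousOn f Ω)
    {Df : EuclideanSpace ℝ (Fin n) → EuclideanSpace ℝ (Fin n) →L[ℝ] EuclideanSpace ℝ (Fin N)}
    (hDf : LocallyIntegrableOn Df Ω volume)
    (hw : ∀ φ : EuclideanSpace ℝ (Fin n) → ℝ, ContDiff ℝ (⊤ : ℕ∞) φ → HasCompactSupport φ →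
      tsupport φ ⊆ Ω → ∀ v : EuclideanSpace ℝ (Fin n),
        (∫ x in Ω, (fderiv ℝ φ x v) • f x) = - ∫ x in Ω, (φ x) • (Df x v))
    {S : Set (EuclideanSpace ℝ (Fin n))} (hS : Convex ℝ S) {c : EuclideanSpace ℝ (Fin n)}
    {r L : ℝ} (hr : 0 < r) (hL : 0 ≤ L) (hcS : ball c r ⊆ S) (hSc : S ⊆ closedBall c (L * r))
    (hcΩ : closedBall c (L * r) ⊆ Ω) (hI : ∫⁻ y in S, ‖Df y‖ₑ ^ p ≠ ⊤) :
    ediam (f '' S) ≤ ENNReal.ofReal (2 * morreyConst n p L * r ^ (1 - n / p)) *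
      (∫⁻ y in S, ‖Df y‖ₑ ^ p) ^ (1 / p) := by
  have hp0 : 0 < p := (Nat.cast_nonneg n).trans_lt hp
  set T := closedBall c (L * r)
  have hT : IsCompact T := isCompact_closedBall _ _
  obtain ⟨G, hG⟩ := ContinuousMap.exists_restrict_eq hT.isClosed
    (⟨T.domRestrict f, (hfc.mono hcΩ).domRestrict⟩ : C(T, EuclideanSpace ℝ (Fin N)))
  have hGf : ∀ y ∈ T, G y = f y := fun y hy => DFunLike.congr_fun hG ⟨y, hy⟩
  have hDT : IntegrableOn Df T := hDf.integrableOn_compact_subset hcΩ hT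
  have hwT : ∀ φ : EuclideanSpace ℝ (Fin n) → ℝ, ContDiff ℝ (⊤ : ℕ∞) φ → tsupport φ ⊆ T →
      ∀ v, ∫ y in T, (fderiv ℝ φ y v) • G y = - ∫ y in T, φ y • Df y v := by
    intro φ hφ hφT v
    have h := hw φ hφ (hT.of_isClosed_subset (isClosed_tsupport φ) hφT) (hφT.trans hcΩ) v
    rw [setIntegral_eq_of_subset_of_forall_sdiff_eq_zero hΩ.measurableSet hcΩ,
      setIntegral_eq_of_subset_of_forall_sdiff_eq_zero hΩ.measurableSet hcΩ] at h
    · rw [← h]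
      exact setIntegral_congr_fun hT.measurableSet fun y hy => by simp only [hGf y hy]
    · intro y hy
      rw [image_eq_zero_of_notMem_tsupport fun h' => hy.2 (hφT h'), zero_smul]
    · intro y hy
      rw [image_eq_zero_of_notMem_tsupport (f := fderiv ℝ φ) fun h' =>
        hy.2 (hφT (tsupport_fderiv_subset ℝ h')), _root_.zero_apply, zero_smul]
  set I := ∫⁻ y in S, ‖Df y‖ₑ ^ p with hIdef
  set M := (I ^ (1 / p)).toReal with hM
  have hI' : I ^ (1 / p) ≠ ⊤ := ENNReal.rpow_ne_top_of_nonneg (by positivity) hI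
  have hIM : I ≤ ENNReal.ofReal (M ^ p) := by
    rw [← ENNReal.ofReal_rpow_of_nonneg ENNReal.toReal_nonneg hp0.le, ENNReal.ofReal_toReal hI',
      ← ENNReal.rpow_mul, one_div_mul_cancel hp0.ne', ENNReal.rpow_one]
  let b : ContDiffBump (0 : EuclideanSpace ℝ (Fin n)) :=
    ⟨r / 2, r, half_pos hr, half_lt_self hr⟩
  have key : ∀ x ∈ S, ‖(∫ y, b.normed volume (y - c) • G y) - f x‖ ≤
      morreyConst n p L * r ^ (1 - n / p) * M := fun x hx => by
    rw [← hGf x (hSc hx)]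
    exact norm_integral_bump_sub_le hn hp G.continuous hT hDT hwT hS hSc hL hx
      (mem_closedBall.1 (hSc hx)) b rfl rfl hcS ENNReal.toReal_nonneg hIM
  refine ediam_image_le_iff.2 fun x hx y hy => ?_
  have hC : 0 ≤ morreyConst n p L := morreyConst_nonneg hp hL
  rw [← ENNReal.ofReal_toReal hI', ← ENNReal.ofReal_mul (by positivity), edist_dist]
  refine ENNReal.ofReal_le_ofReal ?_
  refine (dist_triangle_left _ _ (∫ y, b.normed volume (y - c) • G y)).trans ?_
  rw [dist_eq_norm, dist_eq_norm]
  linarith [key x hx, key y hy]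

theorem sum_rpow_le_card_rpow_mul {ι : Type*} (s : Finset ι) (u : ι → ℝ≥0∞) {t : ℝ} (ht : 0 < t)
    (ht1 : t ≤ 1) : ∑ i ∈ s, u i ^ t ≤ (s.card : ℝ≥0∞) ^ (1 - t) * (∑ i ∈ s, u i) ^ t := by
  have h := ENNReal.rpow_sum_le_const_mul_sum_rpow s (fun i => u i ^ t) ((one_le_inv₀ ht).2 ht1)
  simp only [← ENNReal.rpow_mul, mul_inv_cancel₀ ht.ne', ENNReal.rpow_one] at h
  have h' := ENNReal.rpow_le_rpow h ht.le
  rw [← ENNReal.rpow_mul, inv_mul_cancel₀ ht.ne', ENNReal.rpow_one,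
    ENNReal.mul_rpow_of_nonneg _ _ ht.le, ← ENNReal.rpow_mul, sub_mul, inv_mul_cancel₀ ht.ne',
    one_mul] at h'
  exact h'

section slab

variable {E : Type*} [NormedAddCommGroup E] [InnerProductSpace ℝ E] {V : Submodule ℝ E}
  {m : ℕ}

/-- The centre of `slab e a r i`. -/
def slabCenter (e : OrthonormalBasis (Fin m) ℝ V) (a : Vᗮ) (r : ℝ) (i : Fin m → ℤ) : E :=
  ∑ j, (r * (i j + 1 / 2)) • (e j : E) + a

theorem abs_inner_basis_le (e : OrthonormalBasis (Fin m) ℝ V) (j : Fin m) (y : E) :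
    |inner ℝ (e j : E) y| ≤ ‖y‖ := by
  have h := abs_real_inner_le_norm (e j : E) y
  rwa [← Submodule.coe_norm, e.orthonormal.1 j, one_mul] at h

theorem inner_slabCenter (e : OrthonormalBasis (Fin m) ℝ V) (a : Vᗮ) (r : ℝ) (i : Fin m → ℤ)
    (j : Fin m) : inner ℝ (e j : E) (slabCenter e a r i) = r * (i j + 1 / 2) := by
  have h : ∀ k, inner ℝ (e j : E) (e k : E) = if j = k then (1 : ℝ) else 0 := fun k => by
    rw [← Submodule.coe_inner, orthonormal_iff_ite.1 e.orthonormal]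
  simp [slabCenter, inner_add_right, inner_sum, inner_smul_right, h,
    Submodule.inner_right_of_mem_orthogonal (e j).2 a.2]

/-- The indices of the grid cells of side `r` meeting the ball of centre `x` and radius `R`. -/
def slabIndices (e : OrthonormalBasis (Fin m) ℝ V) (x : E) (R r : ℝ) : Finset (Fin m → ℤ) :=
  Fintype.piFinset fun j =>
    Finset.Icc ⌊(inner ℝ (e j : E) x - R) / r⌋ ⌊(inner ℝ (e j : E) x + R) / r⌋

theorem card_slabIndices_le (e : OrthonormalBasis (Fin m) ℝ V) (x : E) {R r : ℝ} (hr : 0 < r)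
    (hrR : r ≤ R) : ((slabIndices e x R r).card : ℝ) ≤ (4 * R / r) ^ m := by
  rw [slabIndices, Fintype.card_piFinset, Nat.cast_prod]
  refine (Finset.prod_le_prod (fun j _ => Nat.cast_nonneg _) fun j _ =>
    (?_ : _ ≤ 4 * R / r)).trans (le_of_eq (by simp [div_pow]))
  have hR : 0 < R := hr.trans_le hrR
  have h1 := Int.floor_le ((inner ℝ (e j : E) x + R) / r)
  have h2 := Int.lt_floor_add_one ((inner ℝ (e j : E) x - R) / r)
  have h3 : ⌊(inner ℝ (e j : E) x - R) / r⌋ ≤ ⌊(inner ℝ (e j : E) x + R) / r⌋ := by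
    gcongr
    linarith
  have h4 : 1 ≤ R / r := (one_le_div hr).2 hrR
  rw [Int.card_Icc, ← Int.cast_natCast, Int.toNat_of_nonneg (by omega)]
  push_cast
  have h5 : (inner ℝ (e j : E) x + R) / r = (inner ℝ (e j : E) x - R) / r + 2 * (R / r) := by ring
  have h6 : 4 * R / r = 4 * (R / r) := by ring
  linarith

variable [V.HasOrthogonalProjection]

/-- The points whose coordinates along `V` lie in the grid cell of side `r` with index `i`, and
whose projection to `Vᗮ` is within `r` of `a`. -/
def slab (e : OrthonormalBasis (Fin m) ℝ V) (a : Vᗮ) (r : ℝ) (i : Fin m → ℤ) : Set E :=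
  {y | (∀ j, ⌊inner ℝ (e j : E) y / r⌋ = i j) ∧ Vᗮ.orthogonalProjectionOnto y ∈ ball a r}

theorem norm_le_sum_abs_inner_add (e : OrthonormalBasis (Fin m) ℝ V) (y : E) :
    ‖y‖ ≤ ∑ j, |inner ℝ (e j : E) y| + ‖Vᗮ.orthogonalProjectionOnto y‖ := by
  have h := V.starProjection_add_starProjection_orthogonal y
  calc ‖y‖ = ‖V.starProjection y + Vᗮ.starProjection y‖ := by rw [h]
    _ ≤ ‖V.orthogonalProjectionOnto y‖ + ‖Vᗮ.orthogonalProjectionOnto y‖ := norm_add_le _ _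
    _ ≤ _ := by
      gcongr
      rw [e.orthogonalProjectionOnto_apply_eq_sum]
      refine (norm_sum_le _ _).trans (le_of_eq (Finset.sum_congr rfl fun j _ => ?_))
      rw [norm_smul, e.orthonormal.1 j, mul_one, Real.norm_eq_abs]

theorem orthogonalProjectionOnto_slabCenter (e : OrthonormalBasis (Fin m) ℝ V) (a : Vᗮ) (r : ℝ)
    (i : Fin m → ℤ) : Vᗮ.orthogonalProjectionOnto (slabCenter e a r i) = a := by
  have h : ∀ k, Vᗮ.orthogonalProjectionOnto (e k : E) = 0 := fun k =>
    Submodule.orthogonalProjectionOnto_orthogonal_apply_eq_zero (e k).2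
  simp [slabCenter, h]

theorem mem_slab_iff (e : OrthonormalBasis (Fin m) ℝ V) (a : Vᗮ) {r : ℝ} (hr : 0 < r)
    (i : Fin m → ℤ) (y : E) : y ∈ slab e a r i ↔
      (∀ j, inner ℝ (e j : E) y ∈ Ico (r * i j) (r * (i j + 1))) ∧
        Vᗮ.orthogonalProjectionOnto y ∈ ball a r := by
  simp only [slab, mem_ofPred_eq, Int.floor_eq_iff, le_div_iff₀ hr, div_lt_iff₀ hr, mem_Ico,
    mul_comm r]

theorem ball_subset_slab (e : OrthonormalBasis (Fin m) ℝ V) (a : Vᗮ) {r : ℝ} (hr : 0 < r)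
    (i : Fin m → ℤ) : ball (slabCenter e a r i) (r / 2) ⊆ slab e a r i := by
  intro y hy
  rw [mem_ball, dist_eq_norm] at hy
  refine (mem_slab_iff e a hr i y).2 ⟨fun j => ?_, ?_⟩
  · have h := (abs_inner_basis_le e j _).trans_lt hy
    rw [inner_sub_right, inner_slabCenter, abs_lt] at h
    constructor <;> linarith
  · rw [mem_ball, dist_eq_norm]
    have h := Vᗮ.norm_orthogonalProjectionOnto_apply_le (y - slabCenter e a r i)
    rw [map_sub, orthogonalProjectionOnto_slabCenter] at h
    linarith

theorem slab_subset_closedBall (e : OrthonormalBasis (Fin m) ℝ V) (a : Vᗮ) {r : ℝ} (hr : 0 < r)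
    (i : Fin m → ℤ) : slab e a r i ⊆ closedBall (slabCenter e a r i) ((m + 1) * r) := by
  intro y hy
  obtain ⟨h1, h2⟩ := (mem_slab_iff e a hr i y).1 hy
  rw [mem_closedBall, dist_eq_norm]
  refine (norm_le_sum_abs_inner_add e _).trans ?_
  have h3 : ∑ j, |inner ℝ (e j : E) (y - slabCenter e a r i)| ≤ ∑ _j : Fin m, r :=
    Finset.sum_le_sum fun j _ => by
      rw [inner_sub_right, inner_slabCenter, abs_le]
      have := h1 j
      constructor <;> linarith [this.1, this.2]
  rw [map_sub, orthogonalProjectionOnto_slabCenter, ← dist_eq_norm]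
  rw [mem_ball] at h2
  simp only [Finset.sum_const, Finset.card_univ, Fintype.card_fin, nsmul_eq_mul] at h3
  linarith

theorem convex_slab (e : OrthonormalBasis (Fin m) ℝ V) (a : Vᗮ) {r : ℝ} (hr : 0 < r)
    (i : Fin m → ℤ) : Convex ℝ (slab e a r i) := by
  have h : slab e a r i =
      (⋂ j, (innerSL ℝ (e j : E)).toLinearMap ⁻¹' Ico (r * i j) (r * (i j + 1))) ∩
        Vᗮ.orthogonalProjectionOnto.toLinearMap ⁻¹' ball a r := by
    ext y
    simp [mem_slab_iff e a hr]
  rw [h]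
  exact (convex_iInter fun j => (convex_Ico _ _).linear_preimage _).inter
    ((convex_ball _ _).linear_preimage _)

theorem disjoint_slab (e : OrthonormalBasis (Fin m) ℝ V) (a : Vᗮ) (r : ℝ) {i i' : Fin m → ℤ}
    (h : i ≠ i') : Disjoint (slab e a r i) (slab e a r i') :=
  disjoint_left.2 fun _ hy hy' => h (funext fun j => (hy.1 j).symm.trans (hy'.1 j))

theorem measurableSet_slab [MeasurableSpace E] [BorelSpace E]
    (e : OrthonormalBasis (Fin m) ℝ V) (a : Vᗮ) (r : ℝ)
    (i : Fin m → ℤ) : MeasurableSet (slab e a r i) := by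
  have h : slab e a r i = (⋂ j, {y | ⌊inner ℝ (e j : E) y / r⌋ = i j}) ∩
      Vᗮ.orthogonalProjectionOnto ⁻¹' ball a r := by
    ext y
    simp [slab]
  rw [h]
  refine (MeasurableSet.iInter fun j => ?_).inter
    (isOpen_ball.preimage Vᗮ.orthogonalProjectionOnto.continuous).measurableSet
  have h1 : Measurable fun y : E => inner ℝ (e j : E) y / r :=
    (Continuous.div_const (by fun_prop) r).measurable
  exact (Int.measurable_floor.comp h1) (measurableSet_singleton (i j))

theorem exists_mem_slab (e : OrthonormalBasis (Fin m) ℝ V) (a : Vᗮ) {x y : E} {R r : ℝ}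
    (hr : 0 < r) (hy : y ∈ ball x R) (hya : Vᗮ.orthogonalProjectionOnto y = a) :
    ∃ i ∈ slabIndices e x R r, y ∈ slab e a r i := by
  refine ⟨fun j => ⌊inner ℝ (e j : E) y / r⌋, ?_, fun j => rfl, hya ▸ mem_ball_self hr⟩
  refine Fintype.mem_piFinset.2 fun j => Finset.mem_Icc.2 ?_
  rw [mem_ball, dist_eq_norm] at hy
  have h := (abs_inner_basis_le e j _).trans_lt hy
  rw [inner_sub_right, abs_lt] at h
  constructor <;> gcongr <;> linarith

theorem sum_measure_slab_le [MeasurableSpace E] [BorelSpace E]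
    (ν : Measure E) (e : OrthonormalBasis (Fin m) ℝ V) (a : Vᗮ) (r : ℝ)
    (s : Finset (Fin m → ℤ)) :
    ∑ i ∈ s, ν (slab e a r i) ≤ ν.map Vᗮ.orthogonalProjectionOnto (closedBall a r) := by
  rw [Measure.map_apply Vᗮ.orthogonalProjectionOnto.continuous.measurable measurableSet_closedBall,
    ← measure_biUnion_finset (fun i _ i' _ h => disjoint_slab e a r h)
      fun i _ => measurableSet_slab e a r i]
  exact measure_mono (iUnion₂_subset fun i _ y hy => ball_subset_closedBall hy.2)

/-- If the oscillation of `f` on each slab around the slice over `a` is controlled by `ν`, and the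
`ν`-mass near that slice decays faster than `r ^ β`, then the image of the slice is `ℋ^α`-null. -/
theorem hausdorffMeasure_image_slice_inter_ball_eq_zero [MeasurableSpace E] [BorelSpace E]
    {Y : Type*} [EMetricSpace Y] [MeasurableSpace Y] [BorelSpace Y] (f : E → Y) (ν : Measure E)
    [IsFiniteMeasure ν] (e : OrthonormalBasis (Fin m) ℝ V) (a : Vᗮ) (x : E)
    {R C s p α β : ℝ} (hR : 0 < R) (hC : 0 ≤ C) (hs : 0 < s) (hα : 0 < α) (hαp : α < p)
    (hexp : α * s - m * (1 - α / p) + β * (α / p) = 0)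
    (hf : ∀ r, 0 < r → r ≤ R → ∀ i, (slab e a r i ∩ ball x R).Nonempty →
      ediam (f '' slab e a r i) ≤ ENNReal.ofReal (C * r ^ s) * ν (slab e a r i) ^ (1 / p))
    (hν : ∀ ε : ℝ, 0 < ε → ∀ᶠ r in 𝓝[>] (0 : ℝ),
      ν.map Vᗮ.orthogonalProjectionOnto (closedBall a r) ≤ ENNReal.ofReal (ε * r ^ β)) :
    μH[α] (f '' ({y | Vᗮ.orthogonalProjectionOnto y = a} ∩ ball x R)) = 0 := by
  have hp : 0 < p := hα.trans hαp
  have hαp0 : 0 < α / p := by positivity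
  have hαp1 : α / p < 1 := (div_lt_one hp).2 hαp
  have hsmall : ∀ᶠ r in 𝓝[>] (0 : ℝ), 0 < r ∧ r ≤ R :=
    Eventually.and self_mem_nhdsWithin (nhdsWithin_le_nhds (Iic_mem_nhds hR))
  let t : (r : ℝ) → slabIndices e x R r → Set Y := fun r i =>
    f '' (slab e a r i ∩ ({y | Vᗮ.orthogonalProjectionOnto y = a} ∩ ball x R))
  have ht : ∀ r, 0 < r → r ≤ R → ∀ i, ediam (t r i) ≤
      ENNReal.ofReal (C * r ^ s) * ν (slab e a r i) ^ (1 / p) := by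
    intro r hr hrR i
    rcases (slab e a r i ∩ ball x R).eq_empty_or_nonempty with h | h
    · have h0 : t r i = ∅ := image_eq_empty.2
        (subset_empty_iff.1 (h ▸ inter_subset_inter_right _ inter_subset_right))
      rw [h0, ediam_empty]
      exact zero_le
    · exact (ediam_mono (image_mono inter_subset_left)).trans (hf r hr hrR i h)
  have hbound : ∀ ε : ℝ, 0 < ε → μH[α] (f '' ({y | Vᗮ.orthogonalProjectionOnto y = a} ∩ ball x R)) ≤
      ENNReal.ofReal (C ^ α * ((4 * R) ^ m) ^ (1 - α / p) * ε ^ (α / p)) := by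
    intro ε hε
    refine (Measure.hausdorffMeasure_le_liminf_sum (l := 𝓝[>] (0 : ℝ)) α _
      (fun r => ENNReal.ofReal (C * r ^ s) * ν univ ^ (1 / p)) ?_ t ?_ ?_).trans ?_
    · have h1 : Tendsto (fun r : ℝ => C * r ^ s) (𝓝 0) (𝓝 (C * 0 ^ s)) :=
        ((Real.continuousAt_rpow_const 0 s (Or.inr hs.le)).tendsto).const_mul C
      rw [Real.zero_rpow hs.ne', mul_zero] at h1
      have h2 := ENNReal.Tendsto.mul_const (b := ν univ ^ (1 / p))
        (ENNReal.tendsto_ofReal (h1.mono_left (nhdsWithin_le_nhds (s := Ioi 0))))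
        (Or.inr (ENNReal.rpow_ne_top_of_nonneg (by positivity) (measure_ne_top _ _)))
      simpa using h2
    · filter_upwards [hsmall] with r hr i
      refine (ht r hr.1 hr.2 i).trans ?_
      gcongr
      exact subset_univ _
    · filter_upwards [hsmall] with r hr
      rintro _ ⟨y, ⟨hya, hyx⟩, rfl⟩
      obtain ⟨i, hi, hyi⟩ := exists_mem_slab e a hr.1 hyx hya
      exact mem_iUnion.2 ⟨⟨i, hi⟩, mem_image_of_mem f ⟨hyi, hya, hyx⟩⟩
    · refine liminf_le_of_frequently_le' (Eventually.frequently ?_)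
      filter_upwards [hsmall, hν ε hε] with r hr hrν
      have hr0 := hr.1
      calc ∑ i, ediam (t r i) ^ α
          ≤ ∑ i : slabIndices e x R r,
              ENNReal.ofReal (C * r ^ s) ^ α * ν (slab e a r i) ^ (α / p) := by
            refine Finset.sum_le_sum fun i _ => ?_
            refine (ENNReal.rpow_le_rpow (ht r hr.1 hr.2 i) hα.le).trans (le_of_eq ?_)
            rw [ENNReal.mul_rpow_of_nonneg _ _ hα.le, ← ENNReal.rpow_mul, one_div_mul_eq_div]
        _ = ENNReal.ofReal (C * r ^ s) ^ α *
              ∑ i ∈ slabIndices e x R r, ν (slab e a r i) ^ (α / p) := by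
            rw [← Finset.mul_sum, Finset.sum_coe_sort (slabIndices e x R r)
              fun i => ν (slab e a r i) ^ (α / p)]
        _ ≤ ENNReal.ofReal (C * r ^ s) ^ α *
              (ENNReal.ofReal ((4 * R / r) ^ m) ^ (1 - α / p) *
                ENNReal.ofReal (ε * r ^ β) ^ (α / p)) := by
            gcongr
            refine (sum_rpow_le_card_rpow_mul _ _ hαp0 hαp1.le).trans ?_
            gcongr
            · rw [← ENNReal.ofReal_natCast]
              exact ENNReal.ofReal_le_ofReal (card_slabIndices_le e x hr.1 hr.2)
            · exact (sum_measure_slab_le ν e a r _).trans hrν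
        _ = _ := by
            rw [ENNReal.ofReal_rpow_of_nonneg (by positivity) hα.le,
              ENNReal.ofReal_rpow_of_nonneg (by positivity) (by linarith),
              ENNReal.ofReal_rpow_of_nonneg (by positivity) hαp0.le,
              ← ENNReal.ofReal_mul (by positivity), ← ENNReal.ofReal_mul (by positivity)]
            congr 1
            rw [Real.mul_rpow hC (by positivity), Real.mul_rpow hε.le (by positivity), div_pow,
              Real.div_rpow (by positivity) (by positivity), ← Real.rpow_natCast r m,
              ← Real.rpow_mul hr0.le, ← Real.rpow_mul hr0.le, ← Real.rpow_mul hr0.le]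
            have h1 : r ^ (s * α) * r ^ (β * (α / p)) = r ^ (m * (1 - α / p)) := by
              rw [← Real.rpow_add hr0]
              congr 1
              linarith
            have h2 : r ^ (m * (1 - α / p)) ≠ 0 := by positivity
            rw [← h1] at h2 ⊢
            field_simp
  have hlim : Tendsto (fun ε : ℝ =>
      ENNReal.ofReal (C ^ α * ((4 * R) ^ m) ^ (1 - α / p) * ε ^ (α / p))) (𝓝[>] 0) (𝓝 0) := by
    have h1 := ((Real.continuousAt_rpow_const 0 (α / p) (Or.inr hαp0.le)).tendsto.const_mul
      (C ^ α * ((4 * R) ^ m) ^ (1 - α / p))).mono_left (nhdsWithin_le_nhds (s := Ioi 0))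
    simpa [Real.zero_rpow hαp0.ne'] using ENNReal.tendsto_ofReal h1
  exact le_antisymm (ge_of_tendsto hlim (eventually_nhdsWithin_of_forall hbound)) zero_le

end slab

theorem map_orthogonalProjectionOnto_absolutelyContinuous {E : Type*} [NormedAddCommGroup E]
    [InnerProductSpace ℝ E] [FiniteDimensional ℝ E] [MeasurableSpace E] [BorelSpace E]
    (W : Submodule ℝ E) {ν : Measure E} (hν : ν ≪ volume) :
    ν.map W.orthogonalProjectionOnto ≪ (μH[Module.finrank ℝ W] : Measure W) := by
  have hsurj : Function.Surjective W.orthogonalProjectionOnto.toLinearMap := fun w =>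
    ⟨w, Submodule.orthogonalProjectionOnto_mem_subspace_eq_self w⟩
  obtain ⟨c, -, hc⟩ := LinearMap.exists_map_addHaar_eq_smul_addHaar
    W.orthogonalProjectionOnto.toLinearMap volume (μH[Module.finrank ℝ W] : Measure W) hsurj
  have h := hν.map W.orthogonalProjectionOnto.continuous.measurable
  refine h.trans ?_
  change Measure.map W.orthogonalProjectionOnto.toLinearMap volume ≪ _
  rw [hc]
  exact Measure.smul_absolutelyContinuous

/-- A slice of `Ω` near which the energy decays faster than `r ^ β` has `ℋ^α`-null image. -/
theorem hausdorffMeasure_image_slice_eq_zero {n N m : ℕ} (hn : 0 < n) {p : ℝ} (hp : n < p)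
    {Ω : Set (EuclideanSpace ℝ (Fin n))} (hΩ : IsOpen Ω)
    {f : EuclideanSpace ℝ (Fin n) → EuclideanSpace ℝ (Fin N)} (hfc : ContinuousOn f Ω)
    {Df : EuclideanSpace ℝ (Fin n) → EuclideanSpace ℝ (Fin n) →L[ℝ] EuclideanSpace ℝ (Fin N)}
    (hDf : LocallyIntegrableOn Df Ω volume)
    (hw : ∀ φ : EuclideanSpace ℝ (Fin n) → ℝ, ContDiff ℝ (⊤ : ℕ∞) φ → HasCompactSupport φ →
      tsupport φ ⊆ Ω → ∀ v : EuclideanSpace ℝ (Fin n),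
        (∫ x in Ω, (fderiv ℝ φ x v) • f x) = - ∫ x in Ω, (φ x) • (Df x v))
    (hI : ∫⁻ y in Ω, ‖Df y‖ₑ ^ p ≠ ⊤) {V : Submodule ℝ (EuclideanSpace ℝ (Fin n))}
    (e : OrthonormalBasis (Fin m) ℝ V) (a : Vᗮ) {α β : ℝ} (hα : 0 < α) (hαp : α < p)
    (hexp : α * (1 - n / p) - m * (1 - α / p) + β * (α / p) = 0)
    (ha : ∀ ε : ℝ, 0 < ε → ∀ᶠ r in 𝓝[>] (0 : ℝ),
      ((volume.restrict Ω).withDensity fun y => ‖Df y‖ₑ ^ p).map Vᗮ.orthogonalProjectionOnto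
        (closedBall a r) ≤ ENNReal.ofReal (ε * r ^ β)) :
    μH[α] (f '' ({y | Vᗮ.orthogonalProjectionOnto y = a} ∩ Ω)) = 0 := by
  have hp0 : 0 < p := (Nat.cast_nonneg n).trans_lt hp
  set ν := (volume.restrict Ω).withDensity fun y => ‖Df y‖ₑ ^ p with hνdef
  have : IsFiniteMeasure ν := isFiniteMeasure_withDensity hI
  have hs : 0 < 1 - n / p := sub_pos.2 ((div_lt_one hp0).2 hp)
  have hL : (0 : ℝ) ≤ 2 * (m + 1) := by positivity
  have hC : 0 ≤ morreyConst n p (2 * (m + 1)) := morreyConst_nonneg hp hL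
  have hloc : ∀ x ∈ Ω, ∃ R : ℝ, 0 < R ∧ closedBall x ((2 * m + 3) * R) ⊆ Ω := fun x hx => by
    obtain ⟨δ, hδ, h⟩ := Metric.nhds_basis_closedBall.mem_iff.1 (hΩ.mem_nhds hx)
    exact ⟨δ / (2 * m + 3), by positivity, by rwa [mul_div_cancel₀ _ (by positivity)]⟩
  choose! R hR hRΩ using hloc
  obtain ⟨t, htΩ, htc, hcov⟩ := TopologicalSpace.countable_cover_nhdsWithin
    (f := fun x => ball x (R x)) (s := Ω)
    fun x hx => mem_nhdsWithin_of_mem_nhds (ball_mem_nhds x (hR x hx))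
  refine measure_mono_null
    (t := ⋃ x ∈ t, f '' ({y | Vᗮ.orthogonalProjectionOnto y = a} ∩ ball x (R x))) ?_
    ((measure_biUnion_null_iff htc).2 fun x hx => ?_)
  · rintro _ ⟨y, ⟨hya, hyΩ⟩, rfl⟩
    obtain ⟨x, hx, hyx⟩ := mem_iUnion₂.1 (hcov hyΩ)
    exact mem_iUnion₂.2 ⟨x, hx, mem_image_of_mem f ⟨hya, hyx⟩⟩
  refine hausdorffMeasure_image_slice_inter_ball_eq_zero f ν e a x (hR x (htΩ hx))
    (C := 2 * morreyConst n p (2 * (m + 1)) * (1 / 2) ^ (1 - n / p)) (by positivity) hs hα hαp hexp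
    (fun r hr hrR i hne => ?_) ha
  obtain ⟨y, hyi, hyx⟩ := hne
  have hLr : 2 * (m + 1) * (r / 2) = (m + 1) * r := by ring
  have hSc : slab e a r i ⊆ closedBall (slabCenter e a r i) (2 * (m + 1) * (r / 2)) := by
    rw [hLr]
    exact slab_subset_closedBall e a hr i
  have hcΩ : closedBall (slabCenter e a r i) (2 * (m + 1) * (r / 2)) ⊆ Ω := by
    refine (closedBall_subset_closedBall' ?_).trans (hRΩ x (htΩ hx))
    have h1 := dist_triangle_left (slabCenter e a r i) x y
    have h2 := mem_closedBall.1 (hSc hyi)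
    have h3 := mem_ball.1 hyx
    have h4 : 2 * ((m + 1) * r) ≤ 2 * ((m + 1) * R x) := by gcongr
    rw [hLr] at *
    linarith
  have hνS : ν (slab e a r i) = ∫⁻ y in slab e a r i, ‖Df y‖ₑ ^ p := by
    rw [hνdef, withDensity_apply _ (measurableSet_slab e a r i),
      Measure.restrict_restrict_of_subset (hSc.trans hcΩ)]
  have h := ediam_image_le_of_lintegral_weakDeriv hn hp hΩ hfc hDf hw (convex_slab e a hr i) (half_pos hr)
    hL (ball_subset_slab e a hr i) hSc hcΩ (hνS ▸ measure_ne_top _ _)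
  rwa [← hνS, div_eq_mul_one_div r 2, mul_comm r, Real.mul_rpow (by norm_num) hr.le,
    ← mul_assoc] at h

/-- Balogh–Monti–Tyson: generic dimension distortion for parallel affine subspaces.
The exceptional set `{a ∈ V^⊥ : ℋ^α(f(V_a ∩ Ω)) > 0}` is `ℋ^β`-null, where
`β = (n-m) - p(1 - m/α)`. -/
theorem bmt_foliations (n N : ℕ) (Ω : Set (EuclideanSpace ℝ (Fin n)))
    (hΩ : IsEuclDomain Ω) (p : ℝ) (hp : (n : ℝ) < p)
    (m : ℕ) (hm1 : 1 ≤ m) (hmn : m < n)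
    (V : Submodule ℝ (EuclideanSpace ℝ (Fin n))) (hV : Module.finrank ℝ V = m)
    (f : EuclideanSpace ℝ (Fin n) → EuclideanSpace ℝ (Fin N))
    (hfc : ContinuousOn f Ω) (hf : MemW1p n N p Ω f)
    (α : ℝ) (hα1 : (m : ℝ) < α) (hα2 : α < p*m/(p - n + m)) :
    μH[((n : ℝ) - m) - p*(1 - m/α)]
      {a : EuclideanSpace ℝ (Fin n) | a ∈ Vᗮ ∧
        0 < μH[α] (f '' (((fun v => v + a) '' (V : Set (EuclideanSpace ℝ (Fin n)))) ∩ Ω))}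
      = 0 := by
  obtain ⟨Df, hDf, hfin, hw⟩ := hf
  have hm0 : (1 : ℝ) ≤ m := by exact_mod_cast hm1
  have hmn' : (m : ℝ) < n := by exact_mod_cast hmn
  have hp0 : 0 < p := by linarith
  have hα : 0 < α := by linarith
  have hden : 0 < p - n + m := by linarith
  have hαp : α < p := by
    refine hα2.trans_le ((div_le_iff₀ hden).2 ?_)
    gcongr
    linarith
  set β := ((n : ℝ) - m) - p * (1 - m / α) with hβdef
  have hβ : 0 < β := by
    have h1 : α * (p - n + m) < p * m := (lt_div_iff₀ hden).1 hα2
    have h2 : β = (p * m - α * (p - n + m)) / α := by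
      rw [hβdef]
      field_simp
      ring
    rw [h2]
    exact div_pos (by linarith) hα
  have hβd : β < (Module.finrank ℝ Vᗮ : ℝ) := by
    have h1 : (m : ℝ) + Module.finrank ℝ Vᗮ = n := by
      have h := V.finrank_add_finrank_orthogonal
      rw [hV, finrank_euclideanSpace, Fintype.card_fin] at h
      exact_mod_cast h
    have h2 : 0 < p * (1 - m / α) := mul_pos hp0 (sub_pos.2 ((div_lt_one hα).2 hα1))
    linarith
  have hexp : α * (1 - n / p) - m * (1 - α / p) + β * (α / p) = 0 := by
    rw [hβdef]
    field_simp
    ring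
  have hI : ∫⁻ y in Ω, ‖Df y‖ₑ ^ p ≠ ⊤ := by
    refine ne_of_lt (lt_of_le_of_lt (le_of_eq (lintegral_congr fun y => ?_)) hfin)
    rw [← ENNReal.ofReal_rpow_of_nonneg (norm_nonneg _) hp0.le, ofReal_norm]
  let ν := (volume.restrict Ω).withDensity fun y => ‖Df y‖ₑ ^ p
  have : IsFiniteMeasure ν := isFiniteMeasure_withDensity hI
  have hνac : ν ≪ volume :=
    (withDensity_absolutelyContinuous _ _).trans Measure.restrict_le_self.absolutelyContinuous
  have hnull := hausdorffMeasure_not_isLittleO_closedBall_eq_zero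
    (ν.map Vᗮ.orthogonalProjectionOnto) hβ hβd
    (map_orthogonalProjectionOnto_absolutelyContinuous Vᗮ hνac)
  rw [← (isometry_subtype_coe (s := (Vᗮ : Set (EuclideanSpace ℝ (Fin n))))).hausdorffMeasure_image
    (Or.inl hβ.le)] at hnull
  refine measure_mono_null ?_ hnull
  rintro a ⟨haV, ha⟩
  refine ⟨⟨a, haV⟩, fun hgood => ha.ne' (measure_mono_null (image_mono
    (inter_subset_inter_left _ ?_)) (hausdorffMeasure_image_slice_eq_zero (by omega) hp hΩ.1 hfc hDf
      hw hI ((stdOrthonormalBasis ℝ V).reindex (finCongr hV)) ⟨a, haV⟩ hα hαp hexp hgood)), rfl⟩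
  rintro _ ⟨v, hv, rfl⟩
  have h1 := Submodule.orthogonalProjectionOnto_orthogonal_apply_eq_zero hv
  have h2 := Submodule.orthogonalProjectionOnto_mem_subspace_eq_self (⟨a, haV⟩ : Vᗮ)
  simp only [mem_ofPred_eq, map_add, h1, zero_add]
  exact h2
end
end

section
/- Fix p > n ≥ 2, 1 < α < p/(p−n+1), and a 1-dimensional linear subspace L of ℝ^n with orthogonal complement L^⊥. Then for every ε > 0 there exist a set A ⊆ L^⊥ with dimH A > (n−1) − p(1 − 1/α) − ε and a quasiconformal homeomorphism f : ℝ^n → ℝ^n which is continuous and lies in W^{1,p}(ℝ^n : ℝ^n), such that dimH f(L_a) ≥ α for every a ∈ A. -/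
open Set Filter MeasureTheory Metric Topology
open scoped ENNReal NNReal

noncomputable section

section Rearrangement

section Groups

variable {V : Type*} [NormedAddCommGroup V]

lemma exists_lipschitzWith_sum {ι X : Type*} [Fintype ι] [PseudoMetricSpace X] {f : ι → X → V}
    (hf : ∀ i, ∃ K, LipschitzWith K (f i)) : ∃ K, LipschitzWith K fun x => ∑ i, f i x := by
  choose K hK using hf
  refine ⟨∑ i, K i, LipschitzWith.of_dist_le_mul fun x y => ?_⟩
  push_cast
  rw [Finset.sum_mul]
  exact (dist_sum_sum_le _ _ _).trans (Finset.sum_le_sum fun i _ => (hK i).dist_le_mul x y)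

/-- The group of bi-Lipschitz bijections which are the identity outside `W`. -/
def biLipSupp (W : Set V) : Subgroup (Equiv.Perm V) where
  carrier := {g | (∃ K, LipschitzWith K g) ∧ (∃ K, LipschitzWith K g.symm) ∧ ∀ x ∉ W, g x = x}
  mul_mem' := by
    rintro g h ⟨⟨K, hK⟩, ⟨K', hK'⟩, hW⟩ ⟨⟨J, hJ⟩, ⟨J', hJ'⟩, hW'⟩
    refine ⟨⟨K * J, hK.comp hJ⟩, ⟨J' * K', hJ'.comp hK'⟩, fun x hx => ?_⟩
    simp [hW' x hx, hW x hx]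
  one_mem' := ⟨⟨1, LipschitzWith.id⟩, ⟨1, LipschitzWith.id⟩, fun _ _ => rfl⟩
  inv_mem' := by
    rintro g ⟨hK, hK', hW⟩
    refine ⟨hK', hK, fun x hx => ?_⟩
    exact g.symm_apply_eq.2 (hW x hx).symm

/-- Two configurations of points are related if a bi-Lipschitz bijection supported in
`ball 0 R` moves one to the other and is a translation near each point. -/
def TranslRel {ι : Type*} (R : ℝ) (t u : ι → V) : Prop :=
  ∃ g ∈ biLipSupp (ball (0 : V) R), ∃ δ > 0, ∀ i x, ‖x‖ ≤ δ → g (t i + x) = u i + x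

lemma TranslRel.symm {ι : Type*} {R : ℝ} {t u : ι → V} (h : TranslRel R t u) :
    TranslRel R u t := by
  obtain ⟨g, hg, δ, hδ, h⟩ := h
  refine ⟨g⁻¹, inv_mem hg, δ, hδ, fun i x hx => ?_⟩
  rw [← h i x hx]
  exact g.symm_apply_apply _

lemma TranslRel.trans {ι : Type*} {R : ℝ} {t u w : ι → V} (h : TranslRel R t u)
    (h' : TranslRel R u w) : TranslRel R t w := by
  obtain ⟨g, hg, δ, hδ, h⟩ := h
  obtain ⟨g', hg', δ', hδ', h'⟩ := h'
  refine ⟨g' * g, mul_mem hg' hg, min δ δ', lt_min hδ hδ', fun i x hx => ?_⟩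
  rw [Equiv.Perm.mul_apply, h i x (hx.trans (min_le_left _ _)),
    h' i x (hx.trans (min_le_right _ _))]

lemma TranslRel.refl {ι : Type*} {R : ℝ} (t : ι → V) : TranslRel R t t :=
  ⟨1, one_mem _, 1, one_pos, fun _ _ _ => rfl⟩

end Groups

variable {V : Type*} [NormedAddCommGroup V] [InnerProductSpace ℝ V] [FiniteDimensional ℝ V]

lemma exists_biLipSupp_eq_add {W : Set V} {φ : V → V} (hφ : LipschitzWith (1 / 2) φ)
    (hW : ∀ x ∉ W, φ x = 0) : ∃ g ∈ biLipSupp W, ∀ x, g x = x + φ x := by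
  have hd : ∀ x y, ‖φ x - φ y‖ ≤ 1 / 2 * ‖x - y‖ := fun x y => by
    simpa using hφ.norm_sub_le x y
  have key : ∀ x y, ‖x - y‖ ≤ 2 * ‖x + φ x - (y + φ y)‖ := fun x y => by
    have h1 : x - y = (x + φ x - (y + φ y)) - (φ x - φ y) := by abel
    have h2 := norm_sub_le (x + φ x - (y + φ y)) (φ x - φ y)
    rw [← h1] at h2
    linarith [hd x y]
  have hbij : Function.Bijective fun x => x + φ x := by
    constructor
    · intro x y hxy
      have := key x y
      simp only at hxy
      rw [hxy, sub_self, norm_zero, mul_zero] at this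
      exact sub_eq_zero.1 (norm_le_zero_iff.1 this)
    · intro y
      have hc : ContractingWith (1 / 2) fun x => y - φ x := by
        refine ⟨by norm_num, LipschitzWith.of_dist_le_mul fun a b => ?_⟩
        rw [dist_eq_norm, dist_eq_norm, sub_sub_sub_cancel_left, norm_sub_rev]
        simpa using hd a b
      refine ⟨hc.fixedPoint, ?_⟩
      have := hc.fixedPoint_isFixedPt
      exact (sub_eq_iff_eq_add.1 this).symm
  refine ⟨Equiv.ofBijective _ hbij, ⟨⟨1 + 1 / 2, LipschitzWith.id.add hφ⟩, ⟨2, ?_⟩, ?_⟩,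
    fun x => rfl⟩
  · refine LipschitzWith.of_dist_le_mul fun a b => ?_
    rw [dist_eq_norm, dist_eq_norm]
    have := key ((Equiv.ofBijective _ hbij).symm a) ((Equiv.ofBijective _ hbij).symm b)
    have h1 : ∀ a, (Equiv.ofBijective _ hbij).symm a + φ ((Equiv.ofBijective _ hbij).symm a) = a :=
      fun a => (Equiv.ofBijective _ hbij).apply_symm_apply a
    rw [h1, h1] at this
    simpa using this
  · intro x hx
    simp [hW x hx]

lemma exists_lipschitz_bump {a b : ℝ} (ha : 0 < a) (hab : a < b) :
    ∃ η : V → ℝ, (∃ K, LipschitzWith K η) ∧ (∃ K, LipschitzWith K fun x => η x • x) ∧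
      (∀ x, ‖x‖ ≤ a → η x = 1) ∧ ∀ x, b ≤ ‖x‖ → η x = 0 := by
  let η : ContDiffBump (0 : V) := ⟨a, b, ha, hab⟩
  refine ⟨η, ?_, ?_, fun x hx => η.one_of_mem_closedBall (by simpa using hx),
    fun x hx => η.zero_of_le_dist (by simpa using hx)⟩
  · exact ContDiff.lipschitzWith_of_hasCompactSupport (n := 1) η.hasCompactSupport
      η.contDiff (by simp)
  · exact ContDiff.lipschitzWith_of_hasCompactSupport (n := 1) η.hasCompactSupport.smul_right
      (η.contDiff.smul contDiff_id) (by simp)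

lemma isPreconnected_ball_diff_finite (hV : 1 < Module.finrank ℝ V) {R : ℝ} (hR : 0 < R)
    {F : Set V} (hF : F.Finite) : IsPreconnected (ball (0 : V) R \ F) := by
  let e := OpenPartialHomeomorph.univBall (0 : V) R
  have hr : 1 < Module.rank ℝ V := by
    rw [← Module.finrank_eq_rank]; exact_mod_cast hV
  have htgt : e.target = ball 0 R := OpenPartialHomeomorph.univBall_target _ hR
  have hsrc : e.source = univ := OpenPartialHomeomorph.univBall_source _ _
  have hinj : Function.Injective e := by
    rw [← injOn_univ, ← hsrc]; exact e.injOn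
  have hc := ((hF.preimage hinj.injOn).countable.isConnected_compl_of_one_lt_rank hr).isPreconnected
  have hcont : Continuous e := by
    rw [← continuousOn_univ, ← hsrc]; exact e.continuousOn
  have : ball (0 : V) R \ F = e '' (e ⁻¹' F)ᶜ := by
    ext x
    constructor
    · rintro ⟨hx, hxF⟩
      rw [← htgt] at hx
      exact ⟨e.symm x, by simpa [e.right_inv hx] using hxF, e.right_inv hx⟩
    · rintro ⟨y, hy, rfl⟩
      refine ⟨?_, hy⟩
      rw [← htgt]
      exact e.map_source (by simp [hsrc])
  rw [this]
  exact hc.image _ hcont.continuousOn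

lemma translRel_update {ι : Type*} [Finite ι] [DecidableEq ι] (hV : 1 < Module.finrank ℝ V)
    {R : ℝ} (hR : 0 < R) {t : ι → V} (j : ι) {x y : V}
    (hx : x ∈ ball (0 : V) R \ (t '' {j}ᶜ)) (hy : y ∈ ball (0 : V) R \ (t '' {j}ᶜ)) :
    TranslRel R (Function.update t j x) (Function.update t j y) := by
  have hF : (t '' {j}ᶜ).Finite := toFinite _
  refine (isPreconnected_ball_diff_finite hV hR hF).induction₂
    (fun x y => TranslRel R (Function.update t j x) (Function.update t j y)) ?_
    (fun _ _ _ _ _ _ h h' => h.trans h') (fun _ _ _ _ h => h.symm) hx hy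
  intro x hx
  have hopen : IsOpen (ball (0 : V) R \ (t '' {j}ᶜ)) := isOpen_ball.sdiff hF.isClosed
  obtain ⟨s, hs, hsub⟩ := Metric.isOpen_iff.1 hopen x hx
  obtain ⟨η, ⟨K, hK⟩, -, h1, h0⟩ := exists_lipschitz_bump (V := V) (a := s / 4) (b := s / 2)
    (by positivity) (by linarith)
  have hnear : ∀ᶠ y in 𝓝 x, K * ‖y - x‖ < 1 / 2 := by
    have : Tendsto (fun y => (K : ℝ) * ‖y - x‖) (𝓝 x) (𝓝 (K * ‖x - x‖)) :=
      (Continuous.tendsto (by fun_prop) x)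
    refine this.eventually_lt_const (by simp)
  filter_upwards [nhdsWithin_le_nhds hnear] with y hy
  obtain ⟨g, hg, hgx⟩ := exists_biLipSupp_eq_add (W := ball (0 : V) R)
    (φ := fun w => η (w - x) • (y - x)) (by
      refine LipschitzWith.of_dist_le_mul fun a b => ?_
      rw [dist_eq_norm, ← sub_smul, norm_smul, dist_eq_norm]
      have h2 := hK.norm_sub_le (a - x) (b - x)
      rw [sub_sub_sub_cancel_right] at h2
      calc _ ≤ (K * ‖a - b‖) * ‖y - x‖ := by gcongr
        _ = (K * ‖y - x‖) * ‖a - b‖ := by ring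
        _ ≤ _ := by
          gcongr
          simpa using hy.le) (by
      intro w hw
      have : η (w - x) = 0 := h0 _ (by
        by_contra! hlt
        exact hw (hsub (by rw [mem_ball, dist_eq_norm]; linarith)).1)
      simp [this])
  refine ⟨g, hg, s / 4, by positivity, fun i w hw => ?_⟩
  rw [hgx]
  by_cases hij : i = j
  · subst hij
    simp only [Function.update_self, add_sub_cancel_left, h1 w hw, one_smul]
    abel
  · simp only [Function.update_of_ne hij]
    have : η (t i + w - x) = 0 := h0 _ (by
      have h3 : s ≤ ‖t i - x‖ := by
        by_contra! hlt
        exact (hsub (by rwa [mem_ball, dist_eq_norm])).2 ⟨i, hij, rfl⟩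
      have h4 : t i - x = (t i + w - x) - w := by abel
      have h5 := norm_sub_le (t i + w - x) w
      rw [← h4] at h5
      linarith)
    simp [this]

lemma translRel_of_disjoint {ι : Type*} [Finite ι] (hV : 1 < Module.finrank ℝ V)
    {R : ℝ} (hR : 0 < R) {t u : ι → V} (ht : Function.Injective t) (hu : Function.Injective u)
    (htR : ∀ i, t i ∈ ball (0 : V) R) (huR : ∀ i, u i ∈ ball (0 : V) R)
    (htu : ∀ i j, t i ≠ u j) : TranslRel R t u := by
  classical
  have := Fintype.ofFinite ι
  have key : ∀ s : Finset ι, TranslRel R t (s.piecewise u t) := by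
    intro s
    induction s using Finset.induction_on with
    | empty => simpa using TranslRel.refl t
    | insert j s hj ih =>
      refine ih.trans ?_
      have h := translRel_update hV hR (t := s.piecewise u t) j (x := t j) (y := u j) ?_ ?_
      · rw [← Finset.piecewise_insert] at h
        convert h using 1
        conv_lhs => rw [← Function.update_eq_self j (s.piecewise u t)]
        simp [hj]
      · refine ⟨htR j, ?_⟩
        rintro ⟨i, hij, h⟩
        by_cases hi : i ∈ s
        · rw [Finset.piecewise_eq_of_mem _ _ _ hi] at h
          exact htu _ _ h.symm
        · rw [Finset.piecewise_eq_of_notMem _ _ _ hi] at h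
          exact hij (ht h)
      · refine ⟨huR j, ?_⟩
        rintro ⟨i, hij, h⟩
        by_cases hi : i ∈ s
        · rw [Finset.piecewise_eq_of_mem _ _ _ hi] at h
          exact hij (hu h)
        · rw [Finset.piecewise_eq_of_notMem _ _ _ hi] at h
          exact htu _ _ h
  simpa using key Finset.univ

lemma translRel_of_injective {ι : Type*} [Finite ι] (hV : 1 < Module.finrank ℝ V)
    {R : ℝ} (hR : 0 < R) {t u : ι → V} (ht : Function.Injective t) (hu : Function.Injective u)
    (htR : ∀ i, t i ∈ ball (0 : V) R) (huR : ∀ i, u i ∈ ball (0 : V) R) : TranslRel R t u := by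
  have : Nontrivial V := Module.nontrivial_of_finrank_pos (R := ℝ) (by omega)
  have hinf : (ball (0 : V) R \ (range t ∪ range u)).Infinite :=
    (infinite_of_mem_nhds (0 : V) (ball_mem_nhds _ hR)).sdiff
      ((finite_range t).union (finite_range u))
  have := hinf.to_subtype
  obtain ⟨w⟩ : Nonempty (ι ↪ ↑(ball (0 : V) R \ (range t ∪ range u))) := by
    have := Fintype.ofFinite ι
    exact ⟨(Fintype.equivFin ι).toEmbedding.trans (Fin.valEmbedding.trans (Infinite.natEmbedding _))⟩
  have hw : Function.Injective fun i => (w i : V) := Subtype.val_injective.comp w.injective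
  refine (translRel_of_disjoint hV hR ht hw htR (fun i => (w i).2.1) fun i j h => ?_).trans
    (translRel_of_disjoint hV hR hw hu (fun i => (w i).2.1) huR fun i j h => ?_)
  · exact (w j).2.2 (Or.inl ⟨i, h⟩)
  · exact (w i).2.2 (Or.inr ⟨j, h.symm⟩)

/-- Simultaneous rescaling of disjoint balls. -/
lemma exists_biLipSupp_scale {ι : Type*} [Finite ι] {W : Set V} {c : ι → V} {R : ℝ}
    (hW : ∀ i, ball (c i) R ⊆ W) (hdisj : Pairwise fun i j => Disjoint (ball (c i) R) (ball (c j) R))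
    {a b : ℝ} (ha : a ∈ Ioo 0 R) (hb : b ∈ Ioo 0 R) :
    ∃ g ∈ biLipSupp W, ∀ i x, ‖x‖ ≤ 1 → g (c i + a • x) = c i + b • x := by
  have := Fintype.ofFinite ι
  refine isPreconnected_Ioo.induction₂
    (fun a b => ∃ g ∈ biLipSupp W, ∀ i x, ‖x‖ ≤ 1 → g (c i + a • x) = c i + b • x) ?_
    ?_ ?_ ha hb
  · intro a ha
    obtain ⟨η, -, ⟨K, hK⟩, h1, h0⟩ := exists_lipschitz_bump (V := V) ha.1 ha.2
    let Φ : V → V := fun w => ∑ i, η (w - c i) • (w - c i)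
    obtain ⟨J, hΦ⟩ : ∃ J, LipschitzWith J Φ := exists_lipschitzWith_sum fun i =>
      ⟨_, hK.comp (LipschitzWith.id.sub (LipschitzWith.const (c i)))⟩
    have hnear : ∀ᶠ b in 𝓝 a, J * |(b - a) / a| < 1 / 2 := by
      have : Tendsto (fun b => (J : ℝ) * |(b - a) / a|) (𝓝 a) (𝓝 (J * |(a - a) / a|)) :=
        (Continuous.tendsto (by fun_prop) a)
      refine this.eventually_lt_const (by simp)
    filter_upwards [nhdsWithin_le_nhds hnear] with b hb
    obtain ⟨g, hg, hgx⟩ := exists_biLipSupp_eq_add (W := W)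
      (φ := fun w => ((b - a) / a) • Φ w) (by
        refine LipschitzWith.of_dist_le_mul fun x y => ?_
        rw [dist_eq_norm, ← smul_sub, norm_smul, dist_eq_norm, Real.norm_eq_abs]
        have h2 := hΦ.norm_sub_le x y
        calc _ ≤ |(b - a) / a| * (J * ‖x - y‖) := by gcongr
          _ = (J * |(b - a) / a|) * ‖x - y‖ := by ring
          _ ≤ _ := by
            gcongr
            simpa using hb.le) (by
        intro w hw
        have : Φ w = 0 := Finset.sum_eq_zero fun i _ => by
          rw [h0, zero_smul]
          by_contra! hlt
          exact hw (hW i (by rwa [mem_ball, dist_eq_norm]))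
        simp [this])
    refine ⟨g, hg, fun i x hx => ?_⟩
    have hax : ‖a • x‖ ≤ a := by
      rw [norm_smul, Real.norm_of_nonneg ha.1.le]
      nlinarith [ha.1]
    have : Φ (c i + a • x) = a • x := by
      have : ∀ j ∈ Finset.univ, j ≠ i →
          η (c i + a • x - c j) • (c i + a • x - c j) = 0 := fun j _ hj => by
        rw [h0, zero_smul]
        by_contra! hlt
        refine Set.disjoint_left.1 (hdisj hj) (?_ : c i + a • x ∈ _) ?_
        · rwa [mem_ball, dist_eq_norm]
        · rw [mem_ball, dist_eq_norm, add_sub_cancel_left]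
          exact hax.trans_lt ha.2
      simp only [Φ]
      rw [Finset.sum_eq_single_of_mem i (Finset.mem_univ _) this, add_sub_cancel_left, h1 _ hax,
        one_smul]
    rw [hgx, this, smul_smul, div_mul_cancel₀ _ ha.1.ne', add_assoc, ← add_smul]
    simp
  · rintro a b d - - - ⟨g, hg, h⟩ ⟨g', hg', h'⟩
    exact ⟨g' * g, mul_mem hg' hg, fun i x hx => by rw [Equiv.Perm.mul_apply, h i x hx, h' i x hx]⟩
  · rintro a b - - ⟨g, hg, h⟩
    refine ⟨g⁻¹, inv_mem hg, fun i x hx => ?_⟩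
    rw [← h i x hx]
    exact g.symm_apply_apply _

lemma exists_biLipSupp_rearrange {ι : Type*} [Finite ι] (hV : 1 < Module.finrank ℝ V) {R : ℝ}
    (hR : 0 < R) {r ρ r' ρ' : ℝ} (hr : 0 < r) (hr' : r < r') (hρ : 0 < ρ) (hρ' : ρ < ρ')
    {t u : ι → V}
    (ht : ∀ i, ball (t i) r' ⊆ ball 0 R) (hu : ∀ i, ball (u i) ρ' ⊆ ball 0 R)
    (htd : Pairwise fun i j => Disjoint (ball (t i) r') (ball (t j) r'))
    (hud : Pairwise fun i j => Disjoint (ball (u i) ρ') (ball (u j) ρ')) :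
    ∃ g ∈ biLipSupp (ball (0 : V) R), ∀ i x, ‖x‖ ≤ 1 → g (t i + r • x) = u i + ρ • x := by
  have hinj : ∀ {c : ι → V} {s : ℝ}, 0 < s →
      (Pairwise fun i j => Disjoint (ball (c i) s) (ball (c j) s)) → Function.Injective c := by
    intro c s hs hd i j hij
    by_contra hne
    refine Set.disjoint_left.1 (hd hne) (mem_ball_self hs : c i ∈ _) ?_
    rw [hij]; exact mem_ball_self hs
  obtain ⟨g, hg, δ, hδ, h⟩ := translRel_of_injective hV hR (hinj (hr.trans hr') htd)
    (hinj (hρ.trans hρ') hud) (fun i => ht i (mem_ball_self (hr.trans hr')))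
    (fun i => hu i (mem_ball_self (hρ.trans hρ')))
  set a := min δ (min r ρ)
  have ha : 0 < a := lt_min hδ (lt_min hr hρ)
  have har : a ≤ r := (min_le_right _ _).trans (min_le_left _ _)
  have haρ : a ≤ ρ := (min_le_right _ _).trans (min_le_right _ _)
  obtain ⟨g₁, hg₁, h₁⟩ := exists_biLipSupp_scale ht htd (a := r) (b := a) ⟨hr, hr'⟩
    ⟨ha, har.trans_lt hr'⟩
  obtain ⟨g₂, hg₂, h₂⟩ := exists_biLipSupp_scale hu hud (a := a) (b := ρ)
    ⟨ha, haρ.trans_lt hρ'⟩ ⟨hρ, hρ'⟩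
  refine ⟨g₂ * (g * g₁), mul_mem hg₂ (mul_mem hg hg₁), fun i x hx => ?_⟩
  rw [Equiv.Perm.mul_apply, Equiv.Perm.mul_apply, h₁ i x hx, h i, h₂ i x hx]
  rw [norm_smul, Real.norm_of_nonneg ha.le]
  nlinarith [min_le_left δ (min r ρ), norm_nonneg x]

end Rearrangement

section CantorMaps

variable {V : Type*} [NormedAddCommGroup V] [InnerProductSpace ℝ V]

lemma nonpos_of_contraction {X : Type*} {P : X → Prop} {e : X → ℝ} {C q : ℝ} (hq : 0 ≤ q)
    (hq1 : q < 1) (hC : ∀ x, P x → e x ≤ C)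
    (h : ∀ x, P x → e x ≤ 0 ∨ ∃ y, P y ∧ e x ≤ q * e y) {x : X} (hx : P x) : e x ≤ 0 := by
  have key : ∀ k : ℕ, ∀ x, P x → e x ≤ max C 0 * q ^ k := by
    intro k
    induction k with
    | zero => intro x hx; simpa using Or.inl (hC x hx)
    | succ k ih =>
      intro x hx
      obtain h0 | ⟨y, hy, hxy⟩ := h x hx
      · exact h0.trans (by positivity)
      · calc e x ≤ q * e y := hxy
          _ ≤ q * (max C 0 * q ^ k) := by gcongr; exact ih y hy
          _ = _ := by ring
  have ht : Tendsto (fun k : ℕ => max C 0 * q ^ k) atTop (𝓝 (max C 0 * 0)) :=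
    (tendsto_pow_atTop_nhds_zero_of_lt_one hq hq1).const_mul _
  rw [mul_zero] at ht
  exact ge_of_tendsto' ht fun k => key k x hx

variable (V) in
/-- Data for a self-similar homeomorphism carrying the attractor of `x ↦ t i + r • x` onto the
attractor of `x ↦ u i + ρ • x`. -/
structure CantorData (ι : Type*) where
  (r ρ : ℝ)
  (t u : ι → V)
  (g : Equiv.Perm V)
  r_pos : 0 < r
  r_lt_one : r < 1
  ρ_pos : 0 < ρ
  ρ_lt_one : ρ < 1
  t_norm : ∀ i, ‖t i‖ + r < 1 / 2
  u_norm : ∀ i, ‖u i‖ + ρ < 1 / 2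
  t_sep : ∀ i j, i ≠ j → 2 * r < ‖t i - t j‖
  u_sep : ∀ i j, i ≠ j → 2 * ρ < ‖u i - u j‖
  g_mem : g ∈ biLipSupp (ball (0 : V) (1 / 2))
  g_map : ∀ i x, ‖x‖ ≤ 1 → g (t i + r • x) = u i + ρ • x

namespace CantorData

variable {ι : Type*} (D : CantorData V ι)

/-- The data of the inverse homeomorphism. -/
def symm : CantorData V ι where
  r := D.ρ
  ρ := D.r
  t := D.u
  u := D.t
  g := D.g⁻¹
  r_pos := D.ρ_pos
  r_lt_one := D.ρ_lt_one
  ρ_pos := D.r_pos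
  ρ_lt_one := D.r_lt_one
  t_norm := D.u_norm
  u_norm := D.t_norm
  t_sep := D.u_sep
  u_sep := D.t_sep
  g_mem := inv_mem D.g_mem
  g_map := fun i x hx => by
    rw [← D.g_map i x hx]
    exact D.g.symm_apply_apply _

/-- Inverse of the similarity `x ↦ t i + r • x`. -/
def pull (i : ι) (x : V) : V := D.r⁻¹ • (x - D.t i)

lemma pull_push (i : ι) (x : V) : D.pull i (D.t i + D.r • x) = x := by
  simp [pull, D.r_pos.ne']

lemma push_pull (i : ι) (x : V) : D.t i + D.r • D.pull i x = x := by
  simp [pull, D.r_pos.ne']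

lemma pull_sub (i : ι) (x y : V) : D.pull i x - D.pull i y = D.r⁻¹ • (x - y) := by
  rw [pull, pull, ← smul_sub, sub_sub_sub_cancel_right]

lemma norm_pull_sub (i : ι) (x y : V) : ‖D.pull i x - D.pull i y‖ = D.r⁻¹ * ‖x - y‖ := by
  rw [pull_sub, norm_smul, Real.norm_of_nonneg (inv_nonneg.2 D.r_pos.le)]

lemma continuous_pull (i : ι) : Continuous (D.pull i) := by
  unfold pull; fun_prop

lemma norm_push_lt {x : V} (hx : ‖x‖ ≤ 1) (i : ι) : ‖D.t i + D.r • x‖ < 1 / 2 := by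
  have h1 := norm_add_le (D.t i) (D.r • x)
  rw [norm_smul, Real.norm_of_nonneg D.r_pos.le] at h1
  nlinarith [D.t_norm i, D.r_pos]

lemma one_lt_norm_pull_of_ne {i j : ι} (hij : j ≠ i) {x : V} (hx : ‖D.pull i x‖ ≤ 1) :
    1 < ‖D.pull j x‖ := by
  have h1 := D.t_sep j i hij
  have h2 : D.t j - D.t i = D.r • D.pull i x - D.r • D.pull j x := by
    rw [sub_eq_sub_iff_add_eq_add, push_pull, add_comm, push_pull]
  have h3 := norm_sub_le (D.r • D.pull i x) (D.r • D.pull j x)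
  rw [← h2, norm_smul, norm_smul, Real.norm_of_nonneg D.r_pos.le] at h3
  by_contra! h
  nlinarith [D.r_pos]

lemma one_lt_norm_pull_of_norm {x : V} (hx : 1 / 2 ≤ ‖x‖) (i : ι) : 1 < ‖D.pull i x‖ := by
  by_contra! h
  have := D.norm_push_lt h i
  rw [push_pull] at this
  linarith

lemma norm_g_lt {x : V} (hx : ‖x‖ < 1 / 2) : ‖D.g x‖ < 1 / 2 := by
  by_contra! h
  have := D.g.injective (D.g_mem.2.2 (D.g x) (by simpa using h))
  rw [this] at h
  linarith

lemma g_of_le {x : V} (hx : 1 / 2 ≤ ‖x‖) : D.g x = x :=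
  D.g_mem.2.2 x (by simpa using hx)

lemma exists_g_le_mul : ∃ H, ∀ x y y', ‖y - x‖ = ‖y' - x‖ →
    ‖D.g y - D.g x‖ ≤ H * ‖D.g y' - D.g x‖ := by
  obtain ⟨⟨K, hK⟩, ⟨K', hK'⟩, -⟩ := D.g_mem
  refine ⟨K * K', fun x y y' h => ?_⟩
  have h1 := hK.norm_sub_le y x
  have h2 := hK'.norm_sub_le (D.g y') (D.g x)
  simp only [Equiv.symm_apply_apply] at h2
  calc ‖D.g y - D.g x‖ ≤ K * ‖y' - x‖ := h ▸ h1
    _ ≤ K * (K' * ‖D.g y' - D.g x‖) := by gcongr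
    _ = _ := by ring

lemma summable_pow : Summable fun k : ℕ => D.ρ ^ k :=
  summable_geometric_of_lt_one D.ρ_pos.le D.ρ_lt_one

variable [Fintype ι]

/-- The transfer operator on displacement fields. -/
def transfer (w : V → V) (x : V) : V := ∑ i, D.ρ • w (D.pull i x)

lemma transfer_of_norm_pull_le {w : V → V} (hw : ∀ x, 1 / 2 ≤ ‖x‖ → w x = 0) {i : ι} {x : V}
    (hx : ‖D.pull i x‖ ≤ 1) : D.transfer w x = D.ρ • w (D.pull i x) := by
  refine Finset.sum_eq_single_of_mem i (Finset.mem_univ _) fun j _ hj => ?_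
  rw [hw _ (by linarith [D.one_lt_norm_pull_of_ne hj hx]), smul_zero]

lemma transfer_of_forall_le {w : V → V} (hw : ∀ x, 1 / 2 ≤ ‖x‖ → w x = 0) {x : V}
    (hx : ∀ i, 1 / 2 ≤ ‖D.pull i x‖) : D.transfer w x = 0 :=
  Finset.sum_eq_zero fun i _ => by rw [hw _ (hx i), smul_zero]

lemma transfer_eq_zero {w : V → V} (hw : ∀ x, 1 / 2 ≤ ‖x‖ → w x = 0) {x : V} (hx : 1 / 2 ≤ ‖x‖) :
    D.transfer w x = 0 :=
  D.transfer_of_forall_le hw fun i => by linarith [D.one_lt_norm_pull_of_norm hx i]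

lemma norm_transfer_le {w : V → V} (hw : ∀ x, 1 / 2 ≤ ‖x‖ → w x = 0) {C : ℝ} (hC : 0 ≤ C)
    (hwC : ∀ x, ‖w x‖ ≤ C) (x : V) : ‖D.transfer w x‖ ≤ D.ρ * C := by
  by_cases h : ∃ i, ‖D.pull i x‖ ≤ 1
  · obtain ⟨i, hi⟩ := h
    rw [D.transfer_of_norm_pull_le hw hi, norm_smul, Real.norm_of_nonneg D.ρ_pos.le]
    exact mul_le_mul_of_nonneg_left (hwC _) D.ρ_pos.le
  · push Not at h
    rw [D.transfer_of_forall_le hw fun i => by linarith [h i], norm_zero]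
    exact mul_nonneg D.ρ_pos.le hC

lemma lipschitz_transfer {w : V → V} (hw : ∃ K, LipschitzWith K w) :
    ∃ K, LipschitzWith K (D.transfer w) := by
  obtain ⟨K, hK⟩ := hw
  refine exists_lipschitzWith_sum fun i =>
    ⟨_, ((lipschitzWith_smul D.ρ).comp (hK.comp (β := V) ((lipschitzWith_smul D.r⁻¹).comp
      (LipschitzWith.id.sub (LipschitzWith.const (D.t i))))))⟩

/-- The terms of the series defining the displacement. -/
def term (k : ℕ) : V → V := D.transfer^[k] fun x => D.g x - x

lemma term_succ (k : ℕ) : D.term (k + 1) = D.transfer (D.term k) :=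
  Function.iterate_succ_apply' _ _ _

lemma term_eq_zero (k : ℕ) : ∀ x, 1 / 2 ≤ ‖x‖ → D.term k x = 0 := by
  induction k with
  | zero => intro x hx; simp [term, D.g_of_le hx]
  | succ k ih => intro x hx; rw [term_succ]; exact D.transfer_eq_zero ih hx

lemma norm_term_le (k : ℕ) : ∀ x, ‖D.term k x‖ ≤ D.ρ ^ k := by
  induction k with
  | zero =>
    intro x
    obtain hx | hx := le_or_gt (1 / 2) ‖x‖
    · rw [D.term_eq_zero 0 x hx]; simp
    · have := norm_sub_le (D.g x) x
      have := D.norm_g_lt hx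
      simp only [term, Function.iterate_zero, id, pow_zero]
      linarith
  | succ k ih =>
    intro x
    rw [term_succ, pow_succ']
    exact D.norm_transfer_le (D.term_eq_zero k) (pow_nonneg D.ρ_pos.le _) ih x

lemma lipschitz_term (k : ℕ) : ∃ K, LipschitzWith K (D.term k) := by
  induction k with
  | zero => exact ⟨_, D.g_mem.1.choose_spec.sub LipschitzWith.id⟩
  | succ k ih => rw [term_succ]; exact D.lipschitz_transfer ih

lemma continuous_term (k : ℕ) : Continuous (D.term k) :=
  (D.lipschitz_term k).choose_spec.continuous

/-- The displacement of the self-similar homeomorphism. -/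
def disp (x : V) : V := ∑' k, D.term k x

lemma disp_eq_zero {x : V} (hx : 1 / 2 ≤ ‖x‖) : D.disp x = 0 := by
  simp [disp, D.term_eq_zero _ x hx]

lemma norm_disp_le (x : V) : ‖D.disp x‖ ≤ (1 - D.ρ)⁻¹ :=
  tsum_of_norm_bounded (hasSum_geometric_of_lt_one D.ρ_pos.le D.ρ_lt_one)
    fun k => D.norm_term_le k x

/-- The self-similar homeomorphism. -/
def toFun (x : V) : V := x + D.disp x

lemma toFun_of_le {x : V} (hx : 1 / 2 ≤ ‖x‖) : D.toFun x = x := by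
  rw [toFun, D.disp_eq_zero hx, add_zero]

variable [FiniteDimensional ℝ V]

lemma summable_term (x : V) : Summable fun k => D.term k x :=
  Summable.of_norm_bounded D.summable_pow fun k => D.norm_term_le k x

lemma continuous_toFun : Continuous D.toFun :=
  continuous_id.add (continuous_tsum D.continuous_term D.summable_pow D.norm_term_le)

lemma toFun_eq (x : V) : D.toFun x = D.g x + D.transfer D.disp x := by
  have h : D.transfer D.disp x = ∑' k, D.term (k + 1) x := by
    simp only [term_succ, transfer]
    rw [Summable.tsum_finsetSum fun i _ => (D.summable_term _).const_smul _]
    exact Finset.sum_congr rfl fun i _ => ((D.summable_term _).tsum_const_smul _).symm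
  rw [toFun, disp, (D.summable_term x).tsum_eq_zero_add, h]
  simp only [term, Function.iterate_zero, id]
  abel

lemma toFun_of_norm_pull_le {i : ι} {x : V} (hx : ‖D.pull i x‖ ≤ 1) :
    D.toFun x = D.u i + D.ρ • D.toFun (D.pull i x) := by
  rw [toFun_eq, D.transfer_of_norm_pull_le (fun _ => D.disp_eq_zero) hx]
  nth_rewrite 1 [← D.push_pull i x]
  rw [D.g_map i _ hx, toFun, smul_add, add_assoc]

lemma toFun_push (i : ι) {x : V} (hx : ‖x‖ ≤ 1) :
    D.toFun (D.t i + D.r • x) = D.u i + D.ρ • D.toFun x := by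
  rw [D.toFun_of_norm_pull_le (i := i) (by rwa [pull_push]), pull_push]

lemma toFun_of_forall_le {x : V} (hx : ∀ i, 1 / 2 ≤ ‖D.pull i x‖) : D.toFun x = D.g x := by
  rw [toFun_eq, D.transfer_of_forall_le (fun _ => D.disp_eq_zero) hx, add_zero]

lemma norm_toFun_le {x : V} (hx : ‖x‖ ≤ 1) : ‖D.toFun x‖ ≤ 1 := by
  suffices ‖D.toFun x‖ - 1 ≤ 0 by linarith
  refine nonpos_of_contraction (P := fun x : V => ‖x‖ ≤ 1) (e := fun x => ‖D.toFun x‖ - 1)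
    (C := (1 - D.ρ)⁻¹) D.ρ_pos.le D.ρ_lt_one (fun x hx => ?_) (fun x hx => ?_) hx
  · have := norm_add_le x (D.disp x)
    have := D.norm_disp_le x
    simp only [toFun]
    linarith
  · by_cases h : ∃ i, ‖D.pull i x‖ ≤ 1
    · obtain ⟨i, hi⟩ := h
      refine Or.inr ⟨_, hi, ?_⟩
      rw [D.toFun_of_norm_pull_le hi]
      have := norm_add_le (D.u i) (D.ρ • D.toFun (D.pull i x))
      rw [norm_smul, Real.norm_of_nonneg D.ρ_pos.le] at this
      linarith [D.u_norm i]
    · push Not at h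
      left
      rw [D.toFun_of_forall_le fun i => by linarith [h i]]
      obtain h' | h' := le_or_gt (1 / 2) ‖x‖
      · rw [D.g_of_le h']; linarith
      · linarith [D.norm_g_lt h']

lemma symm_toFun_toFun (x : V) : D.symm.toFun (D.toFun x) = x := by
  obtain hx | hx := le_or_gt 1 ‖x‖
  · rw [D.toFun_of_le (by linarith), D.symm.toFun_of_le (by linarith)]
  suffices ‖D.symm.toFun (D.toFun x) - x‖ ≤ 0 from sub_eq_zero.1 (norm_le_zero_iff.1 this)
  refine nonpos_of_contraction (P := fun x : V => ‖x‖ ≤ 1)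
    (e := fun x => ‖D.symm.toFun (D.toFun x) - x‖) (C := 2)
    D.r_pos.le D.r_lt_one (fun x hx => ?_) (fun x hx => ?_) hx.le
  · have := norm_sub_le (D.symm.toFun (D.toFun x)) x
    have := D.symm.norm_toFun_le (D.norm_toFun_le hx)
    linarith
  · by_cases h : ∃ i, ‖D.pull i x‖ ≤ 1
    · obtain ⟨i, hi⟩ := h
      refine Or.inr ⟨_, hi, ?_⟩
      rw [D.toFun_of_norm_pull_le hi]
      have h1 := D.symm.toFun_push i (D.norm_toFun_le hi)
      change D.symm.toFun (D.u i + D.ρ • _) = D.t i + D.r • _ at h1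
      rw [h1]
      nth_rewrite 2 [← D.push_pull i x]
      rw [add_sub_add_left_eq_sub, ← smul_sub, norm_smul, Real.norm_of_nonneg D.r_pos.le]
    · push Not at h
      left
      rw [D.toFun_of_forall_le fun i => by linarith [h i], D.symm.toFun_of_forall_le]
      · simp [symm]
      · intro i
        by_contra! hlt
        have h1 : D.u i + D.ρ • D.symm.pull i (D.g x) = D.g x := D.symm.push_pull i (D.g x)
        rw [← D.g_map i _ (by linarith)] at h1
        have h2 := D.g.injective h1
        have h3 := h i
        rw [← h2, pull_push] at h3
        linarith

lemma isHomeoOn_toFun : IsHomeoOn D.toFun univ univ := by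
  have h1 : Function.LeftInverse D.symm.toFun D.toFun := D.symm_toFun_toFun
  have h2 : Function.RightInverse D.symm.toFun D.toFun := D.symm.symm_toFun_toFun
  exact ⟨bijOn_univ.2 ⟨h1.injective, h2.surjective⟩, D.continuous_toFun.continuousOn,
    D.symm.toFun, ⟨h1.leftInvOn _, h2.rightInvOn _⟩, D.symm.continuous_toFun.continuousOn⟩

end CantorData
end CantorMaps

section Quasiconformality

variable {V : Type*} [NormedAddCommGroup V]

lemma limsup_stretch_le {f : V → V} {x : V} {K δ : ℝ} (hK : 0 ≤ K) (hδ : 0 < δ)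
    (hne : ∀ s : ℝ, 0 < s → ∃ y, ‖y - x‖ = s)
    (h : ∀ y y', ‖y - x‖ = ‖y' - x‖ → ‖y - x‖ < δ → ‖f y - f x‖ ≤ K * ‖f y' - f x‖) :
    limsup (fun s => maxStretch univ f x s / minStretch univ f x s) (𝓝[>] (0 : ℝ)) ≤ K := by
  have hnonneg : ∀ s, 0 ≤ maxStretch univ f x s / minStretch univ f x s := fun s =>
    div_nonneg (Real.sSup_nonneg (by rintro _ ⟨y, -, rfl⟩; exact dist_nonneg))
      (Real.sInf_nonneg (by rintro _ ⟨y, -, rfl⟩; exact dist_nonneg))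
  refine limsup_le_of_le (isCoboundedUnder_le_of_le _ hnonneg) ?_
  filter_upwards [Ioo_mem_nhdsGT hδ] with s hs
  obtain ⟨z, hz⟩ := hne s hs.1
  have hmem : ∀ y, ‖y - x‖ = s → dist (f y) (f x) ∈
      (fun y => dist (f y) (f x)) '' {y ∈ univ | dist y x = s} := fun y hy =>
    ⟨y, ⟨mem_univ _, by rwa [dist_eq_norm]⟩, rfl⟩
  refine div_le_of_le_mul₀ (Real.sInf_nonneg (by rintro _ ⟨y, -, rfl⟩; exact dist_nonneg)) hK ?_
  refine csSup_le ⟨_, hmem z hz⟩ ?_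
  rintro _ ⟨y, ⟨-, hy⟩, rfl⟩
  rw [dist_eq_norm] at hy
  rw [minStretch, ← smul_eq_mul, ← Real.sInf_smul_of_nonneg hK]
  refine le_csInf (Set.Nonempty.smul_set ⟨_, hmem z hz⟩) ?_
  rintro _ ⟨_, ⟨y', ⟨-, hy'⟩, rfl⟩, rfl⟩
  rw [dist_eq_norm] at hy'
  simp only [dist_eq_norm, smul_eq_mul]
  exact h y y' (hy.trans hy'.symm) (hy ▸ hs.2)

variable [InnerProductSpace ℝ V] [FiniteDimensional ℝ V]

namespace CantorData

variable {ι : Type*} [Fintype ι] (D : CantorData V ι)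

lemma hasCompactSupport_disp : HasCompactSupport D.disp :=
  HasCompactSupport.intro (isCompact_closedBall (0 : V) (1 / 2)) fun x hx =>
    D.disp_eq_zero (by simpa using le_of_lt (by simpa using hx))

lemma continuous_disp : Continuous D.disp :=
  continuous_tsum D.continuous_term D.summable_pow D.norm_term_le

lemma uniformContinuous_toFun : UniformContinuous D.toFun :=
  uniformContinuous_id.add
    (D.hasCompactSupport_disp.uniformContinuous_of_continuous D.continuous_disp)

lemma exists_le_mul_of_large {a : ℝ} (ha : 0 < a) : ∃ H, ∀ x y y', ‖y - x‖ = ‖y' - x‖ →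
    a ≤ ‖y - x‖ → ‖D.toFun y - D.toFun x‖ ≤ H * ‖D.toFun y' - D.toFun x‖ := by
  obtain ⟨δ, hδ, hδa⟩ := Metric.uniformContinuous_iff.1 D.symm.uniformContinuous_toFun a ha
  set C := (1 - D.ρ)⁻¹ with hC
  have hC0 : 0 ≤ C := inv_nonneg.2 (by linarith [D.ρ_lt_one])
  have hclose : ∀ x y, |‖D.toFun y - D.toFun x‖ - ‖y - x‖| ≤ 2 * C := fun x y => by
    refine (abs_norm_sub_norm_le _ _).trans ?_
    have : D.toFun y - D.toFun x - (y - x) = D.disp y - D.disp x := by simp only [toFun]; abel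
    rw [this]
    linarith [norm_sub_le (D.disp y) (D.disp x), D.norm_disp_le x, D.norm_disp_le y]
  refine ⟨max 3 (6 * C / δ), fun x y y' hyy' hy => ?_⟩
  have h1 := abs_le.1 (hclose x y)
  have h2 := abs_le.1 (hclose x y')
  obtain hs | hs := le_total (4 * C) ‖y - x‖
  · calc ‖D.toFun y - D.toFun x‖ ≤ 3 * ‖D.toFun y' - D.toFun x‖ := by linarith
      _ ≤ _ := by gcongr; exact le_max_left _ _
  · have h3 : δ ≤ ‖D.toFun y' - D.toFun x‖ := by
      by_contra! hlt
      have := hδa (a := D.toFun y') (b := D.toFun x) (by rwa [dist_eq_norm])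
      rw [symm_toFun_toFun, symm_toFun_toFun, dist_eq_norm] at this
      linarith
    calc ‖D.toFun y - D.toFun x‖ ≤ 6 * C / δ * δ := by
          rw [div_mul_cancel₀ _ hδ.ne']; linarith
      _ ≤ max 3 (6 * C / δ) * ‖D.toFun y' - D.toFun x‖ := by
          gcongr; exact le_max_right _ _

/-- The self-similar homeomorphism is weakly quasisymmetric. -/
lemma exists_toFun_le_mul : ∃ H, ∀ x y y', ‖y - x‖ = ‖y' - x‖ →
    ‖D.toFun y - D.toFun x‖ ≤ H * ‖D.toFun y' - D.toFun x‖ := by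
  obtain ⟨H₁, hH₁⟩ := D.exists_le_mul_of_large (a := D.r / 4) (by linarith [D.r_pos])
  obtain ⟨H₂, hH₂⟩ := D.exists_g_le_mul
  refine ⟨max H₁ H₂, fun x y y' hyy' => ?_⟩
  have key : ∀ k : ℕ, ∀ x y y', ‖y - x‖ = ‖y' - x‖ → D.r ^ k * (D.r / 4) ≤ ‖y - x‖ →
      ‖D.toFun y - D.toFun x‖ ≤ max H₁ H₂ * ‖D.toFun y' - D.toFun x‖ := by
    intro k
    induction k with
    | zero =>
      intro x y y' h hle
      refine (hH₁ x y y' h (by simpa using hle)).trans ?_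
      gcongr; exact le_max_left _ _
    | succ k ih =>
      intro x y y' h hle
      obtain hs | hs := le_or_gt (D.r / 4) ‖y - x‖
      · refine (hH₁ x y y' h hs).trans ?_
        gcongr; exact le_max_left _ _
      have hr := D.r_pos
      have hp : ∀ i z, ‖z - x‖ = ‖y - x‖ → |‖D.pull i z‖ - ‖D.pull i x‖| ≤ 1 / 4 := by
        intro i z hz
        refine (abs_norm_sub_norm_le _ _).trans ?_
        rw [norm_pull_sub, hz, inv_mul_le_iff₀ hr]
        linarith
      by_cases hx : ∃ i, ‖D.pull i x‖ ≤ 3 / 4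
      · obtain ⟨i, hi⟩ := hx
        have h1 := abs_le.1 (hp i y rfl)
        have h2 := abs_le.1 (hp i y' h.symm)
        rw [D.toFun_of_norm_pull_le (i := i) (x := x) (by linarith),
          D.toFun_of_norm_pull_le (i := i) (x := y) (by linarith),
          D.toFun_of_norm_pull_le (i := i) (x := y') (by linarith), add_sub_add_left_eq_sub,
          add_sub_add_left_eq_sub, ← smul_sub, ← smul_sub, norm_smul, norm_smul,
          mul_left_comm]
        gcongr
        refine ih _ _ _ (by rw [norm_pull_sub, norm_pull_sub, h]) ?_
        rw [norm_pull_sub, le_inv_mul_iff₀ hr]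
        linarith [pow_succ' D.r k, mul_assoc D.r (D.r ^ k) (D.r / 4), hle,
          congrArg (· * (D.r / 4)) (pow_succ' D.r k)]
      · push Not at hx
        rw [D.toFun_of_forall_le (x := x) fun i => by linarith [hx i],
          D.toFun_of_forall_le (x := y) fun i => by linarith [hx i, (abs_le.1 (hp i y rfl)).1],
          D.toFun_of_forall_le (x := y') fun i => by
            linarith [hx i, (abs_le.1 (hp i y' h.symm)).1]]
        refine (hH₂ x y y' h).trans ?_
        gcongr; exact le_max_right _ _
  obtain h0 | h0 := (norm_nonneg (y - x)).eq_or_lt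
  · rw [← h0] at hyy'
    rw [sub_eq_zero.1 (norm_eq_zero.1 h0.symm), sub_eq_zero.1 (norm_eq_zero.1 hyy'.symm)]
    simp
  · have hr := D.r_pos
    obtain ⟨k, hk⟩ := exists_pow_lt_of_lt_one (show 0 < ‖y - x‖ / (D.r / 4) by positivity)
      D.r_lt_one
    exact key k x y y' hyy' ((lt_div_iff₀ (by positivity)).1 hk).le

end CantorData
end Quasiconformality

section RadialMap

lemma one_le_max_one (s : ℝ) : 1 ≤ max 1 s := le_max_left _ _

/-- The radial damping factor. -/
def damp (γ s : ℝ) : ℝ := max 1 s ^ (-γ)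

variable {γ : ℝ}

lemma damp_pos (γ s : ℝ) : 0 < damp γ s :=
  Real.rpow_pos_of_pos (by linarith [one_le_max_one s]) _

lemma damp_of_le {s : ℝ} (hs : s ≤ 1) : damp γ s = 1 := by simp [damp, hs]

lemma damp_anti (hγ : 0 ≤ γ) : Antitone (damp γ) := fun s t hst =>
  Real.rpow_le_rpow_of_nonpos (by linarith [one_le_max_one s]) (max_le_max_left _ hst)
    (by linarith)

lemma continuous_damp : Continuous (damp γ) :=
  (continuous_const.max continuous_id).rpow_const fun s =>
    Or.inl (by simp only [id]; linarith [one_le_max_one s])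

lemma mul_damp_div_damp_le (h0 : 0 ≤ γ) (h1 : γ ≤ 1) {s t : ℝ} (hs : 0 ≤ s) (hst : s ≤ t) :
    s * damp γ s ≤ (γ * t + (1 - γ) * s) * damp γ t := by
  have hms := one_le_max_one s
  have hmt := one_le_max_one t
  obtain rfl | hs' := hs.eq_or_lt
  · have := damp_pos γ t
    rw [zero_mul, mul_zero, add_zero]; positivity
  have hratio : max 1 t / max 1 s ≤ t / s := by
    rw [div_le_div_iff₀ (by linarith) hs']
    obtain h | h := le_total 1 s
    · rw [max_eq_right h, max_eq_right (h.trans hst)]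
    · rw [max_eq_left h, mul_one]
      obtain h' | h' := le_total 1 t
      · rw [max_eq_right h']; nlinarith
      · rw [max_eq_left h']; linarith
  have h2 : damp γ s = (max 1 t / max 1 s) ^ γ * damp γ t := by
    rw [damp, damp, Real.div_rpow (by linarith) (by linarith), Real.rpow_neg (by linarith),
      Real.rpow_neg (by linarith)]
    have := Real.rpow_pos_of_pos (show 0 < max 1 t by linarith) γ
    field_simp
  have h3 : s * (t / s) ^ γ = t ^ γ * s ^ (1 - γ) := by
    rw [Real.div_rpow (hs.trans hst) hs, Real.rpow_sub hs', Real.rpow_one]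
    ring
  calc s * damp γ s = s * (max 1 t / max 1 s) ^ γ * damp γ t := by rw [h2]; ring
    _ ≤ s * (t / s) ^ γ * damp γ t := by
        have := (damp_pos γ t).le
        gcongr
    _ ≤ _ := by
        rw [h3]
        refine mul_le_mul_of_nonneg_right ?_ (damp_pos γ t).le
        exact Real.geom_mean_le_arith_mean2_weighted h0 (by linarith) (hs.trans hst) hs (by ring)

variable {V : Type*} [NormedAddCommGroup V] [InnerProductSpace ℝ V]

/-- The radial map fixing the unit ball and compressing its complement. -/
def radial (γ : ℝ) (x : V) : V := damp γ ‖x‖ • x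

lemma radial_of_le {x : V} (hx : ‖x‖ ≤ 1) : radial γ x = x := by
  rw [radial, damp_of_le hx, one_smul]

lemma continuous_radial : Continuous (radial γ : V → V) :=
  (continuous_damp.comp continuous_norm).smul continuous_id

lemma norm_smul_sub_smul_sq (a b : ℝ) (x y : V) :
    ‖a • x - b • y‖ ^ 2 = (b * ‖y‖ - a * ‖x‖) ^ 2 +
      2 * (a * b) * (‖x‖ * ‖y‖ - inner ℝ x y) := by
  rw [norm_sub_sq_real, norm_smul, norm_smul, real_inner_smul_left, real_inner_smul_right,
    mul_pow, mul_pow, Real.norm_eq_abs, Real.norm_eq_abs, sq_abs, sq_abs]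
  ring

lemma norm_radial_sub_le (h0 : 0 ≤ γ) (h1 : γ ≤ 1) {x y : V} (hxy : ‖x‖ ≤ ‖y‖) :
    ‖radial γ x - radial γ y‖ ≤ damp γ ‖x‖ * ‖x - y‖ := by
  have hd := damp_anti h0 hxy
  have hx := damp_pos γ ‖x‖
  have hy := damp_pos γ ‖y‖
  have hm := mul_damp_div_damp_le h0 h1 (norm_nonneg x) hxy
  have hc := real_inner_le_norm x y
  refine le_of_sq_le_sq ?_ (by positivity)
  have e2 := norm_smul_sub_smul_sq 1 1 x y
  simp only [one_smul, one_mul, mul_one] at e2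
  rw [radial, radial, norm_smul_sub_smul_sq, mul_pow, e2]
  set s := ‖x‖
  set t := ‖y‖
  set a := damp γ s
  set b := damp γ t
  have hs : 0 ≤ s := norm_nonneg x
  have k1 : 0 ≤ b * t - a * s := by nlinarith [mul_nonneg (sub_nonneg.2 h1) (sub_nonneg.2 hxy)]
  have k2 : b * t - a * s ≤ a * (t - s) := by nlinarith
  have k3 : (b * t - a * s) ^ 2 ≤ (a * (t - s)) ^ 2 := by gcongr
  have k4 : a * b ≤ a * a := by gcongr
  nlinarith [mul_le_mul_of_nonneg_right k4 (sub_nonneg.2 hc)]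

lemma le_norm_radial_sub (h0 : 0 ≤ γ) (h1 : γ ≤ 1) {x y : V} (hxy : ‖x‖ ≤ ‖y‖) :
    (1 - γ) * damp γ ‖y‖ * ‖x - y‖ ≤ ‖radial γ x - radial γ y‖ := by
  have hd := damp_anti h0 hxy
  have hx := damp_pos γ ‖x‖
  have hy := damp_pos γ ‖y‖
  have hm := mul_damp_div_damp_le h0 h1 (norm_nonneg x) hxy
  have hc := real_inner_le_norm x y
  refine le_of_sq_le_sq ?_ (norm_nonneg _)
  have e2 := norm_smul_sub_smul_sq 1 1 x y
  simp only [one_smul, one_mul, mul_one] at e2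
  rw [radial, radial, norm_smul_sub_smul_sq, mul_pow, e2]
  set s := ‖x‖
  set t := ‖y‖
  set a := damp γ s
  set b := damp γ t
  have hs : 0 ≤ s := norm_nonneg x
  have k2 : (1 - γ) * b * (t - s) ≤ b * t - a * s := by nlinarith
  have k0 : 0 ≤ (1 - γ) * b * (t - s) :=
    mul_nonneg (mul_nonneg (by linarith) hy.le) (by linarith)
  have k3 : ((1 - γ) * b * (t - s)) ^ 2 ≤ (b * t - a * s) ^ 2 := by gcongr
  have k4 : ((1 - γ) * b) ^ 2 ≤ a * b := by
    have : (1 - γ) ^ 2 ≤ 1 := by nlinarith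
    nlinarith [mul_pos hy hy, mul_le_mul_of_nonneg_right hd hy.le]
  nlinarith [mul_le_mul_of_nonneg_right k4 (sub_nonneg.2 hc)]

lemma lipschitzWith_radial (h0 : 0 ≤ γ) (h1 : γ ≤ 1) : LipschitzWith 1 (radial γ : V → V) := by
  have hd : ∀ s, damp γ s ≤ 1 := fun s =>
    Real.rpow_le_one_of_one_le_of_nonpos (one_le_max_one s) (by linarith)
  refine LipschitzWith.of_dist_le_mul fun x y => ?_
  wlog hxy : ‖x‖ ≤ ‖y‖ generalizing x y
  · rw [dist_comm, dist_comm x]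
    exact this y x (le_of_not_ge hxy)
  rw [dist_eq_norm, dist_eq_norm, NNReal.coe_one]
  exact (norm_radial_sub_le h0 h1 hxy).trans (by gcongr; exact hd _)

lemma damp_le_two_mul (h0 : 0 ≤ γ) (h1 : γ ≤ 1) {s t : ℝ} (h : t ≤ s + 1) :
    damp γ s ≤ 2 * damp γ t := by
  have hs := one_le_max_one s
  have ht := one_le_max_one t
  have hmax : max 1 t ≤ 2 * max 1 s :=
    max_le (by linarith) (by linarith [le_max_right 1 s])
  have h2 : (2 : ℝ) ^ γ ≤ 2 := by
    simpa using Real.rpow_le_rpow_of_exponent_le one_le_two h1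
  have h3 : max 1 t ^ γ ≤ 2 * max 1 s ^ γ := by
    calc max 1 t ^ γ ≤ (2 * max 1 s) ^ γ := by gcongr
      _ = 2 ^ γ * max 1 s ^ γ := Real.mul_rpow (by norm_num) (by linarith)
      _ ≤ _ := by gcongr
  rw [damp, damp, Real.rpow_neg (by linarith), Real.rpow_neg (by linarith), ← div_eq_mul_inv,
    inv_eq_one_div, div_le_div_iff₀ (by positivity) (by positivity)]
  linarith

lemma norm_radial_sub_le_two (h0 : 0 ≤ γ) (h1 : γ ≤ 1) {x y : V} (h : ‖y - x‖ ≤ 1) :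
    ‖radial γ y - radial γ x‖ ≤ 2 * damp γ ‖x‖ * ‖y - x‖ := by
  obtain hxy | hxy := le_total ‖y‖ ‖x‖
  · refine (norm_radial_sub_le h0 h1 hxy).trans ?_
    gcongr
    exact damp_le_two_mul h0 h1 (by linarith [norm_le_norm_add_norm_sub' x y, norm_sub_rev x y])
  · rw [norm_sub_rev, norm_sub_rev y]
    refine (norm_radial_sub_le h0 h1 hxy).trans ?_
    have := damp_pos γ ‖x‖
    gcongr
    linarith

lemma radial_le_mul (h0 : 0 ≤ γ) (h1 : γ < 1) {x y y' : V} (h : ‖y - x‖ = ‖y' - x‖)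
    (hy : ‖y - x‖ ≤ 1) :
    ‖radial γ y - radial γ x‖ ≤ 4 / (1 - γ) * ‖radial γ y' - radial γ x‖ := by
  have h2 : (1 - γ) * damp γ ‖x‖ * ‖y' - x‖ ≤ 2 * ‖radial γ y' - radial γ x‖ := by
    have hd := damp_pos γ ‖x‖
    obtain hxy | hxy := le_total ‖y'‖ ‖x‖
    · linarith [le_norm_radial_sub h0 h1.le hxy, norm_nonneg (radial γ y' - radial γ x)]
    · have h3 := le_norm_radial_sub h0 h1.le hxy
      rw [norm_sub_rev, norm_sub_rev (radial γ x)] at h3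
      have h4 : damp γ ‖x‖ ≤ 2 * damp γ ‖y'‖ :=
        damp_le_two_mul h0 h1.le (by linarith [norm_le_norm_add_norm_sub' y' x])
      have h5 : (1 - γ) * damp γ ‖x‖ * ‖y' - x‖ ≤ (1 - γ) * (2 * damp γ ‖y'‖) * ‖y' - x‖ := by
        have : 0 ≤ 1 - γ := by linarith
        gcongr
      linarith
  have h3 := norm_radial_sub_le_two h0 h1.le hy
  have hγ : 0 < 1 - γ := by linarith
  rw [div_mul_eq_mul_div, le_div_iff₀ hγ]
  rw [h] at h3
  nlinarith

lemma isHomeoOn_radial (h0 : 0 ≤ γ) (h1 : γ < 1) : IsHomeoOn (radial γ : V → V) univ univ := by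
  have hγ : 0 < 1 - γ := by linarith
  have hmax : ∀ (δ s : ℝ), 0 ≤ s → -1 ≤ δ → max 1 (max 1 s ^ δ * s) = max 1 s ^ (δ + 1) := by
    intro δ s hs hδ
    obtain h | h := le_total s 1
    · rw [max_eq_left h]; simp [h]
    · rw [max_eq_right h, Real.rpow_add_one (by linarith), max_eq_right]
      rw [← Real.rpow_add_one (by linarith)]
      exact Real.one_le_rpow h (by linarith)
  have key : ∀ δ δ' : ℝ, -1 ≤ δ → (δ + 1) * δ' + δ = 0 → ∀ x : V,
      max 1 ‖max 1 ‖x‖ ^ δ • x‖ ^ δ' • max 1 ‖x‖ ^ δ • x = x := by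
    intro δ δ' hδ hδ' x
    have hx := one_le_max_one ‖x‖
    rw [norm_smul, Real.norm_of_nonneg (by positivity), hmax _ _ (norm_nonneg x) hδ, smul_smul,
      ← Real.rpow_mul (by linarith), ← Real.rpow_add (by linarith), hδ', Real.rpow_zero, one_smul]
  let inv : V → V := fun x => max 1 ‖x‖ ^ (γ / (1 - γ)) • x
  have hinv : Continuous inv := ((continuous_const.max continuous_norm).rpow_const fun x =>
    Or.inl (by linarith [one_le_max_one ‖x‖])).smul continuous_id
  have hl : Function.LeftInverse inv (radial γ) :=
    key (-γ) (γ / (1 - γ)) (by linarith) (by field_simp; ring)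
  have hr : Function.RightInverse inv (radial γ) :=
    key (γ / (1 - γ)) (-γ) (by linarith [div_nonneg h0 hγ.le]) (by field_simp; ring)
  exact ⟨bijOn_univ.2 ⟨hl.injective, hr.surjective⟩, continuous_radial.continuousOn,
    inv, ⟨hl.leftInvOn _, hr.rightInvOn _⟩, hinv.continuousOn⟩

end RadialMap

section DampedMap

namespace CantorData

variable {V : Type*} [NormedAddCommGroup V] [InnerProductSpace ℝ V] [FiniteDimensional ℝ V]
  {ι : Type*} [Fintype ι] (D : CantorData V ι) {γ : ℝ}

lemma radial_toFun (x : V) : radial γ (D.toFun x) = radial γ x + D.disp x := by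
  obtain h | h := le_total ‖x‖ 1
  · rw [radial_of_le h, radial_of_le (D.norm_toFun_le h), toFun]
  · rw [D.toFun_of_le (by linarith), D.disp_eq_zero (by linarith), add_zero]

lemma isQCHomeoOn_radial_toFun [Nontrivial V] (h0 : 0 ≤ γ) (h1 : γ < 1) :
    ∃ K : ℝ, 1 ≤ K ∧ IsQCHomeoOn K (fun x => radial γ (D.toFun x)) univ univ := by
  obtain ⟨H, hH⟩ := D.exists_toFun_le_mul
  have hK : 1 ≤ max 1 (max H (4 / (1 - γ))) := le_max_left _ _
  refine ⟨_, hK, ?_, fun x _ => ?_⟩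
  · obtain ⟨hb, hc, e, he, hec⟩ := D.isHomeoOn_toFun
    obtain ⟨hb', hc', e', he', hec'⟩ := isHomeoOn_radial (V := V) h0 h1
    exact ⟨hb'.comp hb, hc'.comp hc (mapsTo_univ _ _), e ∘ e',
      ⟨fun x hx => by simp [he'.1 (mem_univ _), he.1 hx],
        fun x hx => by simp [he.2 (mem_univ _), he'.2 hx]⟩, hec.comp hec' (mapsTo_univ _ _)⟩
  have hne : ∀ s : ℝ, 0 < s → ∃ y, ‖y - x‖ = s := by
    intro s hs
    obtain ⟨v, hv⟩ := exists_norm_eq V hs.le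
    exact ⟨x + v, by simpa using hv⟩
  obtain hx | hx := lt_or_ge ‖x‖ 1
  · refine limsup_stretch_le (δ := 1 - ‖x‖) (by linarith) (by linarith) hne fun y y' h hy => ?_
    have h2 := norm_le_norm_add_norm_sub' y x
    have h3 := norm_le_norm_add_norm_sub' y' x
    rw [radial_of_le (D.norm_toFun_le hx.le), radial_of_le (D.norm_toFun_le (by linarith)),
      radial_of_le (D.norm_toFun_le (by linarith))]
    refine (hH x y y' h).trans ?_
    gcongr
    exact (le_max_left _ _).trans (le_max_right _ _)
  · refine limsup_stretch_le (δ := 1 / 2) (by linarith) (by norm_num) hne fun y y' h hy => ?_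
    have h2 := norm_le_norm_add_norm_sub' x y
    have h3 := norm_le_norm_add_norm_sub' x y'
    rw [norm_sub_rev] at h2 h3
    rw [D.toFun_of_le (x := x) (by linarith), D.toFun_of_le (x := y) (by linarith),
      D.toFun_of_le (x := y') (by linarith)]
    refine (radial_le_mul h0 h1 h (by linarith)).trans ?_
    gcongr
    exact (le_max_right _ _).trans (le_max_right _ _)

end CantorData
end DampedMap

section WeakDerivative

variable {V : Type*} [NormedAddCommGroup V] [InnerProductSpace ℝ V] [MeasurableSpace V]
  [BorelSpace V]

lemma integrable_fderiv_smul {μ : Measure V} [IsFiniteMeasureOnCompacts μ] {f : V → V} (hf : Continuous f)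
    {φ : V → ℝ} (hφ : ContDiff ℝ (⊤ : ℕ∞) φ) (hφc : HasCompactSupport φ) (v : V) :
    Integrable (fun x => fderiv ℝ φ x v • f x) μ :=
  (((hφ.continuous_fderiv (by simp)).clm_apply continuous_const).smul
    hf).integrable_of_hasCompactSupport ((hφc.fderiv_apply ℝ v).smul_right)

variable [FiniteDimensional ℝ V] {μ : Measure V} [μ.IsAddHaarMeasure]

lemma LipschitzWith.integrable_smul_fderiv {f : V → V} {K : ℝ≥0} (hf : LipschitzWith K f)
    {φ : V → ℝ} (hφ : Continuous φ) (hφc : HasCompactSupport φ) (v : V) :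
    Integrable (fun x => φ x • fderiv ℝ f x v) μ := by
  refine ((hφ.integrable_of_hasCompactSupport hφc).norm.mul_const (K * ‖v‖)).mono'
    (hφ.aestronglyMeasurable.smul
      (measurable_fderiv_apply_const ℝ f v).aestronglyMeasurable) (.of_forall fun x => ?_)
  rw [norm_smul]
  gcongr
  exact (fderiv ℝ f x).le_of_opNorm_le (norm_fderiv_le_of_lipschitz ℝ hf) v

/-- Integration by parts for a Lipschitz map against a test function. -/
lemma LipschitzWith.integral_fderiv_smul {f : V → V} {K : ℝ≥0} (hf : LipschitzWith K f)
    {φ : V → ℝ} (hφ : ContDiff ℝ (⊤ : ℕ∞) φ) (hφc : HasCompactSupport φ) (v : V) :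
    ∫ x, fderiv ℝ φ x v • f x ∂μ = -∫ x, φ x • fderiv ℝ f x v ∂μ := by
  obtain ⟨C, hC⟩ := hφ.lipschitzWith_of_hasCompactSupport hφc (by simp)
  refine ext_inner_left ℝ fun w => ?_
  have hw : LipschitzWith (‖innerSL ℝ w‖₊ * K) fun x => inner ℝ w (f x) :=
    (innerSL ℝ w).lipschitz.comp hf
  have h := hw.integral_lineDeriv_mul_eq (μ := μ) hC hφc v
  rw [inner_neg_right, ← integral_inner (integrable_fderiv_smul hf.continuous hφ hφc v),
    ← integral_inner (hf.integrable_smul_fderiv hφ.continuous hφc v), ← integral_neg]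
  have h1 : ∀ x, lineDeriv ℝ φ x (-v) * inner ℝ w (f x) =
      -inner ℝ w (fderiv ℝ φ x v • f x) := fun x => by
    rw [(hφ.differentiable (by simp) x).lineDeriv_eq_fderiv, map_neg, inner_smul_right, neg_mul]
  have h2 : ∀ᵐ x ∂μ, lineDeriv ℝ (fun x => inner ℝ w (f x)) x v * φ x =
      inner ℝ w (φ x • fderiv ℝ f x v) := by
    filter_upwards [hf.ae_differentiableAt] with x hx
    have h3 : HasFDerivAt (fun x => inner ℝ w (f x)) ((innerSL ℝ w).comp (fderiv ℝ f x)) x :=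
      (innerSL ℝ w).hasFDerivAt.comp x hx.hasFDerivAt
    rw [h3.differentiableAt.lineDeriv_eq_fderiv, h3.fderiv, inner_smul_right, mul_comm]
    rfl
  rw [integral_congr_ae h2, integral_congr_ae (.of_forall h1), integral_neg] at h
  rw [integral_neg, h, neg_neg]

lemma memLp_tsum {α E : Type*} [MeasurableSpace α] {ν : Measure α} [NormedAddCommGroup E]
    {q : ℝ≥0∞} (hq : 1 ≤ q) {f : ℕ → α → E} (hf : ∀ k, AEStronglyMeasurable (f k) ν)
    (hs : ∀ᵐ x ∂ν, Summable fun k => f k x) (h : ∑' k, eLpNorm (f k) q ν ≠ ∞) :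
    MemLp (fun x => ∑' k, f k x) q ν := by
  have hlim : ∀ᵐ x ∂ν, Tendsto (fun m : ℕ => (∑ k ∈ Finset.range m, f k) x) atTop
      (𝓝 (∑' k, f k x)) := by
    filter_upwards [hs] with x hx
    simpa only [Finset.sum_apply] using hx.hasSum.tendsto_sum_nat
  have hm : ∀ m : ℕ, AEStronglyMeasurable (∑ k ∈ Finset.range m, f k) ν := fun m =>
    Finset.aestronglyMeasurable_sum _ fun k _ => hf k
  refine ⟨aestronglyMeasurable_of_tendsto_ae atTop hm hlim, lt_of_le_of_lt ?_ h.lt_top⟩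
  refine (Lp.eLpNorm_lim_le_liminf_eLpNorm hm _ hlim).trans
    (liminf_le_of_frequently_le' (Frequently.of_forall fun m => ?_))
  exact (eLpNorm_sum_le (fun k _ => hf k) hq).trans (ENNReal.sum_le_tsum _)

end WeakDerivative

section Levels

namespace CantorData

variable {V : Type*} [NormedAddCommGroup V] [InnerProductSpace ℝ V] {ι : Type*}
  (D : CantorData V ι)

/-- The level sets of the Cantor construction. -/
def level : ℕ → Set V
  | 0 => closedBall 0 (1 / 2)
  | k + 1 => ⋃ i, D.pull i ⁻¹' level k

lemma antitone_level : Antitone D.level := by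
  refine antitone_nat_of_succ_le fun k => ?_
  induction k with
  | zero =>
    refine iUnion_subset fun i x hx => ?_
    simp only [level, mem_preimage, mem_closedBall_zero_iff] at hx ⊢
    rw [← D.push_pull i x]
    exact (D.norm_push_lt (by linarith) i).le
  | succ k ih => exact iUnion_mono fun i => preimage_mono ih

lemma measure_level_lt_top [FiniteDimensional ℝ V] [MeasurableSpace V] {μ : Measure V}
    [IsFiniteMeasureOnCompacts μ] (k : ℕ) : μ (D.level k) < ∞ :=
  (measure_mono (D.antitone_level (Nat.zero_le k))).trans_lt measure_closedBall_lt_top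

lemma measure_pull_preimage [FiniteDimensional ℝ V] [MeasurableSpace V] [BorelSpace V]
    {μ : Measure V} [μ.IsAddHaarMeasure] (i : ι) (s : Set V) :
    μ (D.pull i ⁻¹' s) = ENNReal.ofReal (D.r ^ Module.finrank ℝ V) * μ s := by
  have h : D.pull i ⁻¹' s = (fun x => x + -D.t i) ⁻¹' ((fun x => D.r⁻¹ • x) ⁻¹' s) := by
    ext x; simp [pull, sub_eq_add_neg]
  rw [h, measure_preimage_add_right, Measure.addHaar_preimage_smul _ (inv_ne_zero D.r_pos.ne'),
    inv_pow, inv_inv, abs_of_pos (pow_pos D.r_pos _)]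

variable [Fintype ι]

lemma isClosed_level (k : ℕ) : IsClosed (D.level k) := by
  induction k with
  | zero => exact isClosed_closedBall
  | succ k ih => exact isClosed_iUnion_of_finite fun i => ih.preimage (D.continuous_pull i)

lemma term_of_notMem_level (k : ℕ) : ∀ x ∉ D.level k, D.term k x = 0 := by
  induction k with
  | zero =>
    exact fun x hx => D.term_eq_zero 0 x (by simpa using le_of_lt (by simpa [level] using hx))
  | succ k ih =>
    intro x hx
    simp only [level, mem_iUnion, mem_preimage, not_exists] at hx
    rw [term_succ, transfer]
    exact Finset.sum_eq_zero fun i _ => by rw [ih _ (hx i), smul_zero]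

lemma fderiv_term_of_notMem_level {k : ℕ} {x : V} (hx : x ∉ D.level k) :
    fderiv ℝ (D.term k) x = 0 := by
  have h : D.term k =ᶠ[𝓝 x] fun _ => 0 :=
    ((D.isClosed_level k).isOpen_compl.eventually_mem hx).mono fun y hy =>
      D.term_of_notMem_level k y hy
  rw [h.fderiv_eq]
  simp

lemma exists_local_lipschitz_term : ∃ C : ℝ, 0 ≤ C ∧ ∀ k x, ∀ᶠ y in 𝓝 x,
    ‖D.term k y - D.term k x‖ ≤ C * (D.ρ / D.r) ^ k * ‖y - x‖ := by
  have hr := D.r_pos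
  have hρ := D.ρ_pos
  obtain ⟨C, hC⟩ := D.lipschitz_term 0
  refine ⟨C, C.2, fun k => ?_⟩
  induction k with
  | zero => exact fun x => .of_forall fun y => by simpa using hC.norm_sub_le y x
  | succ k ih =>
    intro x
    by_cases h : ∃ i, ‖D.pull i x‖ < 1
    · obtain ⟨i, hi⟩ := h
      have ht := (D.continuous_pull i).tendsto x
      filter_upwards [ht.eventually (ih (D.pull i x)),
        ht.norm.eventually_lt_const hi] with y hy hyi
      rw [term_succ, D.transfer_of_norm_pull_le (D.term_eq_zero k) hi.le,
        D.transfer_of_norm_pull_le (D.term_eq_zero k) hyi.le, ← smul_sub, norm_smul,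
        Real.norm_of_nonneg hρ.le]
      rw [norm_pull_sub] at hy
      calc _ ≤ D.ρ * (C * (D.ρ / D.r) ^ k * (D.r⁻¹ * ‖y - x‖)) := by gcongr
        _ = _ := by rw [pow_succ]; ring
    · push Not at h
      have : ∀ᶠ y in 𝓝 x, ∀ i, 1 / 2 < ‖D.pull i y‖ := eventually_all.2 fun i =>
        ((D.continuous_pull i).tendsto x).norm.eventually_const_lt (by linarith [h i])
      filter_upwards [this] with y hy
      rw [term_succ, D.transfer_of_forall_le (D.term_eq_zero k) fun i => (hy i).le,
        D.transfer_of_forall_le (D.term_eq_zero k) fun i => by linarith [h i], sub_zero, norm_zero]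
      positivity

lemma exists_norm_fderiv_term_le : ∃ C : ℝ, 0 ≤ C ∧ ∀ k x,
    ‖fderiv ℝ (D.term k) x‖ ≤ (D.level k).indicator (fun _ => C * (D.ρ / D.r) ^ k) x := by
  have hr := D.r_pos
  have hρ := D.ρ_pos
  obtain ⟨C, hC0, hC⟩ := D.exists_local_lipschitz_term
  refine ⟨C, hC0, fun k x => ?_⟩
  by_cases hx : x ∈ D.level k
  · rw [indicator_of_mem hx]
    exact norm_fderiv_le_of_lip' ℝ (by positivity) (hC k x)
  · rw [indicator_of_notMem hx, D.fderiv_term_of_notMem_level hx, norm_zero]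

variable {p : ℝ}

lemma mul_rpow_inv_lt_one (hp : 1 ≤ p)
    (h : Fintype.card ι * D.r ^ Module.finrank ℝ V * (D.ρ / D.r) ^ p < 1) :
    D.ρ / D.r * (Fintype.card ι * D.r ^ Module.finrank ℝ V) ^ (1 / p) < 1 := by
  have hr := D.r_pos
  have hρ := D.ρ_pos
  have hp0 : 0 < p := by linarith
  rw [← Real.rpow_lt_rpow_iff (by positivity) zero_le_one hp0, Real.one_rpow,
    Real.mul_rpow (by positivity) (by positivity), ← Real.rpow_mul (by positivity),
    one_div_mul_cancel hp0.ne', Real.rpow_one, mul_comm]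
  exact h

lemma mul_lt_one (hp : 1 ≤ p) (hle : D.r ≤ D.ρ)
    (h : Fintype.card ι * D.r ^ Module.finrank ℝ V * (D.ρ / D.r) ^ p < 1) :
    D.ρ / D.r * (Fintype.card ι * D.r ^ Module.finrank ℝ V) < 1 := by
  have hr := D.r_pos
  have hρ := D.ρ_pos
  refine lt_of_le_of_lt ?_ h
  rw [mul_comm]
  gcongr
  exact Real.self_le_rpow_of_one_le ((one_le_div hr).2 hle) hp

variable [FiniteDimensional ℝ V] [MeasurableSpace V] [BorelSpace V] {μ : Measure V}
  [μ.IsAddHaarMeasure]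

lemma measureReal_level_le (k : ℕ) : μ.real (D.level k) ≤
    (Fintype.card ι * D.r ^ Module.finrank ℝ V) ^ k * μ.real (D.level 0) := by
  induction k with
  | zero => simp
  | succ k ih =>
    have hr := D.r_pos
    calc μ.real (D.level (k + 1)) ≤ ∑ i, μ.real (D.pull i ⁻¹' D.level k) :=
          measureReal_iUnion_fintype_le _
      _ = Fintype.card ι * D.r ^ Module.finrank ℝ V * μ.real (D.level k) := by
          simp only [Measure.real, measure_pull_preimage, ENNReal.toReal_mul]
          rw [ENNReal.toReal_ofReal (by positivity)]
          simp [mul_assoc]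
      _ ≤ Fintype.card ι * D.r ^ Module.finrank ℝ V *
            ((Fintype.card ι * D.r ^ Module.finrank ℝ V) ^ k * μ.real (D.level 0)) := by gcongr
      _ = _ := by ring

/-- The formal derivative of the displacement. -/
def dispDeriv (x : V) : V →L[ℝ] V := ∑' k, fderiv ℝ (D.term k) x

lemma ae_summable_fderiv_term (hp : 1 ≤ p) (hle : D.r ≤ D.ρ)
    (h : Fintype.card ι * D.r ^ Module.finrank ℝ V * (D.ρ / D.r) ^ p < 1) :
    ∀ᵐ x ∂μ, Summable fun k => fderiv ℝ (D.term k) x := by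
  have hr := D.r_pos
  have h1 : Fintype.card ι * D.r ^ Module.finrank ℝ V < 1 := by
    refine lt_of_le_of_lt ?_ (D.mul_lt_one hp hle h)
    exact le_mul_of_one_le_left (by positivity) ((one_le_div hr).2 hle)
  have hnull : μ.real (⋂ k, D.level k) ≤ 0 := by
    have ht : Tendsto (fun k : ℕ => (Fintype.card ι * D.r ^ Module.finrank ℝ V) ^ k *
        μ.real (D.level 0)) atTop (𝓝 (0 * μ.real (D.level 0))) :=
      (tendsto_pow_atTop_nhds_zero_of_lt_one (by positivity) h1).mul_const _
    rw [zero_mul] at ht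
    refine ge_of_tendsto' ht fun k => ?_
    exact (measureReal_mono (iInter_subset _ k) (D.measure_level_lt_top k).ne).trans
      (D.measureReal_level_le k)
  have hnull' : μ (⋂ k, D.level k) = 0 := by
    rw [← measureReal_eq_zero_iff (((measure_mono (iInter_subset _ 0)).trans_lt
      (D.measure_level_lt_top 0)).ne)]
    exact le_antisymm hnull measureReal_nonneg
  filter_upwards [measure_eq_zero_iff_ae_notMem.1 hnull'] with x hx
  simp only [mem_iInter, not_forall] at hx
  obtain ⟨m, hm⟩ := hx
  refine summable_of_ne_finset_zero (s := Finset.range m) fun k hk => ?_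
  exact D.fderiv_term_of_notMem_level fun hxk => hm (D.antitone_level (by simpa using hk) hxk)

lemma memLp_dispDeriv (hp : 1 ≤ p) (hle : D.r ≤ D.ρ)
    (h : Fintype.card ι * D.r ^ Module.finrank ℝ V * (D.ρ / D.r) ^ p < 1) :
    MemLp D.dispDeriv (ENNReal.ofReal p) μ := by
  have hr := D.r_pos
  have hρ := D.ρ_pos
  have hp0 : 0 < p := by linarith
  obtain ⟨C, hC0, hC⟩ := D.exists_norm_fderiv_term_le
  refine memLp_tsum (by simpa using hp) (fun k => (measurable_fderiv ℝ _).aestronglyMeasurable)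
    (D.ae_summable_fderiv_term hp hle h) ?_
  set θ := Fintype.card ι * D.r ^ Module.finrank ℝ V with hθ
  have hθ0 : 0 ≤ θ := by positivity
  have hb : ∀ k, eLpNorm (fderiv ℝ (D.term k)) (ENNReal.ofReal p) μ ≤
      ENNReal.ofReal (C * μ.real (D.level 0) ^ (1 / p) * (D.ρ / D.r * θ ^ (1 / p)) ^ k) := by
    intro k
    refine (eLpNorm_mono_real (hC k)).trans ((eLpNorm_indicator_const_le _ _).trans ?_)
    rw [ENNReal.toReal_ofReal hp0.le, ← ENNReal.ofReal_toReal (D.measure_level_lt_top k).ne,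
      ENNReal.ofReal_rpow_of_nonneg ENNReal.toReal_nonneg (by positivity),
      Real.enorm_eq_ofReal (by positivity), ← ENNReal.ofReal_mul (by positivity)]
    refine ENNReal.ofReal_le_ofReal ?_
    calc C * (D.ρ / D.r) ^ k * μ.real (D.level k) ^ (1 / p)
        ≤ C * (D.ρ / D.r) ^ k * (θ ^ k * μ.real (D.level 0)) ^ (1 / p) := by
          gcongr
          exact D.measureReal_level_le k
      _ = _ := by
          rw [Real.mul_rpow (by positivity) (by positivity), mul_pow (D.ρ / D.r),
            Real.rpow_pow_comm hθ0]
          ring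
  refine ne_top_of_le_ne_top ?_ (ENNReal.tsum_le_tsum hb)
  exact ((summable_geometric_of_lt_one (by positivity)
    (D.mul_rpow_inv_lt_one hp h)).mul_left _).tsum_ofReal_ne_top

lemma integral_fderiv_smul_disp (hp : 1 ≤ p) (hle : D.r ≤ D.ρ)
    (h : Fintype.card ι * D.r ^ Module.finrank ℝ V * (D.ρ / D.r) ^ p < 1)
    {φ : V → ℝ} (hφ : ContDiff ℝ (⊤ : ℕ∞) φ) (hφc : HasCompactSupport φ) (v : V) :
    ∫ x, fderiv ℝ φ x v • D.disp x ∂μ = -∫ x, φ x • D.dispDeriv x v ∂μ := by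
  have hr := D.r_pos
  have hρ := D.ρ_pos
  obtain ⟨C, hC0, hC⟩ := D.exists_norm_fderiv_term_le
  obtain ⟨B, hB⟩ := hφ.continuous.bounded_above_of_compact_support hφc
  have hB0 : 0 ≤ B := (norm_nonneg _).trans (hB 0)
  choose K hK using D.lipschitz_term
  have hφ' : Continuous fun x => fderiv ℝ φ x v :=
    (hφ.continuous_fderiv (by simp)).clm_apply continuous_const
  have hφi : Integrable (fun x => fderiv ℝ φ x v) μ :=
    hφ'.integrable_of_hasCompactSupport (hφc.fderiv_apply ℝ v)
  have s1 := hasSum_integral_of_summable_integral_norm (μ := μ)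
    (F := fun k x => fderiv ℝ φ x v • D.term k x)
    (fun k => integrable_fderiv_smul (D.continuous_term k) hφ hφc v) <| by
      refine Summable.of_nonneg_of_le (fun k => by positivity) (fun k => ?_)
        (D.summable_pow.mul_left (∫ x, ‖fderiv ℝ φ x v‖ ∂μ))
      rw [← integral_mul_const]
      refine integral_mono_of_nonneg (.of_forall fun x => norm_nonneg _)
        (hφi.norm.mul_const _) (.of_forall fun x => ?_)
      dsimp only
      rw [norm_smul]
      gcongr
      exact D.norm_term_le k x
  have s2 := hasSum_integral_of_summable_integral_norm (μ := μ)
    (F := fun k x => φ x • fderiv ℝ (D.term k) x v)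
    (fun k => (hK k).integrable_smul_fderiv hφ.continuous hφc v) <| by
      have hs := (summable_geometric_of_lt_one (by positivity)
        (D.mul_lt_one hp hle h)).mul_left (B * ‖v‖ * C * μ.real (D.level 0))
      refine Summable.of_nonneg_of_le (fun k => by positivity) (fun k => ?_) hs
      calc ∫ x, ‖φ x • fderiv ℝ (D.term k) x v‖ ∂μ
          ≤ ∫ x, (D.level k).indicator (fun _ => B * ‖v‖ * (C * (D.ρ / D.r) ^ k)) x ∂μ := by
            refine integral_mono_of_nonneg (.of_forall fun x => norm_nonneg _) ?_
              (.of_forall fun x => ?_)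
            · exact (integrable_indicator_iff (D.isClosed_level k).measurableSet).2
                (integrableOn_const (D.measure_level_lt_top k).ne)
            · dsimp only
              rw [norm_smul]
              refine (mul_le_mul (hB x) ((fderiv ℝ (D.term k) x).le_of_opNorm_le (hC k x) v)
                (norm_nonneg _) hB0).trans_eq ?_
              by_cases hx : x ∈ D.level k
              · simp only [indicator_of_mem hx]; ring
              · simp only [indicator_of_notMem hx]; ring
        _ = B * ‖v‖ * (C * (D.ρ / D.r) ^ k) * μ.real (D.level k) := by
            rw [integral_indicator_const _ (D.isClosed_level k).measurableSet, smul_eq_mul,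
              mul_comm]
        _ ≤ B * ‖v‖ * (C * (D.ρ / D.r) ^ k) *
              ((Fintype.card ι * D.r ^ Module.finrank ℝ V) ^ k * μ.real (D.level 0)) := by
            gcongr
            exact D.measureReal_level_le k
        _ = _ := by rw [mul_pow]; ring
  have e1 : ∀ x, ∑' k, fderiv ℝ φ x v • D.term k x = fderiv ℝ φ x v • D.disp x := fun x =>
    (D.summable_term x).tsum_const_smul _
  have e2 : ∀ᵐ x ∂μ, ∑' k, φ x • fderiv ℝ (D.term k) x v = φ x • D.dispDeriv x v := by
    filter_upwards [D.ae_summable_fderiv_term hp hle h] with x hx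
    have h1 := (ContinuousLinearMap.apply ℝ V v).hasSum hx.hasSum
    exact (h1.const_smul (φ x)).tsum_eq
  simp only [e1] at s1
  rw [integral_congr_ae e2] at s2
  refine s1.unique ?_
  simp only [(hK _).integral_fderiv_smul hφ hφc v]
  exact s2.neg

end CantorData
end Levels

section Sobolev

lemma memLp_fderiv_radial {V : Type*} [NormedAddCommGroup V] [InnerProductSpace ℝ V]
    [FiniteDimensional ℝ V] [MeasurableSpace V] [BorelSpace V] {μ : Measure V}
    [μ.IsAddHaarMeasure] {γ p : ℝ} (h0 : 0 ≤ γ) (h1 : γ ≤ 1) (hp : 0 < p)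
    (h : Module.finrank ℝ V < γ * p) :
    MemLp (fderiv ℝ (radial γ : V → V)) (ENNReal.ofReal p) μ := by
  have hint : MemLp (fun x : V => (1 + ‖x‖) ^ (-γ)) (ENNReal.ofReal p) μ := by
    have hc : Continuous fun x : V => (1 + ‖x‖) ^ (-γ) :=
      (continuous_const.add continuous_norm).rpow_const fun x =>
        Or.inl (show 1 + ‖x‖ ≠ 0 by positivity)
    rw [← integrable_norm_rpow_iff hc.aestronglyMeasurable (by simpa using hp) (by simp),
      ENNReal.toReal_ofReal hp.le]
    refine (integrable_one_add_norm h).congr (.of_forall fun x => ?_)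
    dsimp only
    rw [Real.norm_of_nonneg (by positivity), ← Real.rpow_mul (by positivity), neg_mul]
  refine (hint.const_mul 4).of_le (measurable_fderiv ℝ _).aestronglyMeasurable
    (.of_forall fun x => le_trans ?_ (le_abs_self _))
  have hd : damp γ ‖x‖ ≤ 2 * (1 + ‖x‖) ^ (-γ) := by
    have h2 := damp_le_two_mul h0 h1 (s := ‖x‖) (t := 1 + ‖x‖) (by linarith)
    have h3 : max 1 (1 + ‖x‖) = 1 + ‖x‖ := max_eq_right (by linarith [norm_nonneg x])
    rwa [damp, damp, h3] at h2
  have hdp := damp_pos γ ‖x‖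
  refine (norm_fderiv_le_of_lip' ℝ (C := 2 * damp γ ‖x‖) (by positivity) ?_).trans (by linarith)
  filter_upwards [closedBall_mem_nhds x one_pos] with y hy
  rw [mem_closedBall, dist_eq_norm] at hy
  exact norm_radial_sub_le_two h0 h1 hy

lemma CantorData.memW1p_radial_toFun {n : ℕ} {ι : Type*} [Fintype ι]
    (D : CantorData (EuclideanSpace ℝ (Fin n)) ι) {γ p : ℝ} (h0 : 0 ≤ γ) (h1 : γ ≤ 1) (hp : 1 ≤ p)
    (hγ : n < γ * p) (hle : D.r ≤ D.ρ) (h : Fintype.card ι * D.r ^ n * (D.ρ / D.r) ^ p < 1) :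
    MemW1p n n p univ fun x => radial γ (D.toFun x) := by
  have hn : Module.finrank ℝ (EuclideanSpace ℝ (Fin n)) = n := by simp
  have h' : Fintype.card ι * D.r ^ Module.finrank ℝ (EuclideanSpace ℝ (Fin n)) *
      (D.ρ / D.r) ^ p < 1 := by rwa [hn]
  have hmem : MemLp (fun x => fderiv ℝ (radial γ) x + D.dispDeriv x) (ENNReal.ofReal p) volume :=
    (memLp_fderiv_radial h0 h1 (by linarith) (by rwa [hn])).add (D.memLp_dispDeriv hp hle h')
  have hp0 : ENNReal.ofReal p ≠ 0 := by simp; linarith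
  refine ⟨_, (hmem.locallyIntegrable (by simpa using hp)).locallyIntegrableOn _, ?_, ?_⟩
  · have := lintegral_rpow_enorm_lt_top_of_eLpNorm_lt_top hp0 (by simp) hmem.2
    rw [ENNReal.toReal_ofReal (by linarith)] at this
    rw [setLIntegral_univ]
    refine lt_of_le_of_lt (lintegral_mono fun x => ?_) this
    rw [← ENNReal.ofReal_rpow_of_nonneg (norm_nonneg _) (by linarith), ofReal_norm]
  · intro φ hφ hφc _ v
    have hL := lipschitzWith_radial (V := EuclideanSpace ℝ (Fin n)) h0 h1
    simp only [setIntegral_univ, D.radial_toFun, smul_add, add_apply]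
    rw [integral_add (integrable_fderiv_smul hL.continuous hφ hφc v)
        (integrable_fderiv_smul D.continuous_disp hφ hφc v), integral_add
        (hL.integrable_smul_fderiv hφ.continuous hφc v) ?_, neg_add,
      hL.integral_fderiv_smul hφ hφc, D.integral_fderiv_smul_disp hp hle h' hφ hφc]
    have hloc := (D.memLp_dispDeriv (μ := volume) hp hle h').locallyIntegrable (by simpa using hp)
    have := (hloc.integrable_smul_left_of_hasCompactSupport hφ.continuous hφc)
    simpa using this.apply_continuousLinearMap v

end Sobolev

section Dimension

/-- A family of points indexed by words in `M` letters, whose mutual distances are bounded below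
by `c * q ^ k` when the words first differ at the letter `k`, has dimension at least `σ` as soon
as `M * q ^ σ ≥ 1`. -/
lemma le_dimH_range {X : Type*} [MetricSpace X] {M : ℕ} {q σ c : ℝ} (hq : 0 < q) (hq1 : q < 1)
    (hσ : 0 < σ) (hc : 0 < c) (hM : 1 ≤ M * q ^ σ) {y : (ℕ → Fin M) → X}
    (hy : ∀ ω ω' k, (∀ i < k, ω i = ω' i) → ω k ≠ ω' k → c * q ^ k ≤ dist (y ω) (y ω')) :
    ENNReal.ofReal σ ≤ dimH (range y) := by
  have hM1 : 1 < M := by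
    have h1 : q ^ σ < 1 := Real.rpow_lt_one hq.le hq1 hσ
    by_contra! h
    have h2 : (M : ℝ) ≤ 1 := by exact_mod_cast h
    have h3 : 0 < q ^ σ := by positivity
    nlinarith
  have hM0 : (0 : ℝ) < M := by positivity
  have : NeZero M := ⟨by lia⟩
  have hlow : ∀ ω ω', ω ≠ ω' → c * q ^ PiNat.firstDiff ω ω' ≤ dist (y ω) (y ω') := fun ω ω' h =>
    hy ω ω' _ (fun i hi => PiNat.apply_eq_of_lt_firstDiff hi) (PiNat.apply_firstDiff_ne h)
  have hinj : Function.Injective y := fun ω ω' h => by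
    by_contra hne
    have := hlow ω ω' hne
    rw [h, dist_self] at this
    exact absurd this (not_le.2 (by positivity))
  have hinv := Function.leftInverse_invFun hinj
  have hdist : ∀ ω ω', |Real.ofDigits ω - Real.ofDigits ω'| ≤
      c⁻¹ ^ σ * dist (y ω) (y ω') ^ σ := by
    intro ω ω'
    by_cases hne : ω = ω'
    · rw [hne, sub_self, abs_zero]; positivity
    refine (Real.abs_ofDigits_sub_ofDigits_le (x := ω) (y := ω') (n := PiNat.firstDiff ω ω')
      fun i hi => PiNat.apply_eq_of_lt_firstDiff hi).trans ?_
    set k := PiNat.firstDiff ω ω'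
    have h1 : ((M : ℝ) ^ k)⁻¹ ≤ (q ^ σ) ^ k := by
      rw [inv_le_iff_one_le_mul₀ (by positivity), ← mul_pow, mul_comm]
      exact one_le_pow₀ hM
    have h2 : q ^ k ≤ c⁻¹ * dist (y ω) (y ω') := by
      rw [le_inv_mul_iff₀ hc]; exact hlow ω ω' hne
    calc ((M : ℝ) ^ k)⁻¹ ≤ (q ^ σ) ^ k := h1
      _ = (q ^ k) ^ σ := Real.rpow_pow_comm hq.le σ k
      _ ≤ (c⁻¹ * dist (y ω) (y ω')) ^ σ := by gcongr
      _ = _ := Real.mul_rpow (by positivity) dist_nonneg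
  set h : X → ℝ := fun x => Real.ofDigits (Function.invFun y x) with hh
  have hH : HolderOnWith (c⁻¹ ^ σ).toNNReal σ.toNNReal h (range y) := by
    rintro _ ⟨ω, rfl⟩ _ ⟨ω', rfl⟩
    simp only [hh, hinv ω, hinv ω']
    rw [edist_dist, edist_dist, Real.coe_toNNReal σ hσ.le,
      ENNReal.ofReal_rpow_of_nonneg dist_nonneg hσ.le]
    change _ ≤ ENNReal.ofReal _ * _
    rw [← ENNReal.ofReal_mul (by positivity)]
    exact ENNReal.ofReal_le_ofReal (hdist ω ω')
  have himg : Icc (0 : ℝ) 1 ⊆ h '' range y := by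
    intro s hs
    obtain ⟨ω, -, hω⟩ := Real.ofDigits_SurjOn hM1 hs
    exact ⟨y ω, ⟨ω, rfl⟩, by simp only [hh, hinv ω, hω]⟩
  have h1 : dimH (Icc (0 : ℝ) 1) = 1 := by
    rw [Real.dimH_of_nonempty_interior (by simp)]; simp
  have h2 := (dimH_mono himg).trans (hH.dimH_image_le (by simpa using hσ))
  rw [h1, ENNReal.le_div_iff_mul_le (Or.inl (by simpa using hσ)) (Or.inl ENNReal.coe_ne_top),
    one_mul] at h2
  exact h2

variable {V : Type*} [NormedAddCommGroup V] [NormedSpace ℝ V]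

/-- The point of the attractor of `x ↦ v i + q • x` with a given address. -/
def address {ι : Type*} (q : ℝ) (v : ι → V) (ω : ℕ → ι) : V := ∑' k, q ^ k • v (ω k)

section

variable {ι : Type*} {q : ℝ} {v : ι → V}

lemma norm_address_le (hq : 0 ≤ q) (hq1 : q < 1) (hv : ∀ i, ‖v i‖ + q ≤ 1 / 2) (ω : ℕ → ι) :
    ‖address q v ω‖ ≤ 1 / 2 := by
  refine (tsum_of_norm_bounded ((hasSum_geometric_of_lt_one hq hq1).mul_right (1 / 2 - q))
    fun k => ?_).trans ?_
  · rw [norm_smul, Real.norm_of_nonneg (by positivity)]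
    gcongr
    linarith [hv (ω k)]
  · rw [inv_mul_le_iff₀ (by linarith)]
    linarith

variable [CompleteSpace V]

lemma summable_address (hq : 0 ≤ q) (hq1 : q < 1) (hv : ∀ i, ‖v i‖ + q ≤ 1 / 2) (ω : ℕ → ι) :
    Summable fun k => q ^ k • v (ω k) := by
  refine .of_norm_bounded (summable_geometric_of_lt_one hq hq1) fun k => ?_
  rw [norm_smul, Real.norm_of_nonneg (by positivity)]
  exact mul_le_of_le_one_right (by positivity) (by linarith [hv (ω k)])

lemma address_eq (hq : 0 ≤ q) (hq1 : q < 1) (hv : ∀ i, ‖v i‖ + q ≤ 1 / 2) (ω : ℕ → ι) :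
    address q v ω = v (ω 0) + q • address q v fun k => ω (k + 1) := by
  rw [address, (summable_address hq hq1 hv ω).tsum_eq_zero_add, pow_zero, one_smul, address,
    ← (summable_address hq hq1 hv fun k => ω (k + 1)).tsum_const_smul]
  simp only [smul_smul, pow_succ']

lemma le_norm_address_sub (hq : 0 ≤ q) (hq1 : q < 1) (hv : ∀ i, ‖v i‖ + q ≤ 1 / 2)
    (hsep : ∀ i j, i ≠ j → 2 * q ≤ ‖v i - v j‖) {k : ℕ} :
    ∀ {ω ω' : ℕ → ι}, (∀ i < k, ω i = ω' i) → ω k ≠ ω' k →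
      q * q ^ k ≤ ‖address q v ω - address q v ω'‖ := by
  induction k with
  | zero =>
    intro ω ω' _ hne
    rw [address_eq hq hq1 hv ω, address_eq hq hq1 hv ω', add_sub_add_comm, ← smul_sub]
    set z := address q v fun k => ω (k + 1)
    set z' := address q v fun k => ω' (k + 1)
    have h1 : ‖z - z'‖ ≤ 1 := (norm_sub_le _ _).trans
      (by linarith [norm_address_le hq hq1 hv fun k => ω (k + 1),
        norm_address_le hq hq1 hv fun k => ω' (k + 1)])
    have h2 := norm_sub_le_norm_add (v (ω 0) - v (ω' 0)) (q • (z - z'))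
    rw [norm_smul, Real.norm_of_nonneg hq] at h2
    nlinarith [hsep _ _ hne]
  | succ k ih =>
    intro ω ω' heq hne
    rw [address_eq hq hq1 hv ω, address_eq hq hq1 hv ω', heq 0 k.succ_pos,
      add_sub_add_left_eq_sub, ← smul_sub, norm_smul, Real.norm_of_nonneg hq, pow_succ']
    gcongr
    exact ih (fun i hi => heq (i + 1) (by lia)) hne

end

lemma coe_address {S : Submodule ℝ V} [CompleteSpace S] {ι : Type*} {q : ℝ} {v : ι → S}
    (hq : 0 ≤ q) (hq1 : q < 1) (hv : ∀ i, ‖v i‖ + q ≤ 1 / 2) (ω : ℕ → ι) :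
    ((address q v ω : S) : V) = address q (fun i => (v i : V)) ω :=
  S.subtypeL.map_tsum (summable_address hq hq1 hv ω)

lemma CantorData.toFun_address {V : Type*} [NormedAddCommGroup V] [InnerProductSpace ℝ V]
    [FiniteDimensional ℝ V] {ι : Type*} [Fintype ι] (D : CantorData V ι) (ω : ℕ → ι) :
    D.toFun (address D.r D.t ω) = address D.ρ D.u ω := by
  have ht : ∀ i, ‖D.t i‖ + D.r ≤ 1 / 2 := fun i => (D.t_norm i).le
  have hu : ∀ i, ‖D.u i‖ + D.ρ ≤ 1 / 2 := fun i => (D.u_norm i).le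
  have hx := norm_address_le D.r_pos.le D.r_lt_one ht
  have hy := norm_address_le D.ρ_pos.le D.ρ_lt_one hu
  suffices ‖D.toFun (address D.r D.t ω) - address D.ρ D.u ω‖ ≤ 0 from
    sub_eq_zero.1 (norm_le_zero_iff.1 this)
  refine nonpos_of_contraction (P := fun _ : ℕ → ι => True)
    (e := fun ω => ‖D.toFun (address D.r D.t ω) - address D.ρ D.u ω‖) (C := 2)
    D.ρ_pos.le D.ρ_lt_one (fun ω _ => ?_) (fun ω _ => Or.inr ⟨fun k => ω (k + 1), trivial, ?_⟩)
    trivial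
  · have := norm_sub_le (D.toFun (address D.r D.t ω)) (address D.ρ D.u ω)
    linarith [hy ω, D.norm_toFun_le ((hx ω).trans (by norm_num))]
  · rw [address_eq D.r_pos.le D.r_lt_one ht, address_eq D.ρ_pos.le D.ρ_lt_one hu,
      D.toFun_push _ ((hx _).trans (by norm_num)), add_sub_add_left_eq_sub, ← smul_sub, norm_smul,
      Real.norm_of_nonneg D.ρ_pos.le]

end Dimension

section Construction

variable {V : Type*} [NormedAddCommGroup V] [InnerProductSpace ℝ V] [FiniteDimensional ℝ V]

lemma tendsto_mul_rpow_nhdsGT_zero (C : ℝ) {e : ℝ} (he : 0 < e) :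
    Tendsto (fun s : ℝ => C * s ^ e) (𝓝[>] 0) (𝓝 0) := by
  have h : Tendsto (fun s : ℝ => C * s ^ e) (𝓝 0) (𝓝 (C * 0 ^ e)) :=
    (Real.continuousAt_rpow_const _ _ (Or.inr he.le)).const_mul C
  rw [Real.zero_rpow he.ne', mul_zero] at h
  exact h.mono_left nhdsWithin_le_nhds

lemma exists_grid (q : ℕ) {h : ℝ} (hh : 0 < h) :
    ∃ v : (Fin (Module.finrank ℝ V) → Fin q) → V,
      (∀ c, ‖v c‖ ≤ Module.finrank ℝ V * q * h) ∧ ∀ c c', c ≠ c' → h ≤ ‖v c - v c'‖ := by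
  let b := stdOrthonormalBasis ℝ V
  refine ⟨fun c => ∑ i, (h * (c i : ℕ)) • b i, fun c => ?_, fun c c' hne => ?_⟩
  · refine (norm_sum_le_of_le _ (f := fun i => (h * (c i : ℕ)) • b i) (n := fun _ => h * q)
      fun i _ => ?_).trans ?_
    · rw [norm_smul, b.norm_eq_one, mul_one, Real.norm_of_nonneg (by positivity)]
      gcongr
      exact (c i).2.le
    · simp only [Finset.sum_const, Finset.card_univ, Fintype.card_fin, nsmul_eq_mul]
      exact le_of_eq (by ring)
  · obtain ⟨i, hi⟩ := Function.ne_iff.1 hne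
    have h1 : inner ℝ (b i) (∑ i, (h * (c i : ℕ)) • b i - ∑ i, (h * (c' i : ℕ)) • b i) =
        h * ((c i : ℕ) - (c' i : ℕ) : ℝ) := by
      rw [inner_sub_right, b.orthonormal.inner_right_fintype, b.orthonormal.inner_right_fintype]
      ring
    have h2 : (1 : ℝ) ≤ |((c i : ℕ) - (c' i : ℕ) : ℝ)| := by
      have : ((c i : ℕ) : ℤ) - (c' i : ℕ) ≠ 0 := by
        simpa [sub_eq_zero, Fin.ext_iff] using hi
      exact_mod_cast Int.one_le_abs this
    calc h ≤ h * |((c i : ℕ) - (c' i : ℕ) : ℝ)| := le_mul_of_one_le_right hh.le h2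
      _ = |inner ℝ (b i) (∑ i, (h * (c i : ℕ)) • b i - ∑ i, (h * (c' i : ℕ)) • b i)| := by
          rw [h1, abs_mul, abs_of_pos hh]
      _ ≤ _ := (abs_real_inner_le_norm _ _).trans (by rw [b.norm_eq_one, one_mul])

variable (V) in
/-- Small balls of radius `s` can be packed in number `O(s ^ (-κ))` when `κ` is less than the
dimension. -/
lemma eventually_exists_packing (hd : 0 < Module.finrank ℝ V) {κ : ℝ}
    (hκ : κ < Module.finrank ℝ V) (C : ℝ) : ∀ᶠ s : ℝ in 𝓝[>] 0, ∀ N : ℕ, N ≤ C * s ^ (-κ) →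
      ∃ v : Fin N → V, (∀ i, ‖v i‖ ≤ 1 / 8) ∧ ∀ i j, i ≠ j → 4 * s < ‖v i - v j‖ := by
  set d := Module.finrank ℝ V with hdef
  have hd' : (0 : ℝ) < d := by exact_mod_cast hd
  have h1 := (tendsto_mul_rpow_nhdsGT_zero (C * (80 * d) ^ d) (sub_pos.2 hκ)).eventually_le_const
    one_pos
  have h2 : ∀ᶠ s : ℝ in 𝓝[>] 0, s < 1 / (80 * d) := by
    filter_upwards [Ioo_mem_nhdsGT (show (0 : ℝ) < 1 / (80 * d) by positivity)] with s hs
    exact hs.2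
  filter_upwards [h1, h2, self_mem_nhdsWithin] with s hs1 hs2 hs0 N hN
  rw [mem_Ioi] at hs0
  set q := ⌊1 / (40 * d * s)⌋₊ with hq
  have hq1 : (q : ℝ) ≤ 1 / (40 * d * s) := Nat.floor_le (by positivity)
  have hq2 : 1 / (80 * d * s) ≤ (q : ℝ) := by
    have h3 : 1 / (40 * d * s) < q + 1 := Nat.lt_floor_add_one _
    have h4 : 1 ≤ 1 / (80 * d * s) := by
      rw [le_div_iff₀ (by positivity)]
      rw [lt_div_iff₀ (by positivity)] at hs2
      linarith
    have h5 : 1 / (40 * d * s) = 2 * (1 / (80 * d * s)) := by field_simp; norm_num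
    linarith
  obtain ⟨v, hv, hsep⟩ := exists_grid (V := V) q (h := 5 * s) (by positivity)
  have hcard : N ≤ q ^ d := by
    have h3 : C * s ^ (-κ) ≤ (1 / (80 * d * s)) ^ d := by
      rw [div_pow, one_pow, le_div_iff₀ (by positivity), mul_pow]
      calc C * s ^ (-κ) * ((80 * d) ^ d * s ^ d) = C * (80 * d) ^ d * s ^ (d - κ) := by
            rw [Real.rpow_sub hs0, Real.rpow_neg hs0.le, Real.rpow_natCast]; ring
        _ ≤ 1 := hs1
    have h4 : (N : ℝ) ≤ (q : ℝ) ^ d := hN.trans (h3.trans (by gcongr))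
    exact_mod_cast h4
  obtain ⟨e⟩ := Function.Embedding.nonempty_of_card_le (α := Fin N) (β := Fin d → Fin q)
    (by simpa using hcard)
  refine ⟨fun i => v (e i), fun i => (hv _).trans ?_, fun i j hij => ?_⟩
  · calc (d : ℝ) * q * (5 * s) ≤ d * (1 / (40 * d * s)) * (5 * s) := by gcongr
      _ = 1 / 8 := by field_simp; norm_num
  · linarith [hsep _ _ (e.injective.ne hij)]

lemma exists_cantorData {ι : Type*} [Finite ι] (hV : 1 < Module.finrank ℝ V) {r ρ : ℝ} (hr : 0 < r)
    (hr1 : r < 1 / 8) (hρ : 0 < ρ) (hρ1 : ρ < 1 / 8) {t u : ι → V} (ht : ∀ i, ‖t i‖ ≤ 1 / 4)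
    (hu : ∀ i, ‖u i‖ ≤ 1 / 4) (hts : ∀ i j, i ≠ j → 4 * r < ‖t i - t j‖)
    (hus : ∀ i j, i ≠ j → 4 * ρ < ‖u i - u j‖) :
    ∃ D : CantorData V ι, D.r = r ∧ D.ρ = ρ ∧ D.t = t ∧ D.u = u := by
  have hball : ∀ {x : V} {s : ℝ}, ‖x‖ ≤ 1 / 4 → s < 1 / 8 →
      ball x (2 * s) ⊆ ball 0 (1 / 2) := fun hx hs =>
    ball_subset_ball' (by rw [dist_zero_right]; linarith)
  have hdisj : ∀ {w : ι → V} {s : ℝ}, (∀ i j, i ≠ j → 4 * s < ‖w i - w j‖) →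
      Pairwise fun i j => Disjoint (ball (w i) (2 * s)) (ball (w j) (2 * s)) := fun h i j hij =>
    ball_disjoint_ball (by rw [dist_eq_norm]; linarith [h i j hij])
  obtain ⟨g, hg, hgm⟩ := exists_biLipSupp_rearrange hV (R := 1 / 2) (by norm_num) hr
    (show r < 2 * r by linarith) hρ (show ρ < 2 * ρ by linarith) (t := t) (u := u)
    (fun i => hball (ht i) hr1) (fun i => hball (hu i) hρ1) (hdisj hts) (hdisj hus)
  exact ⟨{
    r := r, ρ := ρ, t := t, u := u, g := g
    r_pos := hr
    r_lt_one := by linarith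
    ρ_pos := hρ
    ρ_lt_one := by linarith
    t_norm := fun i => by linarith [ht i]
    u_norm := fun i => by linarith [hu i]
    t_sep := fun i j hij => by linarith [hts i j hij]
    u_sep := fun i j hij => by linarith [hus i j hij]
    g_mem := hg
    g_map := hgm }, rfl, rfl, rfl, rfl⟩

end Construction

section Parameters

lemma exists_exponents {n p α ε : ℝ} (hn : 1 < n) (hp : n < p) (hα1 : 1 < α)
    (hα2 : α < p / (p - n + 1)) (hε : 0 < ε) :
    ∃ σ β : ℝ, 0 < σ ∧ n - 1 - p * (1 - 1 / α) - ε < σ ∧ σ < n - 1 ∧ 0 < β ∧ β < 1 ∧ α * β < 1 ∧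
      α + σ / β < n ∧ 0 < n - p + p * β - α * β - σ := by
  set s := n - 1 - p * (1 - 1 / α) with hs
  have hα0 : 0 < α := by linarith
  have hs' : s = p * (1 / α) - (p - n + 1) := by rw [hs]; ring
  have hs0 : 0 < s := by
    rw [lt_div_iff₀ (by linarith)] at hα2
    have : p - n + 1 < p * (1 / α) := by
      rw [mul_one_div, lt_div_iff₀ hα0]; linarith
    linarith
  have hinv : 1 / α < 1 := by rw [div_lt_one hα0]; exact hα1
  have hs1 : s < n - 1 := by
    rw [hs]
    nlinarith
  obtain ⟨σ, hσ, hσs⟩ := exists_between (max_lt (show s - ε < s by linarith) hs0)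
  obtain ⟨hσε, hσ0⟩ := max_lt_iff.1 hσ
  have h1 : ∀ᶠ β in 𝓝[<] (1 / α), 0 < n - p + p * β - α * β - σ := by
    have h : Tendsto (fun β => n - p + p * β - α * β - σ) (𝓝 (1 / α))
        (𝓝 (n - p + p * (1 / α) - α * (1 / α) - σ)) := Continuous.tendsto (by fun_prop) _
    refine (h.eventually_const_lt ?_).filter_mono nhdsWithin_le_nhds
    rw [mul_one_div_cancel hα0.ne']
    linarith
  have h2 : ∀ᶠ β in 𝓝[<] (1 / α), 0 < n * β - α * β - σ := by
    have h : Tendsto (fun β => n * β - α * β - σ) (𝓝 (1 / α))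
        (𝓝 (n * (1 / α) - α * (1 / α) - σ)) := Continuous.tendsto (by fun_prop) _
    refine (h.eventually_const_lt ?_).filter_mono nhdsWithin_le_nhds
    rw [mul_one_div_cancel hα0.ne']
    nlinarith [mul_pos (sub_pos.2 hp) (sub_pos.2 hinv)]
  have h3 : ∀ᶠ β in 𝓝[<] (1 / α), β ∈ Ioo 0 (1 / α) := Ioo_mem_nhdsLT (by positivity)
  obtain ⟨β, hβ1, hβ2, hβ0, hβα⟩ := (h1.and (h2.and h3)).exists
  refine ⟨σ, β, hσ0, hσε, by linarith, hβ0, by linarith, ?_, ?_, hβ1⟩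
  · rw [lt_div_iff₀ hα0] at hβα
    linarith
  · rw [← lt_sub_iff_add_lt', div_lt_iff₀ hβ0]
    linarith

lemma natCeil_rpow_neg_le {s e : ℝ} (hs : 0 < s) (hs1 : s ≤ 1) (he : 0 ≤ e) :
    (⌈s ^ (-e)⌉₊ : ℝ) ≤ 2 * s ^ (-e) := by
  have h1 : 1 ≤ s ^ (-e) := Real.one_le_rpow_of_pos_of_le_one_of_nonpos hs hs1 (by linarith)
  have h2 := Nat.ceil_lt_add_one (show 0 ≤ s ^ (-e) by linarith)
  linarith

lemma one_le_natCeil_mul_rpow {s : ℝ} (hs : 0 < s) (e : ℝ) : 1 ≤ ⌈s ^ (-e)⌉₊ * s ^ e := by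
  calc 1 = s ^ (-e) * s ^ e := by rw [← Real.rpow_add hs, neg_add_cancel, Real.rpow_zero]
    _ ≤ _ := by gcongr; exact Nat.le_ceil _

end Parameters

section ParallelLines

lemma norm_le_norm_add_of_mem_orthogonal {V : Type*} [NormedAddCommGroup V] [InnerProductSpace ℝ V]
    {L : Submodule ℝ V} {x y : V} (hx : x ∈ L) (hy : y ∈ Lᗮ) :
    ‖x‖ ≤ ‖x + y‖ ∧ ‖y‖ ≤ ‖x + y‖ := by
  have h := norm_add_sq_eq_norm_sq_add_norm_sq_real (Submodule.inner_right_of_mem_orthogonal hx hy)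
  constructor <;> nlinarith [norm_nonneg x, norm_nonneg y, norm_nonneg (x + y)]

/-- A self-similar homeomorphism whose source attractor is the sum of an attractor in `L` and one
of dimension at least `σ` in `Lᗮ`, and which maps the slices parallel to `L` to sets of dimension
at least `α`. -/
lemma exists_cantorData_line {V : Type*} [NormedAddCommGroup V] [InnerProductSpace ℝ V]
    [FiniteDimensional ℝ V] {n : ℕ} (hn : 2 ≤ n) (hV : Module.finrank ℝ V = n)
    {L : Submodule ℝ V} (hL : Module.finrank ℝ L = 1) {α σ β p : ℝ} (hα : 0 < α) (hσ : 0 < σ)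
    (hσn : σ < n - 1) (hβ : 0 < β) (hβ1 : β < 1) (hαβ : α * β < 1) (hαn : α + σ / β < n)
    (hp : 0 < n - p + p * β - α * β - σ) :
    ∃ (M N : ℕ) (τ : Fin M → L) (a : Fin N → Lᗮ) (D : CantorData V (Fin M × Fin N)),
      D.r ≤ D.ρ ∧ Fintype.card (Fin M × Fin N) * D.r ^ n * (D.ρ / D.r) ^ p < 1 ∧
      1 ≤ M * D.ρ ^ α ∧ 1 ≤ N * D.r ^ σ ∧
      (∀ i, ‖τ i‖ + D.r ≤ 1 / 2) ∧ (∀ i, ‖a i‖ + D.r ≤ 1 / 2) ∧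
      (∀ i j, i ≠ j → 2 * D.r ≤ ‖a i - a j‖) ∧ ∀ i, D.t i = τ i.1 + a i.2 := by
  have hn' : (2 : ℝ) ≤ n := by exact_mod_cast hn
  have hL' : Module.finrank ℝ Lᗮ = n - 1 := by
    have := L.finrank_add_finrank_orthogonal
    omega
  have hL'' : ((Module.finrank ℝ Lᗮ : ℕ) : ℝ) = n - 1 := by
    rw [hL', Nat.cast_sub (by omega), Nat.cast_one]
  have hρ0 : Tendsto (fun s : ℝ => s ^ β) (𝓝[>] 0) (𝓝[>] 0) := by
    refine tendsto_nhdsWithin_iff.2 ⟨by simpa using tendsto_mul_rpow_nhdsGT_zero 1 hβ, ?_⟩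
    filter_upwards [self_mem_nhdsWithin] with s hs using Real.rpow_pos_of_pos hs β
  have hsmall : ∀ᶠ s : ℝ in 𝓝[>] 0, s ∈ Ioo (0 : ℝ) (1 / 8) := Ioo_mem_nhdsGT (by norm_num)
  have h1 := eventually_exists_packing L (by omega) (κ := α * β) (by rw [hL]; exact_mod_cast hαβ) 2
  have h2 := eventually_exists_packing Lᗮ (by omega) (κ := σ) (by rwa [hL'']) 2
  have h3 := hρ0.eventually (eventually_exists_packing V (by omega) (κ := α + σ / β)
    (by rwa [hV]) 4)
  have h4 := (tendsto_mul_rpow_nhdsGT_zero 4 hp).eventually_lt_const one_pos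
  obtain ⟨r, h1, h2, h3, h4, ⟨hr0, hr8⟩, hρ0, hρ8⟩ :=
    (h1.and (h2.and (h3.and (h4.and (hsmall.and (hρ0.eventually hsmall)))))).exists
  set ρ := r ^ β with hρ
  have hM : (⌈ρ ^ (-α)⌉₊ : ℝ) ≤ 2 * r ^ (-(α * β)) := by
    refine (natCeil_rpow_neg_le hρ0 (by linarith) hα.le).trans_eq ?_
    rw [hρ, ← Real.rpow_mul hr0.le]
    ring_nf
  have hN : (⌈r ^ (-σ)⌉₊ : ℝ) ≤ 2 * r ^ (-σ) := natCeil_rpow_neg_le hr0 (by linarith) hσ.le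
  have hM1 := one_le_natCeil_mul_rpow hρ0 α
  have hN1 := one_le_natCeil_mul_rpow hr0 σ
  set M := ⌈ρ ^ (-α)⌉₊
  set N := ⌈r ^ (-σ)⌉₊
  have hMN : (M * N : ℝ) ≤ 4 * r ^ (-(α * β) - σ) := by
    calc (M * N : ℝ) ≤ (2 * r ^ (-(α * β))) * (2 * r ^ (-σ)) := by gcongr
      _ = 4 * r ^ (-(α * β) - σ) := by rw [sub_eq_add_neg, Real.rpow_add hr0]; ring
  obtain ⟨τ, hτ, hτs⟩ := h1 M hM
  obtain ⟨a, ha, has⟩ := h2 N hN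
  obtain ⟨u, hu, hus⟩ := h3 (M * N) (by
    push_cast
    refine hMN.trans_eq ?_
    rw [hρ, ← Real.rpow_mul hr0.le]
    congr 2
    field_simp
    ring)
  obtain ⟨D, hDr, hDρ, hDt, -⟩ := exists_cantorData (V := V) (by omega) hr0 hr8 hρ0 hρ8
    (t := fun i : Fin M × Fin N => (τ i.1 : V) + a i.2) (u := fun i => u (finProdFinEquiv i))
    (fun i => (norm_add_le _ _).trans ((add_le_add (hτ i.1) (ha i.2)).trans (by norm_num)))
    (fun i => (hu _).trans (by norm_num))
    (fun i j hij => by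
      obtain ⟨hx, hy⟩ := norm_le_norm_add_of_mem_orthogonal (τ i.1 - τ j.1).2 (a i.2 - a j.2).2
      rw [show (τ i.1 : V) + a i.2 - (τ j.1 + a j.2) =
        ((τ i.1 - τ j.1 : L) : V) + (a i.2 - a j.2 : Lᗮ) by push_cast; abel]
      by_cases h : i.1 = j.1
      · exact (has _ _ fun h' => hij (Prod.ext h h')).trans_le hy
      · exact (hτs _ _ h).trans_le hx)
    (fun i j hij => hus _ _ (finProdFinEquiv.injective.ne hij))
  refine ⟨M, N, τ, a, D, ?_⟩
  rw [hDr, hDρ, hDt]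
  refine ⟨?_, ?_, hM1, hN1, fun i => by linarith [hτ i], fun i => by linarith [ha i],
    fun i j hij => by linarith [has i j hij], fun _ => rfl⟩
  · simpa using Real.rpow_le_rpow_of_exponent_ge hr0 (by linarith) hβ1.le
  · rw [Fintype.card_prod, Fintype.card_fin, Fintype.card_fin, Nat.cast_mul]
    calc (M * N : ℝ) * r ^ n * (ρ / r) ^ p
        ≤ 4 * r ^ (-(α * β) - σ) * r ^ n * (ρ / r) ^ p := by gcongr
      _ = 4 * r ^ (n - p + p * β - α * β - σ) := by
        have : ρ / r = r ^ (β - 1) := by rw [Real.rpow_sub hr0, Real.rpow_one]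
        rw [this, ← Real.rpow_mul hr0.le, ← Real.rpow_natCast, mul_assoc, mul_assoc,
          ← Real.rpow_add hr0, ← Real.rpow_add hr0]
        congr 2
        ring
      _ < 1 := h4

end ParallelLines

/-- Balogh–Tyson–Wildrick: sharp examples of quasiconformal maps in `W^{1,p}`
increasing the dimension of a large family of parallel lines. -/
theorem btw_increase (n : ℕ) (hn : 2 ≤ n) (p : ℝ) (hp : (n : ℝ) < p)
    (α : ℝ) (hα1 : 1 < α) (hα2 : α < p/(p - n + 1))
    (L : Submodule ℝ (EuclideanSpace ℝ (Fin n))) (hL : Module.finrank ℝ L = 1)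
    (ε : ℝ) (hε : 0 < ε) :
    ∃ A : Set (EuclideanSpace ℝ (Fin n)),
      A ⊆ (Lᗮ : Set (EuclideanSpace ℝ (Fin n))) ∧
      ENNReal.ofReal (((n : ℝ) - 1) - p*(1 - 1/α) - ε) < dimH A ∧
      ∃ (f : EuclideanSpace ℝ (Fin n) → EuclideanSpace ℝ (Fin n)) (K : ℝ),
        1 ≤ K ∧ IsQCHomeoOn K f Set.univ Set.univ ∧ Continuous f ∧
        MemW1p n n p Set.univ f ∧
        ∀ a ∈ A, ENNReal.ofReal α ≤
          dimH (f '' ((fun v => v + a) '' (L : Set (EuclideanSpace ℝ (Fin n))))) := by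
  have hn' : (2 : ℝ) ≤ n := by exact_mod_cast hn
  obtain ⟨σ, β, hσ0, hσε, hσn, hβ0, hβ1, hαβ, hαn, hexp⟩ :=
    exists_exponents (by linarith) hp hα1 hα2 hε
  have hfin : Module.finrank ℝ (EuclideanSpace ℝ (Fin n)) = n := finrank_euclideanSpace_fin
  have : Nontrivial (EuclideanSpace ℝ (Fin n)) :=
    Module.nontrivial_of_finrank_pos (R := ℝ) (by omega)
  obtain ⟨M, N, τ, a, D, hle, hcard, hM, hN, hτ, ha, has, ht⟩ :=
    exists_cantorData_line hn hfin hL (by linarith) hσ0 hσn hβ0 hβ1 hαβ hαn hexp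
  have hp0 : 0 < p := by linarith
  obtain ⟨γ, hγn, hγ1⟩ := exists_between (show n / p < 1 by rwa [div_lt_one hp0])
  have hγ0 : 0 ≤ γ := le_trans (by positivity) hγn.le
  obtain ⟨K, hK, hQC⟩ := D.isQCHomeoOn_radial_toFun hγ0 hγ1
  refine ⟨range fun δ => ((address D.r a δ : Lᗮ) : EuclideanSpace ℝ (Fin n)), ?_, ?_, _, K, hK, hQC,
    continuous_radial.comp D.continuous_toFun,
    D.memW1p_radial_toFun hγ0 hγ1.le (by linarith) ((div_lt_iff₀ hp0).1 hγn) hle hcard, ?_⟩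
  · rintro _ ⟨δ, rfl⟩
    exact (address D.r a δ).2
  · refine ((ENNReal.ofReal_lt_ofReal_iff hσ0).2 hσε).trans_le
      (le_dimH_range D.r_pos D.r_lt_one hσ0 D.r_pos hN fun δ δ' k heq hne => ?_)
    exact le_norm_address_sub D.r_pos.le D.r_lt_one ha has heq hne
  · rintro _ ⟨δ, rfl⟩
    refine (le_dimH_range D.ρ_pos D.ρ_lt_one (by linarith) D.ρ_pos hM
      (y := fun j => address D.ρ D.u fun k => (j k, δ k)) fun j j' k heq hne => ?_).trans
      (dimH_mono ?_)
    · rw [dist_eq_norm]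
      exact le_norm_address_sub D.ρ_pos.le D.ρ_lt_one (fun i => (D.u_norm i).le)
        (fun i i' h => (D.u_sep i i' h).le) (fun i hi => by rw [heq i hi])
        fun h => hne (Prod.ext_iff.1 h).1
    · rintro _ ⟨j, rfl⟩
      refine ⟨_, ⟨_, (address D.r τ j).2, rfl⟩, ?_⟩
      have h : ((address D.r τ j : L) : EuclideanSpace ℝ (Fin n)) + (address D.r a δ : Lᗮ) =
          address D.r D.t fun k => (j k, δ k) := by
        rw [coe_address D.r_pos.le D.r_lt_one hτ, coe_address D.r_pos.le D.r_lt_one ha]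
        simp only [address, ht, smul_add]
        exact ((summable_address (v := fun i => (τ i : EuclideanSpace ℝ (Fin n))) D.r_pos.le
          D.r_lt_one hτ j).tsum_add (summable_address
            (v := fun i => (a i : EuclideanSpace ℝ (Fin n))) D.r_pos.le D.r_lt_one ha δ)).symm
      have hy := norm_address_le D.ρ_pos.le D.ρ_lt_one (fun i => (D.u_norm i).le)
        fun k => (j k, δ k)
      simp only [h, D.toFun_address]
      exact radial_of_le (hy.trans (by norm_num))
end
end
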